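/- Let q be a prime power and let n ≥ 1 be an integer satisfying n < (q−1)/(2√q) + 1 (as real numbers). Fix a nontrivial additive character ψ : F_q → ℂˣ. Let χ₁, χ₂ : F_{q^n}ˣ → ℂˣ be multiplicative characters such that G(χ₁·η, ψ) = G(χ₂·η, ψ) for every multiplicative character η : F_qˣ → ℂˣ. Then χ₁ and χ₂ are Frobenius-equivalent, i.e. there exists an integer j such that χ₁(x) = χ₂(x^(q^j)) for all x ∈ F_{q^n}ˣ. -/

import Mathlib

open scoped Classical

/-- The Gauss sum over `E` of the character `χ` twisted by the character `η` of the
base field `F` (pulled back via the norm map), with respect to the additive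
character `ψ` of `F` (composed with the trace map):
`G(χ·η, ψ) = ∑_{x ∈ Eˣ} χ(x) η(Nm(x)) ψ(Tr(x))`. -/
noncomputable def twistedGaussSum (F : Type) {E : Type} [Field F] [Field E] [Fintype F]
    [Fintype E] [Algebra F E] (χ : Eˣ →* ℂˣ) (η : Fˣ →* ℂˣ) (ψ : AddChar F ℂ) : ℂ :=
  ∑ x : Eˣ, ((χ x : ℂ) * (η (Units.map (Algebra.norm F : E →* F) x) : ℂ)) *
    ψ (Algebra.trace F E (x : E))

section Teichmuller

variable {B : Type*} [CommRing B] [IsDomain B] [IsLocalRing B]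

open Polynomial IsLocalRing in
theorem exists_teichmuller_character {p : ℕ} [Fact p.Prime] [CharP (ResidueField B) p]
    (E : Type*) [Field E] [Fintype E] [CharP E p] {θ : B}
    (hθ : IsPrimitiveRoot θ (Fintype.card E - 1)) :
    ∃ (ω : Eˣ →* Bˣ) (ι : E →+* ResidueField B), Function.Injective ω ∧
      ∀ y : Eˣ, residue B (ω y : B) = ι y := by
  set M := Fintype.card E - 1 with hM
  have hcard : 1 < Fintype.card E := Fintype.one_lt_card
  have hMcast : ((M : ℕ) : ResidueField B) = -1 := by
    have h1 : ((Fintype.card E : ℕ) : ResidueField B) = 0 := by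
      obtain ⟨m, -, hm⟩ := FiniteField.card E p
      rw [hm, Nat.cast_pow, CharP.cast_eq_zero, zero_pow m.ne_zero]
    rw [hM, Nat.cast_sub hcard.le, h1]; simp
  have : NeZero ((M : ℕ) : ResidueField B) := ⟨by rw [hMcast]; simp⟩
  have hMpos : 0 < M := by omega
  have : NeZero M := ⟨hMpos.ne'⟩
  have hθ' : IsPrimitiveRoot (residue B θ) M := by
    rw [← isRoot_cyclotomic_iff, ← map_cyclotomic M (residue B)]
    exact (hθ.isRoot_cyclotomic hMpos).map
  let _ : Algebra (ZMod p) (ResidueField B) := ZMod.algebra _ p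
  let _ : Algebra (ZMod p) E := ZMod.algebra _ p
  have hsplit : ((X ^ Fintype.card E - X : (ZMod p)[X]).map
      (algebraMap (ZMod p) (ResidueField B))).Splits := by
    have : (X ^ Fintype.card E - X : (ZMod p)[X]).map
        (algebraMap (ZMod p) (ResidueField B)) = X * (X ^ M - 1) := by
      have h2 : Fintype.card E = M + 1 := by omega
      simp only [Polynomial.map_sub, Polynomial.map_pow, Polynomial.map_X]
      rw [h2]; ring
    rw [this]
    exact (Splits.X).mul (X_pow_sub_one_splits hθ')
  let ι : E →+* ResidueField B :=
    (IsSplittingField.lift E (X ^ Fintype.card E - X : (ZMod p)[X]) hsplit).toRingHom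
  obtain ⟨g, hg⟩ := IsCyclic.exists_generator (α := Eˣ)
  have hog : orderOf g = M := by
    rw [orderOf_eq_card_of_forall_mem_zpowers hg, Nat.card_eq_fintype_card, Fintype.card_units]
  have hgM : (ι g) ^ M = 1 := by
    rw [← map_pow, ← Units.val_pow_eq_pow_val, ← hog, pow_orderOf_eq_one]; simp
  obtain ⟨k, -, hk⟩ := hθ'.eq_pow_of_pow_eq_one hgM
  let t : Bˣ := (hθ.isUnit hMpos.ne').unit
  have ht : (t : B) = θ := rfl
  have htM : t ^ M = 1 := by ext; simp [ht, hθ.pow_eq_one]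
  have hord : orderOf (t ^ k) ∣ orderOf g := by
    rw [hog]
    apply orderOf_dvd_of_pow_eq_one
    rw [← pow_mul, mul_comm, pow_mul, htM, one_pow]
  let ω := monoidHomOfForallMemZpowers hg hord
  have hω : ω g = t ^ k := monoidHomOfForallMemZpowers_apply_gen hg hord
  have key : ∀ y : Eˣ, residue B (ω y : B) = ι y := by
    intro y
    obtain ⟨m, rfl⟩ := mem_powers_iff_mem_zpowers.mpr (hg y)
    simp only [map_pow, hω, Units.val_pow_eq_pow_val]
    rw [ht, hk]
  refine ⟨ω, ι, ?_, key⟩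
  rw [injective_iff_map_eq_one]
  intro y hy
  have := key y
  rw [hy] at this
  ext
  apply ι.injective
  rw [← this]; simp

end Teichmuller

theorem exists_valuationSubring_of_prime (p : ℕ) (hp : p.Prime) :
    ∃ B : ValuationSubring ℂ, ¬ IsUnit (p : B) ∧ ∀ z : ℂ, IsIntegral ℤ z → z ∈ B := by
  let A : Subring ℂ := (integralClosure ℤ ℂ).toSubring
  have hI : Ideal.span {(p : A)} ≠ ⊤ := by
    rw [Ne, Ideal.span_singleton_eq_top]
    rintro hu
    obtain ⟨b, hb⟩ := isUnit_iff_exists_inv.mp hu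
    have hbi : IsIntegral ℤ ((b : ℂ)) := b.2
    have hb' : (p : ℂ) * (b : ℂ) = 1 := by exact_mod_cast congrArg Subtype.val hb
    have hp0 : (p : ℂ) ≠ 0 := by exact_mod_cast hp.ne_zero
    have hbq : (b : ℂ) = algebraMap ℚ ℂ ((p : ℚ)⁻¹) := by
      rw [eq_comm]; simp; field_simp; rw [← hb']
    rw [hbq, isIntegral_algebraMap_iff (algebraMap ℚ ℂ).injective] at hbi
    obtain ⟨m, hm⟩ := (IsIntegrallyClosed.isIntegral_iff (R := ℤ)).mp hbi
    have hm' : ((m * p : ℤ) : ℚ) = 1 := by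
      have hp0' : (p : ℚ) ≠ 0 := by exact_mod_cast hp.ne_zero
      have : (m : ℚ) = (p : ℚ)⁻¹ := by simpa using hm
      push_cast; rw [this]; field_simp
    have : m * p = 1 := by exact_mod_cast hm'
    have h1 : (p : ℤ) ∣ 1 := ⟨m, by linarith⟩
    have := Int.le_of_dvd one_pos h1
    have := hp.two_le
    omega
  obtain ⟨B, hAB, hB⟩ := Ideal.image_subset_nonunits_valuationSubring (A := A) _ hI
  refine ⟨B, ?_, fun z hz => hAB hz⟩
  have : ((p : A) : ℂ) ∈ B.nonunits := hB ⟨_, Ideal.subset_span rfl, rfl⟩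
  have h2 : (((p : B) : B) : ℂ) ∈ B.nonunits := by simpa using this
  rwa [ValuationSubring.coe_mem_nonunits_iff, IsLocalRing.mem_maximalIdeal, mem_nonunits_iff] at h2

section GaussSumDivisibility

open IsLocalRing

variable {B : Type*} [CommRing B] {p : ℕ}
  {E : Type*} [Field E] [Fintype E]

variable [IsDomain B]

theorem gaussSum_pow_add_dvd (χ : MulChar E B) {Ψ : AddChar E B} (hΨ : Ψ ≠ 1) (a b : ℕ) :
    gaussSum (χ ^ (a + b)) Ψ ∣ gaussSum (χ ^ a) Ψ * gaussSum (χ ^ b) Ψ := by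
  by_cases h : χ ^ (a + b) = 1
  · rw [h, gaussSum_one_left hΨ]
    exact (isUnit_one.neg).dvd
  · rw [pow_add] at h ⊢
    exact ⟨_, (jacobiSum_mul_nontrivial h Ψ).symm⟩

theorem gaussSum_pow_mul_dvd (χ : MulChar E B) {Ψ : AddChar E B} (hΨ : Ψ ≠ 1) {π : B} {c : ℕ}
    (h : gaussSum (χ ^ c) Ψ ∣ π) (d : ℕ) : gaussSum (χ ^ (d * c)) Ψ ∣ π ^ d := by
  induction d with
  | zero =>
    rw [zero_mul, pow_zero, gaussSum_one_left hΨ]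
    exact (isUnit_one.neg).dvd
  | succ d ih =>
    rw [add_mul, one_mul, pow_succ]
    exact (gaussSum_pow_add_dvd χ hΨ _ _).trans (mul_dvd_mul ih h)

theorem gaussSum_pow_dvd_of_digits (χ : MulChar E B) {Ψ : AddChar E B} (hΨ : Ψ ≠ 1) {π : B}
    {L : ℕ} (h : ∀ i < L, gaussSum (χ ^ (p ^ i)) Ψ ∣ π) (l : List ℕ) (k : ℕ)
    (hl : k + l.length ≤ L) :
    gaussSum (χ ^ (p ^ k * Nat.ofDigits p l)) Ψ ∣ π ^ l.sum := by
  induction l generalizing k with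
  | nil =>
    simp only [Nat.ofDigits_nil, mul_zero, pow_zero, List.sum_nil]
    rw [gaussSum_one_left hΨ]
    exact (isUnit_one.neg).dvd
  | cons d l ih =>
    simp only [List.length_cons] at hl
    rw [Nat.ofDigits_cons, List.sum_cons, pow_add, mul_add, ← mul_assoc, ← pow_succ]
    refine (gaussSum_pow_add_dvd χ hΨ _ _).trans (mul_dvd_mul ?_ (ih (k + 1) (by omega)))
    rw [mul_comm]
    exact gaussSum_pow_mul_dvd χ hΨ (h k (by omega)) _

theorem sum_units_pow_mul_pow [Fact p.Prime] {L : ℕ} (hE : Fintype.card E = p ^ L) {i j : ℕ}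
    (hi : i < L) (hj : j < L) :
    ∑ y : E, (y⁻¹) ^ p ^ i * y ^ p ^ j = if i = j then -1 else 0 := by
  have hp1 : 1 < p := (Fact.out : p.Prime).one_lt
  have hpi : 0 < p ^ i := by positivity
  have hpj : 0 < p ^ j := by positivity
  have hpiL : p ^ i < p ^ L := Nat.pow_lt_pow_right hp1 hi
  have hpjL : p ^ j < p ^ L := Nat.pow_lt_pow_right hp1 hj
  have h1 : ∑ y : E, (y⁻¹) ^ p ^ i * y ^ p ^ j =
      ∑ u : Eˣ, ((u : E) ^ (p ^ j + (p ^ L - 1 - p ^ i))) := by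
    rw [← Fintype.sum_subtype_add_sum_subtype (p := fun y : E => y ≠ 0)]
    have h0 : ∑ y : {y : E // ¬ y ≠ 0}, ((y : E)⁻¹) ^ p ^ i * (y : E) ^ p ^ j = 0 := by
      apply Finset.sum_eq_zero
      rintro ⟨y, hy⟩ -
      have hy : y = 0 := not_not.mp hy
      subst hy
      simp [(Fact.out : p.Prime).ne_zero]
    rw [h0, add_zero]
    symm
    apply Fintype.sum_equiv unitsEquivNeZero
    intro u
    have h2 : ((u : E)) ^ (p ^ L - 1) = 1 := by
      rw [← hE]; exact FiniteField.pow_card_sub_one_eq_one _ u.ne_zero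
    have h3 : (u : E) ^ (p ^ L - 1 - p ^ i) = ((u : E)⁻¹) ^ p ^ i := by
      rw [inv_pow]
      apply eq_inv_of_mul_eq_one_left
      rw [← pow_add, Nat.sub_add_cancel (by omega), h2]
    simp only [unitsEquivNeZero_apply_coe]
    rw [pow_add, h3, mul_comm]
  rw [h1, FiniteField.sum_pow_units, hE]
  congr 1
  rw [eq_iff_iff]
  constructor
  · intro h
    have h2 : p ^ j + (p ^ L - 1 - p ^ i) ≡ 0 [MOD p ^ L - 1] := (Nat.modEq_zero_iff_dvd).mpr h
    have h3 : p ^ j ≡ p ^ i [MOD p ^ L - 1] := by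
      have h4 := h2.add_right (p ^ i)
      rw [add_assoc, Nat.sub_add_cancel (by omega), zero_add] at h4
      exact (by simp [Nat.ModEq] : p ^ j ≡ p ^ j + (p ^ L - 1) [MOD p ^ L - 1]).trans h4
    rcases Nat.lt_trichotomy i j with hij | hij | hij
    · exfalso
      have := (Nat.modEq_iff_dvd' (Nat.pow_le_pow_right hp1.le hij.le)).mp h3.symm
      have h5 := Nat.pow_lt_pow_right hp1 hij
      have := Nat.le_of_dvd (by omega) this
      omega
    · exact hij
    · exfalso
      have := (Nat.modEq_iff_dvd' (Nat.pow_le_pow_right hp1.le hij.le)).mp h3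
      have h5 := Nat.pow_lt_pow_right hp1 hij
      have := Nat.le_of_dvd (by omega) this
      omega
  · rintro rfl
    refine ⟨1, ?_⟩
    omega

variable [IsLocalRing B] [Fact p.Prime] [CharP (ResidueField B) p] {ω : Eˣ →* Bˣ} {ι : E →+* ResidueField B}

theorem residue_ofUnitHom (hω : ∀ y : Eˣ, residue B (ω y : B) = ι y) (y : E) :
    residue B (MulChar.ofUnitHom ω y) = ι y := by
  by_cases hy : y = 0
  · subst hy
    rw [MulChar.map_zero]; simp
  · obtain ⟨u, rfl⟩ := (isUnit_iff_ne_zero.mpr hy)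
    rw [MulChar.ofUnitHom_coe, hω]

theorem residue_eq_one_of_pow_eq_one {ζ : B} (hζ : ζ ^ p = 1) : residue B ζ = 1 := by
  have h : (residue B ζ - 1) ^ p = 0 := by
    rw [sub_pow_char, ← map_pow, hζ]; simp
  exact sub_eq_zero.mp (pow_eq_zero_iff (Fact.out : p.Prime).ne_zero |>.mp h)

/-- The additive character `y ↦ ζ ^ Tr y` of a finite field of characteristic `p`. -/
noncomputable def traceAddChar (E : Type*) [Field E] [CharP E p] {B : Type*} [CommRing B] {ζ : B} (hζ : ζ ^ p = 1) :
    AddChar E B :=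
  letI : Algebra (ZMod p) E := ZMod.algebra E p
  (AddChar.zmodChar p hζ).compAddMonoidHom (Algebra.trace (ZMod p) E).toAddMonoidHom

theorem gaussSum_traceAddChar_dvd [CharP E p] (hωinj : Function.Injective ω)
    (hω : ∀ y : Eˣ, residue B (ω y : B) = ι y) {ζ : B} (hζ : ζ ^ p = 1) {L : ℕ}
    (hE : Fintype.card E = p ^ L) {i : ℕ} (hi : i < L)
    (hiM : p ^ i ≠ p ^ L - 1) :
    gaussSum ((MulChar.ofUnitHom ω)⁻¹ ^ p ^ i) (traceAddChar E hζ) ∣ ζ - 1 := by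
  have hp1 : 1 < p := (Fact.out : p.Prime).one_lt
  have hpi : 0 < p ^ i := by positivity
  have hpiL : p ^ i < p ^ L := Nat.pow_lt_pow_right hp1 hi
  let _ : Algebra (ZMod p) E := ZMod.algebra E p
  set χ := (MulChar.ofUnitHom ω)⁻¹ ^ p ^ i with hχ
  let τ : E → ZMod p := fun y => Algebra.trace (ZMod p) E y
  let c : E → B := fun y => ∑ m ∈ Finset.range (τ y).val, ζ ^ m
  have hΨ : ∀ y : E, traceAddChar E hζ y = 1 + c y * (ζ - 1) := by
    intro y
    simp only [c]
    rw [geom_sum_mul]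
    simp [traceAddChar, AddChar.zmodChar_apply, τ]
  have hχ1 : χ ≠ 1 := by
    intro h
    obtain ⟨g, hg⟩ := IsCyclic.exists_generator (α := Eˣ)
    have hog : orderOf g = p ^ L - 1 := by
      rw [orderOf_eq_card_of_forall_mem_zpowers hg, Nat.card_eq_fintype_card, Fintype.card_units, hE]
    have h1 : χ g = 1 := by rw [h]; simp
    rw [hχ, MulChar.pow_apply_coe, MulChar.inv_apply', ← Units.val_inv_eq_inv_val,
      MulChar.ofUnitHom_coe, ← Units.val_pow_eq_pow_val, ← map_pow, Units.val_eq_one,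
      ← map_one ω] at h1
    have h2 := hωinj h1
    rw [inv_pow, inv_eq_one] at h2
    have h3 := orderOf_dvd_of_pow_eq_one h2
    rw [hog] at h3
    have := Nat.le_of_dvd hpi h3
    omega
  have hG : gaussSum χ (traceAddChar E hζ) = (∑ y, χ y * c y) * (ζ - 1) := by
    unfold gaussSum
    simp_rw [hΨ, mul_add, mul_one, Finset.sum_add_distrib, χ.sum_eq_zero_of_ne_one hχ1, zero_add,
      Finset.sum_mul, mul_assoc]
  have hres : residue B (∑ y, χ y * c y) = -1 := by
    have h1 : ∀ y : E, residue B (χ y * c y) =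
        ι ((y⁻¹) ^ p ^ i * ∑ j ∈ Finset.range L, y ^ p ^ j) := by
      intro y
      have hfin : Module.finrank (ZMod p) E = L := by
        have := Module.card_eq_pow_finrank (K := ZMod p) (V := E)
        rw [hE, ZMod.card] at this
        exact (Nat.pow_right_injective hp1 this).symm
      have h2 : residue B (χ y) = ι ((y⁻¹) ^ p ^ i) := by
        rw [hχ, MulChar.pow_apply' _ hpi.ne', MulChar.inv_apply', map_pow,
          residue_ofUnitHom hω, map_pow]
      have h3 : residue B (c y) = ι (∑ j ∈ Finset.range L, y ^ p ^ j) := by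
        have h4 := FiniteField.algebraMap_trace_eq_sum_pow (ZMod p) E y
        rw [hfin, Nat.card_zmod] at h4
        rw [← h4]
        simp only [c, map_sum, map_pow, residue_eq_one_of_pow_eq_one hζ, one_pow, Finset.sum_const,
          Finset.card_range, nsmul_eq_mul, mul_one]
        change _ = ι (algebraMap (ZMod p) E (τ y))
        conv_rhs => rw [← ZMod.natCast_zmod_val (τ y)]
        rw [map_natCast, map_natCast]
      rw [map_mul, h2, h3, map_mul]
    rw [map_sum]
    simp_rw [h1]
    rw [← map_sum]
    simp_rw [Finset.mul_sum]
    rw [Finset.sum_comm]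
    have : ∀ j ∈ Finset.range L, ∑ y : E, (y⁻¹) ^ p ^ i * y ^ p ^ j = if i = j then -1 else 0 :=
      fun j hj => sum_units_pow_mul_pow hE hi (Finset.mem_range.mp hj)
    rw [Finset.sum_congr rfl this, Finset.sum_ite_eq]
    simp [hi]
  have hu : IsUnit (∑ y, χ y * c y) := by
    have : residue B (∑ y, χ y * c y) ≠ 0 := by rw [hres]; simp
    exact (residue_ne_zero_iff_isUnit _).mp this
  rw [hG]
  obtain ⟨v, hv⟩ := hu
  rw [← hv]
  exact ⟨↑v⁻¹, by rw [mul_right_comm]; simp⟩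

end GaussSumDivisibility

theorem sum_digits_eq_mod_add {p : ℕ} (hp : 1 < p) (a : ℕ) :
    (p.digits a).sum = a % p + (p.digits (a / p)).sum := by
  rcases Nat.eq_zero_or_pos a with rfl | ha
  · simp
  · rw [Nat.digits_def' hp ha, List.sum_cons]

theorem exists_complementary_digits {p : ℕ} (hp : 1 < p) (L a : ℕ) (ha : a < p ^ L) :
    ∃ l : List ℕ, l.length = L ∧ Nat.ofDigits p l + a + 1 = p ^ L ∧
      l.sum + (p.digits a).sum = (p - 1) * L := by
  induction L generalizing a with
  | zero =>
    obtain rfl : a = 0 := by simpa using ha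
    exact ⟨[], by simp⟩
  | succ L ih =>
    have hlt : a / p < p ^ L := by
      rw [Nat.div_lt_iff_lt_mul (by omega), ← pow_succ]; exact ha
    obtain ⟨l, h1, h2, h3⟩ := ih (a / p) hlt
    have hm := Nat.mod_lt a (by omega : 0 < p)
    refine ⟨(p - 1 - a % p) :: l, by simp [h1], ?_, ?_⟩
    · rw [Nat.ofDigits_cons, pow_succ, ← h2]
      have h4 : p - 1 - a % p + a % p + 1 = p := by omega
      have h5 := Nat.div_add_mod a p
      calc p - 1 - a % p + p * Nat.ofDigits p l + a + 1
          = p - 1 - a % p + p * Nat.ofDigits p l + (p * (a / p) + a % p) + 1 := by rw [h5]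
        _ = p * Nat.ofDigits p l + p * (a / p) + (p - 1 - a % p + a % p + 1) := by ring
        _ = _ := by rw [h4]; ring
    · rw [List.sum_cons, sum_digits_eq_mod_add hp, mul_add, ← h3]
      omega

section Associated

open IsLocalRing

variable {B : Type*} [CommRing B] {p : ℕ} [IsDomain B]
  {E : Type*} [Field E] [Fintype E]

theorem associated_sub_one_pow_prime [Fact p.Prime] {ζ : B} (hζ : IsPrimitiveRoot ζ p) :
    Associated (p : B) ((ζ - 1) ^ (p - 1)) := by
  have hp := (Fact.out : p.Prime)
  obtain ⟨m, rfl⟩ : ∃ m, p = m + 1 := ⟨p - 1, by have := hp.one_lt; omega⟩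
  have h := hζ.prod_one_sub_pow_eq_order
  have h2 : Associated (∏ k ∈ Finset.range m, (1 - ζ ^ (k + 1)))
      (∏ k ∈ Finset.range m, (ζ - 1)) := by
    apply Associated.prod
    intro k hk
    have hk := Finset.mem_range.mp hk
    have hcop : (k + 1).Coprime (m + 1) :=
      (Nat.coprime_of_lt_prime (by omega) (by omega) hp).symm
    have h3 := hζ.associated_sub_one_pow_sub_one_of_coprime hcop
    rw [← neg_sub]
    exact h3.symm.neg_left
  rw [h] at h2
  simpa using h2

variable [IsLocalRing B] [Fact p.Prime] [CharP (ResidueField B) p] [CharP E p]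
  {ω : Eˣ →* Bˣ} {ι : E →+* ResidueField B}

theorem associated_gaussSum_pow_sum_digits (hωinj : Function.Injective ω)
    (hω : ∀ y : Eˣ, residue B (ω y : B) = ι y) {ζ : B} (hζ : IsPrimitiveRoot ζ p) {L : ℕ}
    (hE : Fintype.card E = p ^ L) {Ψ : AddChar E B} (hΨ : Ψ ≠ 1) {c : Eˣ}
    (hc : Ψ = (traceAddChar E hζ.pow_eq_one).mulShift c) {a : ℕ} (ha : a < p ^ L - 1) :
    Associated (gaussSum ((MulChar.ofUnitHom ω)⁻¹ ^ a) Ψ) ((ζ - 1) ^ (p.digits a).sum) := by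
  have hp := (Fact.out : p.Prime)
  have hp1 := hp.one_lt
  set χ := (MulChar.ofUnitHom ω)⁻¹ with hχ
  rcases Nat.eq_zero_or_pos a with rfl | hapos
  · simp only [pow_zero, Nat.digits_zero, List.sum_nil]
    rw [gaussSum_one_left hΨ]
    exact (Associated.refl (1 : B)).neg_left
  have hordg : ∀ m : ℕ, χ ^ m = 1 ↔ p ^ L - 1 ∣ m := by
    intro m
    obtain ⟨g, hg⟩ := IsCyclic.exists_generator (α := Eˣ)
    have hog : orderOf g = p ^ L - 1 := by
      rw [orderOf_eq_card_of_forall_mem_zpowers hg, Nat.card_eq_fintype_card, Fintype.card_units, hE]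
    rw [← hog]
    constructor
    · intro h
      have h1 : (χ ^ m) g = 1 := by rw [h]; simp
      rw [hχ, MulChar.pow_apply_coe, MulChar.inv_apply', ← Units.val_inv_eq_inv_val,
        MulChar.ofUnitHom_coe, ← Units.val_pow_eq_pow_val, ← map_pow, Units.val_eq_one,
        ← map_one ω] at h1
      have h2 := hωinj h1
      rw [inv_pow, inv_eq_one] at h2
      exact orderOf_dvd_of_pow_eq_one h2
    · intro h
      ext y
      obtain ⟨k, rfl⟩ := mem_powers_iff_mem_zpowers.mpr (hg y)
      rw [hχ, MulChar.pow_apply_coe, MulChar.inv_apply', ← Units.val_inv_eq_inv_val,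
        MulChar.ofUnitHom_coe, ← Units.val_pow_eq_pow_val, ← map_pow]
      simp only [inv_pow]
      rw [pow_right_comm, orderOf_dvd_iff_pow_eq_one.mp h]
      simp
  have hdiv : ∀ i < L, gaussSum (χ ^ p ^ i) Ψ ∣ ζ - 1 := by
    intro i hi
    have hiM : p ^ i ≠ p ^ L - 1 := by
      have h1 : p ^ i ≤ p ^ (L - 1) := Nat.pow_le_pow_right hp1.le (by omega)
      have h2 : p ^ L = p * p ^ (L - 1) := by
        rw [← pow_succ']; congr 1; omega
      have h3 : 0 < p ^ (L - 1) := by positivity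
      have h4 : 2 * p ^ (L - 1) ≤ p * p ^ (L - 1) := Nat.mul_le_mul_right _ hp1
      omega
    have h1 := gaussSum_traceAddChar_dvd hωinj hω hζ.pow_eq_one hE hi hiM
    rw [← gaussSum_mulShift _ _ c, ← hc] at h1
    exact (dvd_mul_left _ _).trans h1
  have hA : gaussSum (χ ^ a) Ψ ∣ (ζ - 1) ^ (p.digits a).sum := by
    have h := gaussSum_pow_dvd_of_digits χ hΨ hdiv (p.digits a) 0 (by
      rw [zero_add]
      exact (Nat.digits_length_le_iff hp1 a).mpr (by omega))
    rwa [pow_zero, one_mul, Nat.ofDigits_digits] at h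
  obtain ⟨l, hl1, hl2, hl3⟩ := exists_complementary_digits hp1 L a (by omega)
  have hA' : gaussSum (χ ^ (p ^ L - 1 - a)) Ψ ∣ (ζ - 1) ^ l.sum := by
    have h := gaussSum_pow_dvd_of_digits χ hΨ hdiv l 0 (by omega)
    rwa [pow_zero, one_mul, (by omega : Nat.ofDigits p l = p ^ L - 1 - a)] at h
  have hχa : χ ^ a ≠ 1 := by
    rw [Ne, hordg]
    intro h
    have := Nat.le_of_dvd hapos h
    omega
  have hinv : χ ^ (p ^ L - 1 - a) = (χ ^ a)⁻¹ := by
    apply eq_inv_of_mul_eq_one_left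
    rw [← pow_add, Nat.sub_add_cancel ha.le, hordg]
  have hprod : Associated (gaussSum (χ ^ a) Ψ * gaussSum (χ ^ (p ^ L - 1 - a)) Ψ)
      ((ζ - 1) ^ ((p - 1) * L)) := by
    have h1 := gaussSum_mul_gaussSum_eq_card hχa (AddChar.IsPrimitive.of_ne_one hΨ)
    have h2 := mul_gaussSum_inv_eq_gaussSum (χ ^ a)⁻¹ Ψ
    rw [hinv, ← h2]
    have h3 : Associated ((p : B) ^ L) ((ζ - 1) ^ ((p - 1) * L)) := by
      rw [pow_mul]; exact (associated_sub_one_pow_prime hζ).pow_pow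
    refine Associated.trans ?_ h3
    rw [mul_left_comm, h1, hE, Nat.cast_pow]
    have hunit : IsUnit ((χ ^ a)⁻¹ (-1)) := by
      have : IsUnit (-1 : E) := isUnit_one.neg
      exact this.map _
    exact (associated_isUnit_mul_left_iff hunit).mpr (Associated.refl _)
  rw [← hl3, add_comm l.sum, pow_add] at hprod
  obtain ⟨u, hu⟩ := hA
  obtain ⟨u', hu'⟩ := hA'
  have hne : (ζ - 1) ≠ 0 := sub_ne_zero.mpr (hζ.ne_one hp1)
  have hA0 : gaussSum (χ ^ a) Ψ * gaussSum (χ ^ (p ^ L - 1 - a)) Ψ ≠ 0 := by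
    rw [Ne, hprod.eq_zero_iff]
    exact mul_ne_zero (pow_ne_zero _ hne) (pow_ne_zero _ hne)
  have huu : IsUnit (u * u') := by
    obtain ⟨w, hw⟩ := hprod
    rw [hu, hu', mul_mul_mul_comm] at hw
    have := mul_left_cancel₀ hA0 hw
    rw [← this]; exact w.isUnit
  have hu1 : IsUnit u := isUnit_of_mul_isUnit_left huu
  rw [hu]
  exact (associated_mul_isUnit_right_iff hu1).mpr (Associated.refl _)

end Associated

open Polynomial in
theorem sum_hom_pow_mul_addChar_conj {p : ℕ} [Fact p.Prime] {E : Type*} [Field E] [Fintype E]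
    [CharP E p] (ω : Eˣ →* ℂˣ) (Ψ : AddChar E ℂ) {a b κ : ℕ}
    (hκ : κ.Coprime (Fintype.card E - 1))
    (h : ∑ u : Eˣ, ((ω u : ℂ)) ^ a * Ψ (u : E) = ∑ u : Eˣ, ((ω u : ℂ)) ^ b * Ψ (u : E)) :
    ∑ u : Eˣ, ((ω u : ℂ)) ^ (κ * a) * Ψ (u : E) =
      ∑ u : Eˣ, ((ω u : ℂ)) ^ (κ * b) * Ψ (u : E) := by
  have hp := (Fact.out : p.Prime)
  set M := Fintype.card E - 1 with hM
  have hcard : 1 < Fintype.card E := Fintype.one_lt_card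
  have hMpos : 0 < M := by omega
  have hcop : p.Coprime M := by
    obtain ⟨m, -, hm⟩ := FiniteField.card E p
    rw [hp.coprime_iff_not_dvd]
    intro hd
    have h1 : p ∣ M + 1 := by
      have : M + 1 = p ^ (m : ℕ) := by omega
      rw [this]; exact dvd_pow_self _ m.ne_zero
    exact hp.one_lt.ne' (Nat.dvd_one.mp ((Nat.dvd_add_right hd).mp h1))
  obtain ⟨k, hkp, hkM⟩ := Nat.chineseRemainder hcop 1 κ
  have hkcop : k.Coprime (p * M) := by
    apply Nat.Coprime.mul_right
    · rw [Nat.Coprime, hkp.gcd_eq]; simp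
    · rw [Nat.Coprime, hkM.gcd_eq]; exact hκ
  have hpM : p * M ≠ 0 := by have := hp.pos; positivity
  set ξ : ℂ := Complex.exp (2 * Real.pi * Complex.I / (p * M : ℕ)) with hξdef
  have hξ : IsPrimitiveRoot ξ (p * M) := Complex.isPrimitiveRoot_exp _ hpM
  clear_value ξ
  have hξp : IsPrimitiveRoot (ξ ^ M) p := hξ.pow (Nat.pos_of_ne_zero hpM) (mul_comm _ _)
  have hξM : IsPrimitiveRoot (ξ ^ p) M := hξ.pow (Nat.pos_of_ne_zero hpM) rfl
  have : NeZero p := ⟨hp.ne_zero⟩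
  have : NeZero M := ⟨hMpos.ne'⟩
  have hm : ∀ u : Eˣ, ∃ m : ℕ, (ω u : ℂ) = (ξ ^ p) ^ m := by
    intro u
    have h1 : u ^ M = 1 := by
      have := pow_card_eq_one (x := u)
      rwa [Fintype.card_units] at this
    have h2 : (ω u : ℂ) ^ M = 1 := by
      rw [← Units.val_pow_eq_pow_val, ← map_pow, h1]; simp
    obtain ⟨m, -, hm⟩ := hξM.eq_pow_of_pow_eq_one h2
    exact ⟨m, hm.symm⟩
  have ht : ∀ u : Eˣ, ∃ t : ℕ, Ψ (u : E) = (ξ ^ M) ^ t := by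
    intro u
    have h2 : (Ψ (u : E)) ^ p = 1 := by
      rw [← AddChar.map_nsmul_eq_pow]; simp
    obtain ⟨m, -, hm⟩ := hξp.eq_pow_of_pow_eq_one h2
    exact ⟨m, hm.symm⟩
  choose m hm using hm
  choose t ht using ht
  let P : ℕ → ℤ[X] := fun a => ∑ u : Eˣ, X ^ (p * m u * a + M * t u)
  have hP : ∀ a, aeval ξ (P a) = ∑ u : Eˣ, ((ω u : ℂ)) ^ a * Ψ (u : E) := by
    intro a
    simp only [P, map_sum, map_pow, aeval_X]
    refine Finset.sum_congr rfl fun u _ => ?_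
    rw [hm, ht, pow_add, pow_mul, pow_mul, pow_mul]
  have hPk : ∀ a, aeval (ξ ^ k) (P a) = ∑ u : Eˣ, ((ω u : ℂ)) ^ (κ * a) * Ψ (u : E) := by
    intro a
    simp only [P, map_sum, map_pow, aeval_X]
    refine Finset.sum_congr rfl fun u _ => ?_
    have h1 : (ξ ^ M) ^ k = ξ ^ M := by
      conv_rhs => rw [← pow_one (ξ ^ M)]
      rw [pow_eq_pow_mod k hξp.pow_eq_one, hkp, ← pow_eq_pow_mod 1 hξp.pow_eq_one]
    have h2 : (ξ ^ p) ^ k = (ξ ^ p) ^ κ :=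
      by
      rw [pow_eq_pow_mod k hξM.pow_eq_one, hkM, ← pow_eq_pow_mod κ hξM.pow_eq_one]
    calc (ξ ^ k) ^ (p * m u * a + M * t u) = (((ξ ^ p) ^ k) ^ m u) ^ a * ((ξ ^ M) ^ k) ^ t u := by
          simp only [← pow_mul, ← pow_add]; congr 1; ring
      _ = _ := by
          rw [h1, h2, hm, ht]
          simp only [← pow_mul, ← pow_add]; congr 1; ring
  have hroot : aeval ξ (P a - P b) = 0 := by rw [map_sub, hP, hP, h, sub_self]
  have hdvd : minpoly ℤ ξ ∣ P a - P b :=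
    minpoly.isIntegrallyClosed_dvd (hξ.isIntegral (Nat.pos_of_ne_zero hpM)) hroot
  rw [hξ.minpoly_eq_pow_coprime hkcop] at hdvd
  have := aeval_eq_zero_of_dvd_aeval_eq_zero hdvd (minpoly.aeval ℤ (ξ ^ k))
  rw [map_sub, hPk, hPk, sub_eq_zero] at this
  exact this

theorem gaussSum_eq_sum_units {E R : Type*} [Field E] [Fintype E] [CommRing R] (χ : MulChar E R)
    (Ψ : AddChar E R) : gaussSum χ Ψ = ∑ u : Eˣ, χ (u : E) * Ψ (u : E) := by
  unfold gaussSum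
  rw [← Fintype.sum_subtype_add_sum_subtype (p := fun y : E => y ≠ 0)]
  have h0 : ∑ y : {y : E // ¬ y ≠ 0}, χ (y : E) * Ψ (y : E) = 0 := by
    apply Finset.sum_eq_zero
    rintro ⟨y, hy⟩ -
    obtain rfl : y = 0 := not_not.mp hy
    rw [MulChar.map_zero, zero_mul]
  rw [h0, add_zero]
  symm
  apply Fintype.sum_equiv unitsEquivNeZero
  intro u
  simp

open IsLocalRing in
theorem exists_hom_sum_digits_eq_of_gaussSum_eq {p L : ℕ} [Fact p.Prime] {E : Type} [Field E]
    [Fintype E] [CharP E p] (hE : Fintype.card E = p ^ L) {Ψ : AddChar E ℂ} (hΨ : Ψ ≠ 1) :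
    ∃ ω : Eˣ →* ℂˣ, Function.Injective ω ∧ ∀ a b : ℕ, a < p ^ L - 1 → b < p ^ L - 1 →
      ∑ u : Eˣ, ((ω u : ℂ)) ^ a * Ψ (u : E) = ∑ u : Eˣ, ((ω u : ℂ)) ^ b * Ψ (u : E) →
      (p.digits a).sum = (p.digits b).sum := by
  have hp := (Fact.out : p.Prime)
  have : NeZero p := ⟨hp.ne_zero⟩
  have hcard : 1 < Fintype.card E := Fintype.one_lt_card
  obtain ⟨B, hpB, hint⟩ := exists_valuationSubring_of_prime p hp
  have hpres : ((p : ℕ) : ResidueField B) = 0 := by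
    rw [← map_natCast (residue B)]
    by_contra hne
    exact hpB ((residue_ne_zero_iff_isUnit _).mp hne)
  have : CharP (ResidueField B) p := (CharP.charP_iff_prime_eq_zero hp).mpr hpres
  have hroots : ∀ m : ℕ, m ≠ 0 → ∃ z : B, IsPrimitiveRoot z m := by
    intro m hm
    have h1 := Complex.isPrimitiveRoot_exp m hm
    exact ⟨⟨_, hint _ (h1.isIntegral (Nat.pos_of_ne_zero hm))⟩,
      IsPrimitiveRoot.of_map_of_injective (f := B.subtype) h1 B.subtype_injective⟩
  obtain ⟨ζ, hζ⟩ := hroots p hp.ne_zero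
  obtain ⟨θ, hθ⟩ := hroots (Fintype.card E - 1) (by omega)
  obtain ⟨ω, ι, hωinj, hω⟩ := exists_teichmuller_character (p := p) E hθ
  have hζC : IsPrimitiveRoot ((ζ : B) : ℂ) p := hζ.map_of_injective (f := B.subtype) B.subtype_injective
  let _ : Algebra (ZMod p) E := ZMod.algebra E p
  have hΨ0C : (traceAddChar E hζC.pow_eq_one) ≠ (1 : AddChar E ℂ) := by
    intro h
    obtain ⟨y, hy⟩ := Algebra.trace_surjective (ZMod p) E 1
    have h1 : traceAddChar E hζC.pow_eq_one y = 1 := by rw [h]; simp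
    simp only [traceAddChar, AddChar.compAddMonoidHom_apply] at h1
    change AddChar.zmodChar p _ (Algebra.trace (ZMod p) E y) = 1 at h1
    rw [hy, AddChar.zmodChar_apply] at h1
    have : Fact (1 < p) := ⟨hp.one_lt⟩
    rw [ZMod.val_one, pow_one] at h1
    exact hζC.ne_one hp.one_lt h1
  have hsurj : Function.Surjective (traceAddChar E hζC.pow_eq_one).mulShift := by
    have hinj := AddChar.to_mulShift_inj_of_isPrimitive (AddChar.IsPrimitive.of_ne_one hΨ0C)
    exact ((Fintype.bijective_iff_injective_and_card _).mpr ⟨hinj, AddChar.card_eq.symm⟩).2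
  obtain ⟨c, hc⟩ := hsurj Ψ
  have hc0 : c ≠ 0 := by
    rintro rfl
    apply hΨ
    rw [← hc]; simp
  set ΨB : AddChar E B := (traceAddChar E hζ.pow_eq_one).mulShift (Units.mk0 c hc0) with hΨB
  have hval : ∀ y : E, ((ΨB y : B) : ℂ) = Ψ y := by
    intro y
    rw [← hc, hΨB]
    simp only [AddChar.mulShift_apply, traceAddChar, AddChar.compAddMonoidHom_apply,
      AddChar.zmodChar_apply, Units.val_mk0]
    simp
  have hΨB1 : ΨB ≠ 1 := by
    intro h
    apply hΨ
    ext y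
    rw [← hval, h]; simp
  let ωC : Eˣ →* ℂˣ := (Units.map (B.subtype : B →* ℂ)).comp ω
  have hG : ∀ a : ℕ, ((gaussSum ((MulChar.ofUnitHom ω)⁻¹ ^ a) ΨB : B) : ℂ) =
      ∑ u : Eˣ, (((ωC⁻¹) u : ℂˣ) : ℂ) ^ a * Ψ (u : E) := by
    intro a
    rw [gaussSum_eq_sum_units]
    have h3 : ∀ z : B, (z : ℂ) = B.subtype z := fun _ => rfl
    rw [h3, map_sum]
    refine Finset.sum_congr rfl fun u _ => ?_
    rw [map_mul, ← h3, ← h3, hval, MulChar.pow_apply_coe, MulChar.inv_apply',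
      ← Units.val_inv_eq_inv_val, MulChar.ofUnitHom_coe, map_inv]
    have h4 : (((ωC⁻¹) u : ℂˣ) : ℂ) = (((ω u)⁻¹ : Bˣ) : B) := by
      rw [MonoidHom.inv_apply, ← map_inv]; simp only [ωC, MonoidHom.comp_apply, ← map_inv]; rfl
    rw [h4]; rfl
  refine ⟨ωC⁻¹, ?_, ?_⟩
  · intro u v huv
    apply hωinj
    simp only [MonoidHom.inv_apply, inv_inj] at huv
    ext
    simpa [ωC] using congrArg (Units.val) huv
  · intro a b ha hb h
    rw [← hG, ← hG] at h
    have h' := Subtype.val_injective h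
    have h1 := associated_gaussSum_pow_sum_digits hωinj hω hζ hE hΨB1 rfl ha
    have h2 := associated_gaussSum_pow_sum_digits hωinj hω hζ hE hΨB1 rfl hb
    rw [h'] at h1
    have h3 := h1.symm.trans h2
    have hne : (ζ - 1) ≠ 0 := sub_ne_zero.mpr (hζ.ne_one hp.one_lt)
    have hnu : ¬ IsUnit (ζ - 1) := by
      rw [← residue_ne_zero_iff_isUnit, not_not, map_sub,
        residue_eq_one_of_pow_eq_one hζ.pow_eq_one]
      simp
    exact le_antisymm ((pow_dvd_pow_iff hne hnu).mp h3.dvd) ((pow_dvd_pow_iff hne hnu).mp h3.symm.dvd)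

theorem exists_eq_pow_of_injective {G : Type*} [CommGroup G] [IsCyclic G] [Finite G]
    {ω : G →* ℂˣ} (hω : Function.Injective ω) (χ : G →* ℂˣ) : ∃ x : ℕ, χ = ω ^ x := by
  obtain ⟨g, hg⟩ := IsCyclic.exists_generator (α := G)
  have hpos : 0 < orderOf g := orderOf_pos g
  have h1 : IsPrimitiveRoot (ω g : ℂ) (orderOf g) := by
    rw [IsPrimitiveRoot.coe_units_iff, ← orderOf_injective ω hω g]
    exact IsPrimitiveRoot.orderOf _
  have h2 : (χ g : ℂ) ^ orderOf g = 1 := by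
    rw [← Units.val_pow_eq_pow_val, ← map_pow, pow_orderOf_eq_one]; simp
  have : NeZero (orderOf g) := ⟨hpos.ne'⟩
  obtain ⟨x, -, hx⟩ := h1.eq_pow_of_pow_eq_one h2
  refine ⟨x, ?_⟩
  ext y
  obtain ⟨k, rfl⟩ := mem_powers_iff_mem_zpowers.mpr (hg y)
  simp only [map_pow, MonoidHom.pow_apply, Units.val_pow_eq_pow_val]
  rw [hx]

theorem exists_exponents_sum_digits_eq {p f n R : ℕ} [Fact p.Prime] (hf : 0 < f) (hn : 1 ≤ n)
    (F E : Type) [Field F] [Field E] [Fintype F] [Fintype E] [Algebra F E]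
    (hF : Fintype.card F = p ^ f) (hE : Fintype.card E = (p ^ f) ^ n)
    (hR : R * (p ^ f - 1) = (p ^ f) ^ n - 1)
    (ψ : AddChar F ℂ) (hψ : ψ ≠ 1) (χ₁ χ₂ : Eˣ →* ℂˣ)
    (h : ∀ η : Fˣ →* ℂˣ, twistedGaussSum F χ₁ η ψ = twistedGaussSum F χ₂ η ψ) :
    ∃ (ω : Eˣ →* ℂˣ) (x x' : ℕ), χ₁ = ω ^ x ∧ χ₂ = ω ^ x' ∧
      ∀ κ : ℕ, κ.Coprime ((p ^ f) ^ n - 1) → ∀ b : ℕ,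
        (p.digits ((κ * x + b * R) % ((p ^ f) ^ n - 1))).sum =
          (p.digits ((κ * x' + b * R) % ((p ^ f) ^ n - 1))).sum := by
  have hp := (Fact.out : p.Prime)
  have hcardE : 1 < Fintype.card E := Fintype.one_lt_card
  have hcardF : 1 < Fintype.card F := Fintype.one_lt_card
  have : CharP E p := by
    rw [CharP.charP_iff_prime_eq_zero hp]
    have := Nat.cast_card_eq_zero E
    rw [hE, Nat.cast_pow, Nat.cast_pow] at this
    exact (pow_eq_zero_iff hf.ne').mp ((pow_eq_zero_iff (by omega)).mp this)
  set M := (p ^ f) ^ n - 1 with hM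
  let Ψ : AddChar E ℂ := ψ.compAddMonoidHom (Algebra.trace F E).toAddMonoidHom
  have hΨ : Ψ ≠ 1 := by
    intro hc
    apply hψ
    ext z
    obtain ⟨y, hy⟩ := Algebra.trace_surjective F E z
    have h1 : Ψ y = 1 := by rw [hc]; simp
    rw [← hy]
    simpa [Ψ] using h1
  obtain ⟨ω, hω, hdig⟩ := exists_hom_sum_digits_eq_of_gaussSum_eq
    (by rw [hE, ← pow_mul] : Fintype.card E = p ^ (f * n)) hΨ
  rw [pow_mul, ← hM] at hdig
  obtain ⟨x, hx⟩ := exists_eq_pow_of_injective hω χ₁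
  obtain ⟨x', hx'⟩ := exists_eq_pow_of_injective hω χ₂
  refine ⟨ω, x, x', hx, hx', fun κ hκ b => ?_⟩
  have hnorm : ∀ u : Eˣ, Units.map (algebraMap F E : F →* E)
      (Units.map (Algebra.norm F : E →* F) u) = u ^ R := by
    intro u
    ext
    have h1 := FiniteField.algebraMap_norm_eq_prod_pow F E (u : E)
    have hfin : Module.finrank F E = n := by
      have := Module.card_eq_pow_finrank (K := F) (V := E)
      rw [hE, hF] at this
      exact (Nat.pow_right_injective (by omega) this).symm
    simp only [Units.coe_map, MonoidHom.coe_coe, Units.val_pow_eq_pow_val]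
    rw [h1, hfin, Nat.card_eq_fintype_card, hF, Finset.prod_pow_eq_pow_sum]
    congr 1
    have h2 := Nat.geomSum_eq (m := p ^ f) (by omega) n
    rw [h2, ← hM, ← hR]
    exact Nat.mul_div_cancel _ (by omega)
  have hsum : ∀ c z : ℕ, twistedGaussSum F (ω ^ z)
      ((ω.comp (Units.map (algebraMap F E : F →* E))) ^ c) ψ =
        ∑ u : Eˣ, ((ω u : ℂ)) ^ (z + c * R) * Ψ (u : E) := by
    intro c z
    unfold twistedGaussSum
    refine Finset.sum_congr rfl fun u _ => ?_
    have h2 : Ψ (u : E) = ψ (Algebra.trace F E (u : E)) := rfl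
    rw [h2, MonoidHom.pow_apply, MonoidHom.pow_apply, MonoidHom.comp_apply, hnorm, map_pow]
    simp only [Units.val_pow_eq_pow_val]
    rw [pow_add, mul_comm c R, pow_mul]
  have hMpos : 0 < M := by omega
  have hωM : ∀ u : Eˣ, (ω u : ℂ) ^ M = 1 := by
    intro u
    have h1 : u ^ M = 1 := by
      have := pow_card_eq_one (x := u)
      rwa [Fintype.card_units, hE] at this
    rw [← Units.val_pow_eq_pow_val, ← map_pow, h1]; simp
  have hκN : κ.Coprime (p ^ f - 1) := hκ.coprime_dvd_right ⟨R, by rw [mul_comm, hR]⟩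
  obtain ⟨c, hc⟩ : ∃ c, κ * c ≡ b [MOD p ^ f - 1] := by
    obtain ⟨d, -, hd⟩ := Nat.exists_mul_mod_eq_of_coprime b hκN (by omega)
    exact ⟨d, hd⟩
  have hcR : ∀ z, (κ * (z + c * R)) ≡ (κ * z + b * R) [MOD M] := by
    intro z
    have h1 := (hc.mul_right' R)
    rw [mul_comm (p ^ f - 1), hR] at h1
    calc κ * (z + c * R) = κ * z + κ * c * R := by ring
      _ ≡ _ [MOD M] := h1.add_left _
  have heq := h ((ω.comp (Units.map (algebraMap F E : F →* E))) ^ c)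
  rw [hx, hx', hsum, hsum] at heq
  have heq2 := sum_hom_pow_mul_addChar_conj (p := p) ω Ψ (by rwa [hE, ← hM]) heq
  have hred : ∀ z u, (ω u : ℂ) ^ (κ * (z + c * R)) = (ω u : ℂ) ^ ((κ * z + b * R) % M) := by
    intro z u
    rw [pow_eq_pow_mod _ (hωM u), hcR z]
  simp_rw [hred] at heq2
  exact hdig _ _ (Nat.mod_lt _ hMpos) (Nat.mod_lt _ hMpos) heq2

theorem pow_mul_mod_pow_sub_one {p L r a : ℕ} (hr : r ≤ L) (ha : a < p ^ L - 1) :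
    p ^ r * a % (p ^ L - 1) + (p ^ L - 1) * (a / p ^ (L - r)) = p ^ r * a := by
  have hp : 0 < p := by
    rcases Nat.eq_zero_or_pos p with rfl | h
    · rcases Nat.eq_zero_or_pos L with rfl | hL
      · simp at ha
      · simp [zero_pow hL.ne'] at ha
    · exact h
  set d := p ^ (L - r) with hd
  have hpL : p ^ L = p ^ r * d := by rw [hd, ← pow_add]; congr 1; omega
  have hd0 : 0 < d := by positivity
  have hr0 : 0 < p ^ r := by positivity
  have h1 := Nat.div_add_mod a d
  have h2 : a % d < d := Nat.mod_lt _ hd0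
  have h3 : a / d < p ^ r := by
    rw [Nat.div_lt_iff_lt_mul hd0, ← hpL]; omega
  set A := a / d
  set l := a % d
  have key : p ^ r * a = (A + p ^ r * l) + (p ^ L - 1) * A := by
    have h5 : p ^ L - 1 + 1 = p ^ L := by omega
    calc p ^ r * a = p ^ r * (d * A + l) := by rw [h1]
      _ = (p ^ L - 1 + 1) * A + p ^ r * l := by rw [h5, hpL]; ring
      _ = _ := by ring
  have hlt : A + p ^ r * l < p ^ L - 1 := by
    by_contra hge
    push Not at hge
    have h6 : p ^ r * l + p ^ r ≤ p ^ L := by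
      rw [hpL]
      calc p ^ r * l + p ^ r = p ^ r * (l + 1) := by ring
        _ ≤ p ^ r * d := Nat.mul_le_mul_left _ h2
    have h7 : A = p ^ r - 1 := by omega
    have h8 : p ^ r * (l + 1) = p ^ r * d := by
      rw [← hpL, mul_add, mul_one]; omega
    have h9 : l + 1 = d := Nat.eq_of_mul_eq_mul_left hr0 h8
    have h10 : a + 1 = p ^ L := by
      calc a + 1 = d * A + (l + 1) := by rw [← add_assoc, h1]
        _ = d * (A + 1) := by rw [h9]; ring
        _ = p ^ L := by rw [h7, Nat.sub_add_cancel hr0, hpL, mul_comm]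
    omega
  rw [key, Nat.add_mul_mod_self_left, Nat.mod_eq_of_lt hlt]

theorem sub_one_mul_sum_pow_mul_mod {p : ℕ} (hp : 1 < p) {L a : ℕ} (ha : a < p ^ L - 1) :
    (p - 1) * ∑ r ∈ Finset.range L, p ^ r * a % (p ^ L - 1) =
      (p ^ L - 1) * (p.digits a).sum := by
  have h1 : ∀ r ∈ Finset.range L, p ^ r * a % (p ^ L - 1) + (p ^ L - 1) * (a / p ^ (L - r)) =
      p ^ r * a := fun r hr => pow_mul_mod_pow_sub_one (Finset.mem_range.mp hr).le ha
  have h2 := Finset.sum_congr rfl h1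
  rw [Finset.sum_add_distrib, ← Finset.mul_sum, ← Finset.sum_mul] at h2
  have h3 : ∑ r ∈ Finset.range L, a / p ^ (L - r) = ∑ i ∈ Finset.range L, a / p ^ i.succ := by
    rw [← Finset.sum_range_reflect]
    refine Finset.sum_congr rfl fun r hr => ?_
    have := Finset.mem_range.mp hr
    congr 2; omega
  have h4 := Nat.sub_one_mul_sum_log_div_pow_eq_sub_sum_digits (p := p) a
  have h5 : ∑ i ∈ Finset.range L, a / p ^ i.succ =
      ∑ i ∈ Finset.range (Nat.log p a).succ, a / p ^ i.succ := by
    have hlog : ∀ m, Nat.log p a ≤ m → ∑ i ∈ Finset.range m.succ, a / p ^ i.succ =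
        ∑ i ∈ Finset.range (Nat.log p a).succ, a / p ^ i.succ := by
      intro m hm
      symm
      apply Finset.sum_subset
      · intro i; simp only [Finset.mem_range]; omega
      · intro i _ hi
        simp only [Finset.mem_range, not_lt] at hi
        apply Nat.div_eq_of_lt
        exact Nat.lt_pow_of_log_lt hp (by omega)
    rcases le_or_gt (Nat.log p a + 1) L with h | h
    · obtain ⟨m, rfl⟩ : ∃ m, L = m.succ := ⟨L - 1, by omega⟩
      exact hlog m (by omega)
    · apply Finset.sum_subset
      · intro i; simp only [Finset.mem_range]; omega
      · intro i _ hi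
        simp only [Finset.mem_range, not_lt] at hi
        apply Nat.div_eq_of_lt
        calc a < p ^ L := by omega
          _ ≤ p ^ i.succ := Nat.pow_le_pow_right (by omega) (by omega)
  rw [h3, h5] at h2
  have hgeo : (p - 1) * ∑ r ∈ Finset.range L, p ^ r = p ^ L - 1 := by
    rw [Nat.geomSum_eq hp, Nat.mul_div_cancel']
    simpa using Nat.sub_dvd_pow_sub_pow p 1 L
  have hle : (p.digits a).sum ≤ a := Nat.digit_sum_le p a
  have h6 := congrArg (fun z => (p - 1) * z) h2
  beta_reduce at h6
  rw [mul_add, mul_left_comm, h4, ← mul_assoc, hgeo] at h6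
  have h7 : (p ^ L - 1) * (a - (p.digits a).sum) + (p ^ L - 1) * (p.digits a).sum = (p ^ L - 1) * a := by
    rw [← mul_add, Nat.sub_add_cancel hle]
  omega

theorem sum_fract_eq_of_sum_digits_eq {p : ℕ} (hp : 1 < p) {L a b : ℕ}
    (h : (p.digits (a % (p ^ L - 1))).sum = (p.digits (b % (p ^ L - 1))).sum)
    (hL : 0 < p ^ L - 1) :
    ∑ r ∈ Finset.range L, Int.fract ((p ^ (r + 1) * a : ℝ) / ((p ^ L - 1 : ℕ) : ℝ)) =
      ∑ r ∈ Finset.range L, Int.fract ((p ^ (r + 1) * b : ℝ) / ((p ^ L - 1 : ℕ) : ℝ)) := by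
  set M := p ^ L - 1 with hM
  have key : ∀ a : ℕ, ((p - 1 : ℕ) : ℝ) *
      ∑ r ∈ Finset.range L, Int.fract ((p ^ (r + 1) * a : ℝ) / (M : ℝ)) =
        (p.digits (a % M)).sum := by
    intro a
    have h1 := sub_one_mul_sum_pow_mul_mod hp (L := L) (Nat.mod_lt a hL)
    rw [← hM] at h1
    have h2 : ∑ r ∈ Finset.range L, Int.fract ((p ^ (r + 1) * a : ℝ) / (M : ℝ)) =
        ∑ r ∈ Finset.range L, Int.fract ((p ^ r * a : ℝ) / (M : ℝ)) := by
      have h3 := Finset.sum_range_succ (fun r => Int.fract ((p ^ r * a : ℝ) / (M : ℝ))) L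
      rw [Finset.sum_range_succ'] at h3
      have h4 : Int.fract ((p ^ L * a : ℝ) / (M : ℝ)) = Int.fract ((p ^ 0 * a : ℝ) / (M : ℝ)) := by
        have h5 : ((p : ℝ) ^ L) = M + 1 := by
          have : p ^ L = M + 1 := by omega
          exact_mod_cast congrArg (Nat.cast (R := ℝ)) this
        have hM0 : (M : ℝ) ≠ 0 := by exact_mod_cast hL.ne'
        rw [h5, pow_zero, one_mul]
        have : ((M + 1) * a : ℝ) / M = a / M + a := by field_simp; ring
        rw [this, Int.fract_add_natCast]
      rw [h4] at h3
      exact add_right_cancel h3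
    have h6 : ∀ r ∈ Finset.range L, Int.fract ((p ^ r * a : ℝ) / (M : ℝ)) =
        ((p ^ r * (a % M) % M : ℕ) : ℝ) / M := by
      intro r _
      have : ((p : ℝ) ^ r * a) = ((p ^ r * a : ℕ) : ℝ) := by push_cast; ring
      rw [this, Int.fract_div_natCast_eq_div_natCast_mod, Nat.mul_mod_mod]
    rw [h2, Finset.sum_congr rfl h6, ← Finset.sum_div, ← Nat.cast_sum, mul_div_assoc',
      ← Nat.cast_mul, h1, Nat.cast_mul]
    have hM0 : (M : ℝ) ≠ 0 := by exact_mod_cast hL.ne'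
    field_simp
  have hp1 : ((p - 1 : ℕ) : ℝ) ≠ 0 := by
    have : p - 1 ≠ 0 := by omega
    exact_mod_cast this
  apply mul_left_cancel₀ hp1
  rw [key, key, h]

theorem sum_range_comp_of_periodic {A : Type*} [AddCommMonoid A] {N : ℕ} (hN : 0 < N) (g : ℕ → A)
    (hg : ∀ b, g (b % N) = g b) (σ : ℕ → ℕ)
    (hσ : ∀ b < N, ∀ b' < N, σ b ≡ σ b' [MOD N] → b = b') :
    ∑ b ∈ Finset.range N, g (σ b) = ∑ b ∈ Finset.range N, g b := by
  have hinj : Set.InjOn (fun b => σ b % N) (Finset.range N : Set ℕ) := by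
    intro b hb b' hb' h
    simp only [Finset.coe_range, Set.mem_Iio] at hb hb'
    exact hσ b hb b' hb' h
  have himg : (Finset.range N).image (fun b => σ b % N) = Finset.range N := by
    apply Finset.eq_of_subset_of_card_le
    · intro c hc
      obtain ⟨b, _, rfl⟩ := Finset.mem_image.mp hc
      exact Finset.mem_range.mpr (Nat.mod_lt _ hN)
    · rw [Finset.card_image_of_injOn hinj]
  conv_rhs => rw [← himg, Finset.sum_image hinj]
  exact Finset.sum_congr rfl fun b _ => (hg _).symm

/-- The character `x ↦ exp (2πix)` of the real line. -/
noncomputable def expTwoPiI (x : ℝ) : ℂ := Complex.exp (((2 * Real.pi * x : ℝ) : ℂ) * Complex.I)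

theorem expTwoPiI_add (x y : ℝ) : expTwoPiI (x + y) = expTwoPiI x * expTwoPiI y := by
  rw [expTwoPiI, expTwoPiI, expTwoPiI, ← Complex.exp_add]; congr 1; push_cast; ring

theorem expTwoPiI_zero : expTwoPiI 0 = 1 := by simp [expTwoPiI]

theorem norm_expTwoPiI (x : ℝ) : ‖expTwoPiI x‖ = 1 := Complex.norm_exp_ofReal_mul_I _

theorem expTwoPiI_natCast_mul (x : ℝ) (m : ℕ) : expTwoPiI (m * x) = expTwoPiI x ^ m := by
  rw [expTwoPiI, expTwoPiI, ← Complex.exp_nat_mul]; congr 1; push_cast; ring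

theorem expTwoPiI_intCast (m : ℤ) : expTwoPiI m = 1 := by
  rw [expTwoPiI, ← Complex.exp_int_mul_two_pi_mul_I m]; congr 1; push_cast; ring

theorem expTwoPiI_sub_one (x : ℝ) : expTwoPiI x - 1 =
    expTwoPiI (x / 2) * (2 * Complex.I * (Real.sin (Real.pi * x) : ℂ)) := by
  have h1 : expTwoPiI x = expTwoPiI (x / 2) * expTwoPiI (x / 2) := by
    rw [← expTwoPiI_add]; congr 1; ring
  have h2 : (1 : ℂ) = expTwoPiI (x / 2) * expTwoPiI (-(x / 2)) := by
    rw [← expTwoPiI_add, add_neg_cancel, expTwoPiI_zero]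
  rw [h1]
  conv_lhs => rw [h2]
  rw [← mul_sub]
  congr 1
  rw [expTwoPiI, expTwoPiI, Complex.ofReal_sin, Complex.sin]
  have e1 : (((2 * Real.pi * (x / 2) : ℝ) : ℂ) * Complex.I) = ((Real.pi * x : ℝ) : ℂ) * Complex.I := by
    push_cast; ring
  have e2 : (((2 * Real.pi * -(x / 2) : ℝ) : ℂ) * Complex.I) =
      -((Real.pi * x : ℝ) : ℂ) * Complex.I := by
    push_cast; ring
  rw [e1, e2]
  linear_combination (Complex.exp (((Real.pi * x : ℝ) : ℂ) * Complex.I) -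
    Complex.exp (-((Real.pi * x : ℝ) : ℂ) * Complex.I)) * Complex.I_mul_I

theorem norm_expTwoPiI_sub_one (x : ℝ) : ‖expTwoPiI x - 1‖ = 2 * |Real.sin (Real.pi * x)| := by
  rw [expTwoPiI_sub_one, norm_mul, norm_expTwoPiI, one_mul, norm_mul, norm_mul, Complex.norm_I,
    Complex.norm_real]
  simp

theorem expTwoPiI_mod {N : ℕ} (hN : 0 < N) (c b : ℕ) :
    expTwoPiI (-(c * (b % N : ℕ) / N)) = expTwoPiI (-(c * b / N)) := by
  have hN0 : (N : ℝ) ≠ 0 := by exact_mod_cast hN.ne'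
  have h : (b : ℝ) = (b % N : ℕ) + N * (b / N : ℕ) := by exact_mod_cast (Nat.mod_add_div b N).symm
  generalize b / N = k at h
  have : (-(c * b / N : ℝ)) = -(c * (b % N : ℕ) / N) + ((-(c * k) : ℤ) : ℝ) := by
    conv_lhs => rw [h]
    push_cast; field_simp; ring
  rw [this, expTwoPiI_add, expTwoPiI_intCast, mul_one]

theorem expTwoPiI_ne_one {N c : ℕ} (hN : 0 < N) (hc : ¬ N ∣ c) : expTwoPiI (-(c / N)) ≠ 1 := by
  intro h
  rw [expTwoPiI, Complex.exp_eq_one_iff] at h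
  obtain ⟨m, hm⟩ := h
  have hpi : (2 * (Real.pi : ℂ) * Complex.I) ≠ 0 := Complex.two_pi_I_ne_zero
  have h1 : (-(c / N : ℝ)) = (m : ℝ) := by
    have : ((-(c / N : ℝ) : ℝ) : ℂ) = (m : ℂ) := by
      apply mul_right_cancel₀ hpi
      rw [← hm]; push_cast; ring
    exact_mod_cast this
  have hN0 : (N : ℝ) ≠ 0 := by exact_mod_cast hN.ne'
  have h2 : (c : ℤ) = N * (-m) := by
    have : (c : ℝ) = N * (-m) := by rw [← h1]; field_simp
    exact_mod_cast this
  exact hc (Int.natCast_dvd_natCast.mp ⟨_, h2⟩)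

theorem sum_expTwoPiI_mul_fract {N c : ℕ} (hN : 0 < N) (hc : ¬ N ∣ c) {y : ℝ} (hy : 0 ≤ y) :
    ∑ b ∈ Finset.range N, expTwoPiI (-(c * b / N)) * (Int.fract (y + b / N) : ℝ) =
      expTwoPiI (c * ⌊N * y⌋₊ / N) / (expTwoPiI (-(c / N)) - 1) := by
  have hN0 : (N : ℝ) ≠ 0 := by exact_mod_cast hN.ne'
  have hNpos : (0 : ℝ) < N := by exact_mod_cast hN
  set d := ⌊N * y⌋₊ with hd
  set φ := N * y - d with hφ
  have hφ0 : 0 ≤ φ := sub_nonneg.mpr (Nat.floor_le (by positivity))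
  have hφ1 : φ < 1 := by have := Nat.lt_floor_add_one (N * y); rw [hφ]; linarith
  set z := expTwoPiI (-(c / N)) with hz
  have hz1 : z - 1 ≠ 0 := sub_ne_zero.mpr (expTwoPiI_ne_one hN hc)
  set g : ℕ → ℂ := fun b => expTwoPiI (-(c * b / N)) * (((b % N : ℕ) + φ) / N : ℝ) with hg
  have hgp : ∀ b, g (b % N) = g b := by
    intro b; simp only [hg]; rw [expTwoPiI_mod hN, Nat.mod_mod]
  have hfr : ∀ b : ℕ, Int.fract (y + b / N) = (((b + d) % N : ℕ) + φ) / N := by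
    intro b
    have h1 : (y + b / N) = (((b + d) % N : ℕ) + φ) / N + (((b + d) / N : ℕ) : ℝ) := by
      have h : ((b + d : ℕ) : ℝ) = ((b + d) % N : ℕ) + N * ((b + d) / N : ℕ) := by
        exact_mod_cast (Nat.mod_add_div (b + d) N).symm
      rw [hφ]; field_simp; push_cast at h ⊢; linarith
    rw [h1, Int.fract_add_natCast, Int.fract_eq_self]
    have h2 : (((b + d) % N : ℕ) : ℝ) + 1 ≤ N := by exact_mod_cast Nat.mod_lt _ hN
    refine ⟨by positivity, ?_⟩
    rw [div_lt_one hNpos]; linarith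
  have h1 : ∀ b ∈ Finset.range N, expTwoPiI (-(c * b / N)) * (Int.fract (y + b / N) : ℝ) =
      expTwoPiI (c * d / N) * g (b + d) := by
    intro b _
    simp only [hg]
    rw [hfr, ← mul_assoc, ← expTwoPiI_add]
    congr 2
    push_cast; ring
  rw [Finset.sum_congr rfl h1, ← Finset.mul_sum,
    sum_range_comp_of_periodic hN g hgp (fun b => b + d)]
  · rw [div_eq_mul_inv]
    congr 1
    have h2 : ∀ b ∈ Finset.range N, g b = (1 / N : ℂ) * (b * z ^ b) + (φ / N : ℂ) * z ^ b := by
      intro b hb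
      simp only [hg]
      rw [Nat.mod_eq_of_lt (Finset.mem_range.mp hb), hz, ← expTwoPiI_natCast_mul]
      have : (b : ℝ) * -(c / N) = -(c * b / N) := by ring
      rw [this]; push_cast; ring
    have hzN : z ^ N = 1 := by
      rw [hz, ← expTwoPiI_natCast_mul]
      have : (N : ℝ) * -(c / N) = ((-(c : ℤ) : ℤ) : ℝ) := by push_cast; field_simp
      rw [this, expTwoPiI_intCast]
    have h3 : ∑ b ∈ Finset.range N, z ^ b = 0 := by
      have := mul_geom_sum z N
      rw [hzN, sub_self] at this
      exact (mul_eq_zero.mp this).resolve_left hz1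
    have h4 : ∀ m : ℕ, (z - 1) * ∑ b ∈ Finset.range m, (b : ℂ) * z ^ b =
        m * z ^ m - ∑ b ∈ Finset.range m, z ^ (b + 1) := by
      intro m
      induction m with
      | zero => simp
      | succ k ih =>
        rw [Finset.sum_range_succ, mul_add, ih, Finset.sum_range_succ]; push_cast; ring
    have h5 : ∑ b ∈ Finset.range N, (b : ℂ) * z ^ b = N / (z - 1) := by
      rw [eq_div_iff hz1, mul_comm, h4, hzN]
      simp_rw [pow_succ]
      rw [← Finset.sum_mul, h3]; simp
    have hNc : (N : ℂ) ≠ 0 := by exact_mod_cast hN.ne'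
    rw [Finset.sum_congr rfl h2, Finset.sum_add_distrib, ← Finset.mul_sum, ← Finset.mul_sum, h3, h5]
    field_simp; ring
  · intro b hb b' hb' h
    have := Nat.ModEq.add_right_cancel' d h
    rwa [Nat.ModEq, Nat.mod_eq_of_lt hb, Nat.mod_eq_of_lt hb'] at this

theorem norm_sum_expTwoPiI_mul_fract {N c : ℕ} (hN : 0 < N) (hc : ¬ N ∣ c) {y : ℝ} (hy : 0 ≤ y) :
    ‖∑ b ∈ Finset.range N, expTwoPiI (-(c * b / N)) * (Int.fract (y + b / N) : ℝ)‖ =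
      1 / (2 * |Real.sin (Real.pi * c / N)|) := by
  rw [sum_expTwoPiI_mul_fract hN hc hy, norm_div, norm_expTwoPiI, norm_expTwoPiI_sub_one]
  have : Real.pi * -(c / N : ℝ) = -(Real.pi * c / N) := by ring
  rw [this, Real.sin_neg, abs_neg]

theorem norm_sum_expTwoPiI_mul_fract_sub_le {N c : ℕ} (hc0 : 0 < c) (hc : c < N) {y : ℝ}
    (hy : 0 ≤ y) :
    ‖∑ b ∈ Finset.range N, expTwoPiI (-(c * b / N)) * (Int.fract (y + b / N) : ℝ) -
        ((1 / (2 * Real.sin (Real.pi * c / N)) : ℝ) : ℂ) * Complex.I * expTwoPiI (c * y)‖ ≤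
      (Real.pi * c / N) / Real.sin (Real.pi * c / N) * |Int.fract (N * y) - 1 / 2| := by
  have hN : 0 < N := by omega
  have hNpos : (0 : ℝ) < N := by exact_mod_cast hN
  have hcpos : (0 : ℝ) < c := by exact_mod_cast hc0
  have hcN : (c : ℝ) < N := by exact_mod_cast hc
  have hnd : ¬ N ∣ c := fun h => absurd (Nat.le_of_dvd hc0 h) (by omega)
  set θ := Real.pi * c / N with hθ
  have hθ0 : 0 < θ := by positivity
  have hθ1 : θ < Real.pi := by
    rw [hθ, div_lt_iff₀ hNpos]; exact mul_lt_mul_of_pos_left hcN Real.pi_pos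
  have hsin : 0 < Real.sin θ := Real.sin_pos_of_pos_of_lt_pi hθ0 hθ1
  rw [sum_expTwoPiI_mul_fract hN hnd hy]
  set d := ⌊N * y⌋₊
  have hfl : Int.fract (N * y) = N * y - d := by
    rw [← Int.self_sub_floor, natCast_floor_eq_intCast_floor (by positivity)]
  set φ := Int.fract (N * y)
  have h1 : expTwoPiI (c * d / N) / (expTwoPiI (-(c / N)) - 1) =
      ((1 / (2 * Real.sin θ) : ℝ) : ℂ) * Complex.I * expTwoPiI (c * y) *
        expTwoPiI (-(c / N * (φ - 1 / 2))) := by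
    rw [expTwoPiI_sub_one]
    have e1 : Real.pi * -(c / N : ℝ) = -θ := by rw [hθ]; ring
    have e2 : (c * d / N : ℝ) = c * y + -(c / N * (φ - 1 / 2)) + (-(c / N : ℝ)) / 2 := by
      rw [hfl]; field_simp; ring
    rw [e1, Real.sin_neg, e2, expTwoPiI_add, expTwoPiI_add]
    have h0 : expTwoPiI (-(c / N : ℝ) / 2) ≠ 0 := by
      rw [← norm_ne_zero_iff, norm_expTwoPiI]; exact one_ne_zero
    have hs : (Real.sin θ : ℂ) ≠ 0 := by exact_mod_cast hsin.ne'
    generalize expTwoPiI (-(c / N : ℝ) / 2) = w at h0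
    generalize expTwoPiI (-(c / N * (φ - 1 / 2))) = v
    generalize expTwoPiI (c * y) = u
    have hI := Complex.I_ne_zero
    push_cast at hs ⊢
    rw [div_eq_iff (by simp [h0, hs])]
    field_simp
    linear_combination u * v * Complex.I_sq
  have h2 : expTwoPiI (c * d / N) / (expTwoPiI (-(c / N)) - 1) -
      ((1 / (2 * Real.sin θ) : ℝ) : ℂ) * Complex.I * expTwoPiI (c * y) =
      ((1 / (2 * Real.sin θ) : ℝ) : ℂ) * Complex.I * expTwoPiI (c * y) *
        (expTwoPiI (-(c / N * (φ - 1 / 2))) - 1) := by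
    rw [h1]; ring
  rw [h2, norm_mul, norm_mul, norm_mul, norm_expTwoPiI, norm_expTwoPiI_sub_one, Complex.norm_I,
    Complex.norm_real, Real.norm_of_nonneg (by positivity)]
  have h3 : |Real.sin (Real.pi * -(c / N * (φ - 1 / 2)))| ≤ θ * |φ - 1 / 2| := by
    have : Real.pi * -(c / N * (φ - 1 / 2)) = -(θ * (φ - 1 / 2)) := by rw [hθ]; ring
    rw [this, Real.sin_neg, abs_neg]
    refine Real.abs_sin_le_abs.trans ?_
    rw [abs_mul, abs_of_pos hθ0]
  calc 1 / (2 * Real.sin θ) * 1 * 1 * (2 * |Real.sin (Real.pi * -(c / N * (φ - 1 / 2)))|)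
      = 1 / Real.sin θ * |Real.sin (Real.pi * -(c / N * (φ - 1 / 2)))| := by field_simp
    _ ≤ 1 / Real.sin θ * (θ * |φ - 1 / 2|) := by gcongr
    _ = _ := by ring

theorem sum_range_mul_add_one {A : Type*} [AddCommMonoid A] (g : ℕ → A) (f n : ℕ) :
    ∑ r ∈ Finset.range (f * n), g (r + 1) =
      ∑ t ∈ Finset.range f, ∑ i ∈ Finset.range n, g ((i + 1) * f - t) := by
  rw [Finset.sum_comm]
  induction n with
  | zero => simp
  | succ n ih =>
    rw [mul_add, mul_one, Finset.sum_range_add, ih, Finset.sum_range_succ]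
    congr 1
    rw [← Finset.sum_range_reflect]
    refine Finset.sum_congr rfl fun t ht => ?_
    have := Finset.mem_range.mp ht
    congr 1
    rw [add_mul, mul_comm n f]; omega

theorem sum_expTwoPiI_mul_fract_of_mul_modEq_one {N c u v : ℕ} (hN : 0 < N) (huv : u * v ≡ 1 [MOD N])
    (y : ℝ) :
    ∑ b ∈ Finset.range N, expTwoPiI (-(c * b / N)) * (Int.fract (y + u * b / N) : ℝ) =
      ∑ b ∈ Finset.range N,
        expTwoPiI (-((c * v : ℕ) * b / N)) * (Int.fract (y + b / N) : ℝ) := by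
  have hN0 : (N : ℝ) ≠ 0 := by exact_mod_cast hN.ne'
  set g : ℕ → ℂ := fun b =>
    expTwoPiI (-((c * v : ℕ) * b / N)) * (Int.fract (y + b / N) : ℝ) with hg
  have hgp : ∀ b, g (b % N) = g b := by
    intro b
    simp only [hg]
    rw [expTwoPiI_mod hN]
    have h : (b : ℝ) = (b % N : ℕ) + N * (b / N : ℕ) := by exact_mod_cast (Nat.mod_add_div b N).symm
    have h2 : y + b / N = y + (b % N : ℕ) / N + (b / N : ℕ) := by
      conv_lhs => rw [h]
      field_simp; ring
    rw [h2, Int.fract_add_natCast]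
  rw [← sum_range_comp_of_periodic hN g hgp (fun b => u * b)]
  · refine Finset.sum_congr rfl fun b _ => ?_
    simp only [hg]
    have h3 : c * v * (u * b) ≡ c * b [MOD N] := by
      have := huv.mul_left (c * b)
      rw [mul_one] at this
      convert this using 1; ring
    have e1 := expTwoPiI_mod hN 1 (c * v * (u * b))
    rw [h3, expTwoPiI_mod hN 1 (c * b)] at e1
    have e2 : expTwoPiI (-(c * b / N)) = expTwoPiI (-((c * v : ℕ) * (u * b : ℕ) / N)) := by
      convert e1 using 3 <;> push_cast <;> ring
    rw [e2]
    push_cast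
    rfl
  · intro b hb b' hb' h
    have hcop : Nat.gcd N u = 1 := by
      rw [← Nat.Coprime, Nat.coprime_comm]
      exact Nat.Coprime.coprime_mul_right ((by simpa [Nat.Coprime] using huv.gcd_eq) : (u * v).Coprime N)
    have := Nat.ModEq.cancel_left_of_coprime hcop h
    rwa [Nat.ModEq, Nat.mod_eq_of_lt hb, Nat.mod_eq_of_lt hb'] at this

/-- The power sum `∑ᵢ exp (2πi h q^(i+1) X / (q^n - 1))`. -/
noncomputable def expPowerSum (q n h X : ℕ) : ℂ :=
  ∑ i ∈ Finset.range n, expTwoPiI (h * (q ^ (i + 1) * X) / ((q ^ n - 1 : ℕ) : ℝ))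

/-- The sum over `i` of the distances of the fractional parts of `p ^ ((i + 1) f - t) X / R` to
`1 / 2`. -/
noncomputable def fractDev (p f n R t X : ℕ) : ℝ :=
  ∑ i ∈ Finset.range n, |Int.fract ((p ^ ((i + 1) * f - t) * X : ℝ) / (R : ℝ)) - 1 / 2|

theorem norm_expPowerSum_sub_le {p f n R X X' h : ℕ} (hp : 1 < p) (hf : 0 < f) (hn : 1 ≤ n)
    (hR : R * (p ^ f - 1) = (p ^ f) ^ n - 1)
    (hs : ∀ b, (p.digits ((X + b * R) % ((p ^ f) ^ n - 1))).sum =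
      (p.digits ((X' + b * R) % ((p ^ f) ^ n - 1))).sum)
    (hh : ∀ t, ¬ p ^ f - 1 ∣ h * p ^ t) {S : Finset ℕ} (hS : S ⊆ Finset.range f)
    (hSc : ∀ t ∈ S, h * p ^ t < p ^ f - 1) :
    (∑ t ∈ S, 1 / (2 * Real.sin (Real.pi * (h * p ^ t : ℕ) / (p ^ f - 1 : ℕ)))) *
        ‖expPowerSum (p ^ f) n h X - expPowerSum (p ^ f) n h X'‖ ≤
      ∑ t ∈ S, (Real.pi * (h * p ^ t : ℕ) / (p ^ f - 1 : ℕ)) /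
          Real.sin (Real.pi * (h * p ^ t : ℕ) / (p ^ f - 1 : ℕ)) *
          (fractDev p f n R t X + fractDev p f n R t X') +
        ∑ t ∈ Finset.range f \ S,
          n / |Real.sin (Real.pi * (h * p ^ t : ℕ) / (p ^ f - 1 : ℕ))| := by
  set q := p ^ f with hq
  set N := q - 1 with hN
  set M := q ^ n - 1 with hM
  have hq1 : 1 < q := Nat.one_lt_pow hf.ne' hp
  have hNpos : 0 < N := by omega
  have hqn : 1 < q ^ n := Nat.one_lt_pow (by omega) hq1
  have hMpos : 0 < M := by omega
  have hRpos : 0 < R := by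
    rcases Nat.eq_zero_or_pos R with h0 | h0
    · rw [h0, zero_mul] at hR; omega
    · exact h0
  have hN0 : (N : ℝ) ≠ 0 := by exact_mod_cast hNpos.ne'
  have hR0 : (R : ℝ) ≠ 0 := by exact_mod_cast hRpos.ne'
  have hMR : (M : ℝ) = R * N := by exact_mod_cast hR.symm
  have hpL : p ^ (f * n) - 1 = M := by rw [pow_mul]
  have hpp : 0 < p := by omega
  -- the inner sums attached to an exponent and a digit position
  set y : ℕ → ℕ → ℕ → ℝ := fun X t i => (p ^ ((i + 1) * f - t) * X : ℝ) / M with hy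
  have hy0 : ∀ X t i, 0 ≤ y X t i := fun X t i => by simp only [hy]; positivity
  set T : ℕ → ℕ → ℕ → ℂ := fun X t i => ∑ b ∈ Finset.range N,
    expTwoPiI (-((h * p ^ t : ℕ) * b / N)) * (Int.fract (y X t i + b / N) : ℝ) with hT
  have hexp : ∀ t ∈ Finset.range f, ∀ i, p ^ ((i + 1) * f - t) * p ^ t = q ^ (i + 1) := by
    intro t ht i
    have := Finset.mem_range.mp ht
    rw [← pow_add, hq, ← pow_mul]
    congr 1
    have : f ≤ (i + 1) * f := Nat.le_mul_of_pos_left _ (by omega)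
    rw [mul_comm f]; omega
  have hsum : ∀ X, ∑ b ∈ Finset.range N, expTwoPiI (-(h * b / N)) *
      ((∑ r ∈ Finset.range (f * n), Int.fract ((p ^ (r + 1) * (X + b * R : ℕ) : ℝ) / M) : ℝ) : ℂ) =
      ∑ t ∈ Finset.range f, ∑ i ∈ Finset.range n, T X t i := by
    intro X
    have e1 : ∀ b, (∑ r ∈ Finset.range (f * n),
        Int.fract ((p ^ (r + 1) * (X + b * R : ℕ) : ℝ) / M)) =
        ∑ t ∈ Finset.range f, ∑ i ∈ Finset.range n,
          Int.fract ((p ^ ((i + 1) * f - t) * (X + b * R : ℕ) : ℝ) / M) :=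
      fun b => sum_range_mul_add_one (fun r => Int.fract ((p ^ r * (X + b * R : ℕ) : ℝ) / M)) f n
    simp_rw [e1]
    push_cast
    simp_rw [Finset.mul_sum]
    rw [Finset.sum_comm]
    refine Finset.sum_congr rfl fun t ht => ?_
    rw [Finset.sum_comm]
    refine Finset.sum_congr rfl fun i _ => ?_
    simp only [hT]
    rw [← sum_expTwoPiI_mul_fract_of_mul_modEq_one (u := p ^ ((i + 1) * f - t)) hNpos]
    · refine Finset.sum_congr rfl fun b _ => ?_
      congr 3
      simp only [hy]
      rw [hMR]; push_cast; field_simp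
    · rw [hexp t ht i]
      have : q ≡ 1 [MOD N] := ((Nat.modEq_iff_dvd' (by omega)).mpr dvd_rfl).symm
      simpa using this.pow (i + 1)
  have heq : ∑ t ∈ Finset.range f, ∑ i ∈ Finset.range n, T X t i =
      ∑ t ∈ Finset.range f, ∑ i ∈ Finset.range n, T X' t i := by
    rw [← hsum, ← hsum]
    refine Finset.sum_congr rfl fun b _ => ?_
    have h1 := sum_fract_eq_of_sum_digits_eq hp (L := f * n) (a := X + b * R) (b := X' + b * R)
      (by rw [hpL]; exact hs b) (by rw [hpL]; exact hMpos)
    rw [hpL] at h1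
    rw [h1]
  set A : ℕ → ℝ := fun t => 1 / (2 * Real.sin (Real.pi * (h * p ^ t : ℕ) / N)) with hA
  set θ : ℕ → ℝ := fun t => Real.pi * (h * p ^ t : ℕ) / N with hθ
  have hcoh : ∀ t ∈ S, ∀ X, ‖(∑ i ∈ Finset.range n, T X t i) -
      (A t : ℂ) * Complex.I * expPowerSum q n h X‖ ≤
        θ t / Real.sin (θ t) * fractDev p f n R t X := by
    intro t ht X
    have hc0 : 0 < h * p ^ t := by
      rcases Nat.eq_zero_or_pos (h * p ^ t) with h0 | h0
      · exact absurd (h0 ▸ dvd_zero _) (hh t)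
      · exact h0
    rw [expPowerSum, Finset.mul_sum, ← Finset.sum_sub_distrib, fractDev, Finset.mul_sum]
    refine (norm_sum_le _ _).trans (Finset.sum_le_sum fun i _ => ?_)
    have h1 := norm_sum_expTwoPiI_mul_fract_sub_le hc0 (hSc t ht) (hy0 X t i)
    have h2 : ((h * p ^ t : ℕ) : ℝ) * y X t i = h * (q ^ (i + 1) * X) / M := by
      simp only [hy]
      have : ((p : ℝ) ^ ((i + 1) * f - t) * p ^ t) = q ^ (i + 1) := by
        exact_mod_cast hexp t (hS ht) i
      push_cast; rw [← this]; ring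
    have h3 : N * y X t i = (p ^ ((i + 1) * f - t) * X : ℝ) / (R : ℝ) := by
      simp only [hy]; rw [hMR]; field_simp
    rw [h2, h3] at h1
    exact h1
  have hinc : ∀ t X, ‖∑ i ∈ Finset.range n, T X t i‖ ≤
      n * (1 / (2 * |Real.sin (θ t)|)) := by
    intro t X
    refine (norm_sum_le _ _).trans ?_
    have : ∀ i ∈ Finset.range n, ‖T X t i‖ = 1 / (2 * |Real.sin (θ t)|) := fun i _ =>
      norm_sum_expTwoPiI_mul_fract hNpos (hh t) (hy0 X t i)
    rw [Finset.sum_congr rfl this]; simp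
  set U : ℕ → ℕ → ℂ := fun X t => ∑ i ∈ Finset.range n, T X t i with hU
  set P := expPowerSum q n h X
  set P' := expPowerSum q n h X'
  have hApos : 0 ≤ ∑ t ∈ S, A t := by
    refine Finset.sum_nonneg fun t ht => ?_
    have hlt : ((h * p ^ t : ℕ) : ℝ) < N := by exact_mod_cast hSc t ht
    have hNp : (0 : ℝ) < N := by exact_mod_cast hNpos
    have : 0 ≤ Real.sin (Real.pi * (h * p ^ t : ℕ) / N) := by
      apply Real.sin_nonneg_of_nonneg_of_le_pi
      · positivity
      · rw [div_le_iff₀ hNp]; exact mul_le_mul_of_nonneg_left hlt.le Real.pi_pos.le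
    simp only [hA]; positivity
  have hsplit : (((∑ t ∈ S, A t : ℝ) : ℂ) * Complex.I) * (P - P') =
      -(∑ t ∈ S, ((U X t - (A t : ℂ) * Complex.I * P) - (U X' t - (A t : ℂ) * Complex.I * P'))) -
        ∑ t ∈ Finset.range f \ S, (U X t - U X' t) := by
    have h1 : ∑ t ∈ Finset.range f \ S, (U X t - U X' t) + ∑ t ∈ S, (U X t - U X' t) = 0 := by
      rw [Finset.sum_sdiff hS, Finset.sum_sub_distrib]
      exact sub_eq_zero.mpr heq
    have h2 : ∑ t ∈ S, ((U X t - (A t : ℂ) * Complex.I * P) - (U X' t - (A t : ℂ) * Complex.I * P')) =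
        ∑ t ∈ S, (U X t - U X' t) - (((∑ t ∈ S, A t : ℝ) : ℂ) * Complex.I) * (P - P') := by
      push_cast
      rw [Finset.sum_mul, Finset.sum_mul, ← Finset.sum_sub_distrib]
      exact Finset.sum_congr rfl fun t _ => by ring
    rw [h2]
    linear_combination h1
  calc (∑ t ∈ S, A t) * ‖P - P'‖ = ‖(((∑ t ∈ S, A t : ℝ) : ℂ) * Complex.I) * (P - P')‖ := by
        rw [norm_mul, norm_mul, Complex.norm_I, mul_one, Complex.norm_real,
          Real.norm_of_nonneg hApos]
    _ ≤ ∑ t ∈ S, θ t / Real.sin (θ t) * (fractDev p f n R t X + fractDev p f n R t X') +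
        ∑ t ∈ Finset.range f \ S, n / |Real.sin (θ t)| := by
      rw [hsplit]
      refine (norm_sub_le _ _).trans (add_le_add ?_ ?_)
      · rw [norm_neg]
        refine (norm_sum_le _ _).trans (Finset.sum_le_sum fun t ht => ?_)
        refine (norm_sub_le _ _).trans ?_
        rw [mul_add]
        exact add_le_add (hcoh t ht X) (hcoh t ht X')
      · refine (norm_sum_le _ _).trans (Finset.sum_le_sum fun t _ => ?_)
        refine (norm_sub_le _ _).trans ((add_le_add (hinc t X) (hinc t X')).trans_eq ?_)
        ring

theorem sum_range_div_eq_sum_divisors (g : ℚ → ℚ) {m : ℕ} (hm : 0 < m) :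
    ∑ k ∈ Finset.range m, g (k / m) =
      ∑ d ∈ m.divisors, ∑ k ∈ Finset.range d with k.Coprime d, g (k / d) := by
  rw [← Finset.sum_fiberwise_of_maps_to (s := Finset.range m) (t := m.divisors)
    (g := fun k => m / Nat.gcd k m)
    (fun k _ => Nat.mem_divisors.mpr ⟨Nat.div_dvd_of_dvd (Nat.gcd_dvd_right _ _), hm.ne'⟩)]
  refine Finset.sum_congr rfl fun d hd => ?_
  have hdm := Nat.dvd_of_mem_divisors hd
  obtain ⟨e, rfl⟩ := hdm
  have hd0 : 0 < d := Nat.pos_of_mul_pos_right hm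
  have he0 : 0 < e := Nat.pos_of_mul_pos_left hm
  symm
  refine Finset.sum_bij (fun k _ => k * e) ?_ ?_ ?_ ?_
  · intro k hk
    simp only [Finset.mem_filter, Finset.mem_range] at hk ⊢
    refine ⟨Nat.mul_lt_mul_of_pos_right hk.1 he0, ?_⟩
    rw [Nat.gcd_mul_right, hk.2.gcd_eq_one, one_mul, Nat.mul_div_cancel _ he0]
  · intro k _ k' _ h
    exact Nat.eq_of_mul_eq_mul_right he0 h
  · intro k hk
    simp only [Finset.mem_filter, Finset.mem_range] at hk
    obtain ⟨hk1, hk2⟩ := hk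
    have hg : Nat.gcd k (d * e) = e := by
      have h1 := Nat.div_mul_cancel (Nat.gcd_dvd_right k (d * e))
      rw [hk2] at h1
      exact Nat.eq_of_mul_eq_mul_left hd0 h1
    obtain ⟨j, hj⟩ : e ∣ k := hg ▸ Nat.gcd_dvd_left k (d * e)
    subst hj
    refine ⟨j, ?_, mul_comm _ _⟩
    simp only [Finset.mem_filter, Finset.mem_range]
    rw [mul_comm e, Nat.gcd_mul_right] at hg
    refine ⟨?_, ?_⟩
    · rw [mul_comm d] at hk1; exact lt_of_mul_lt_mul_left hk1 (Nat.zero_le _)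
    · exact Nat.eq_of_mul_eq_mul_right he0 (by rw [one_mul]; exact hg)
  · intro k _
    have h1 : (d : ℚ) ≠ 0 := by exact_mod_cast hd0.ne'
    have h2 : (e : ℚ) ≠ 0 := by exact_mod_cast he0.ne'
    congr 1
    push_cast; field_simp

theorem sum_range_abs_two_mul_sub (m : ℕ) :
    ∑ k ∈ Finset.range m, |(2 * k - m : ℚ)| = if Odd m then ((m : ℚ) ^ 2 + 1) / 2 else (m : ℚ) ^ 2 / 2 := by
  have h : ∀ m : ℕ, ∑ k ∈ Finset.range (m + 2), |(2 * k - (m + 2 : ℕ) : ℚ)| =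
      ∑ k ∈ Finset.range m, |(2 * k - m : ℚ)| + (2 * m + 2) := by
    intro m
    rw [Finset.sum_range_succ', Finset.sum_range_succ]
    have : ∀ k ∈ Finset.range m, |(2 * (k + 1 : ℕ) - (m + 2 : ℕ) : ℚ)| = |(2 * k - m : ℚ)| := by
      intro k _; congr 1; push_cast; ring
    rw [Finset.sum_congr rfl this, add_assoc]
    congr 1
    have e1 : (2 * (m + 1 : ℕ) - (m + 2 : ℕ) : ℚ) = m := by push_cast; ring
    have e2 : (2 * (0 : ℕ) - (m + 2 : ℕ) : ℚ) = -(m + 2) := by push_cast; ring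
    rw [e1, e2, abs_neg, abs_of_nonneg (by positivity), abs_of_nonneg (by positivity)]; ring
  induction m using Nat.twoStepInduction with
  | zero => simp
  | one => simp
  | more m ih _ =>
    rw [h, ih]
    have : Odd (m + 2) ↔ Odd m := by
      rw [Nat.odd_add]; simp
    simp only [this]
    split_ifs <;> push_cast <;> ring

/-- The sum of `|k / m - 1 / 2|` over the residues `k` coprime to `m`. -/
def coprimeDev (m : ℕ) : ℚ := ∑ k ∈ Finset.range m with k.Coprime m, |(k / m - 1 / 2 : ℚ)|

theorem sum_divisors_coprimeDev {m : ℕ} (hm : 0 < m) :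
    ∑ d ∈ m.divisors, coprimeDev d = m / 4 + if Odd m then 1 / (4 * m : ℚ) else 0 := by
  simp only [coprimeDev]
  rw [← sum_range_div_eq_sum_divisors (fun z => |z - 1 / 2|) hm]
  have hm0 : (m : ℚ) ≠ 0 := by exact_mod_cast hm.ne'
  have hmp : (0 : ℚ) < 2 * m := by exact_mod_cast (by omega : 0 < 2 * m)
  have : ∀ k ∈ Finset.range m, |((k : ℚ) / m - 1 / 2)| = 1 / (2 * m) * |(2 * k - m : ℚ)| := by
    intro k _
    have e : ((k : ℚ) / m - 1 / 2) = 1 / (2 * m) * (2 * k - m) := by field_simp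
    rw [e, abs_mul, abs_of_pos (show (0 : ℚ) < 1 / (2 * m) by positivity)]
  rw [Finset.sum_congr rfl this, ← Finset.mul_sum, sum_range_abs_two_mul_sub]
  split_ifs <;> field_simp
  · ring
  · ring

/-- The arithmetic function equal to `1 / d` at odd `d` and to `0` at even `d`. -/
def oddInv : ArithmeticFunction ℚ := ⟨fun d => if Odd d then 1 / d else 0, by simp⟩

theorem oddInv_apply (d : ℕ) : oddInv d = if Odd d then 1 / (d : ℚ) else 0 := rfl

theorem isMultiplicative_oddInv : oddInv.IsMultiplicative := by
  refine ⟨by simp [oddInv_apply], fun {m n} _ => ?_⟩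
  simp only [oddInv_apply, Nat.odd_mul]
  by_cases h1 : Odd m <;> by_cases h2 : Odd n <;> simp [h1, h2, mul_comm]

/-- The Möbius transform of `oddInv`. -/
def oddInvMoebius : ArithmeticFunction ℚ :=
  ((ArithmeticFunction.moebius : ArithmeticFunction ℤ) : ArithmeticFunction ℚ) * oddInv

theorem isMultiplicative_oddInvMoebius : oddInvMoebius.IsMultiplicative :=
  ArithmeticFunction.isMultiplicative_moebius.intCast.mul isMultiplicative_oddInv

theorem oddInvMoebius_prime_pow {p k : ℕ} (hp : p.Prime) :
    oddInvMoebius (p ^ (k + 1)) = oddInv (p ^ (k + 1)) - oddInv (p ^ k) := by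
  rw [oddInvMoebius, ArithmeticFunction.mul_apply,
    Nat.sum_divisorsAntidiagonal (f := fun i j =>
      ((ArithmeticFunction.moebius : ArithmeticFunction ℤ) : ArithmeticFunction ℚ) i * oddInv j),
    Nat.sum_divisors_prime_pow hp, Finset.sum_range_succ', Finset.sum_range_succ']
  have h0 : ∑ x ∈ Finset.range k,
      ((ArithmeticFunction.moebius : ArithmeticFunction ℤ) : ArithmeticFunction ℚ)
        (p ^ (x + 1 + 1)) * oddInv (p ^ (k + 1) / p ^ (x + 1 + 1)) = 0 := by
    refine Finset.sum_eq_zero fun x _ => ?_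
    rw [ArithmeticFunction.intCoe_apply,
      ArithmeticFunction.moebius_apply_prime_pow hp (by omega)]
    simp
  rw [h0]
  simp only [ArithmeticFunction.intCoe_apply, zero_add, pow_one, pow_zero, Nat.div_one,
    ArithmeticFunction.moebius_apply_prime hp, ArithmeticFunction.moebius_apply_one]
  rw [pow_succ, Nat.mul_div_cancel _ hp.pos]
  push_cast; ring

theorem abs_oddInvMoebius_le {m : ℕ} (hm : 0 < m) :
    |oddInvMoebius m| * m ≤ (if Odd m then 1 else 2) * (m.totient : ℚ) := by
  induction m using Nat.recOnPosPrimePosCoprime with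
  | zero => simp at hm
  | one => simp [isMultiplicative_oddInvMoebius.map_one]
  | prime_pow p k hp hk =>
    obtain ⟨k, rfl⟩ : ∃ j, k = j + 1 := ⟨k - 1, by omega⟩
    rw [oddInvMoebius_prime_pow hp, Nat.totient_prime_pow_succ hp]
    simp only [oddInv_apply]
    have hp1 : (1 : ℚ) < p := by exact_mod_cast hp.one_lt
    have hc : ((p - 1 : ℕ) : ℚ) = p - 1 := by push_cast [hp.one_lt.le]; ring
    rcases hp.eq_two_or_odd' with rfl | hodd
    · rcases k.eq_zero_or_pos with rfl | hk0
      · norm_num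
      · have h1 : ¬ Odd (2 ^ (k + 1)) := by simp [Nat.even_pow]
        have h2 : ¬ Odd (2 ^ k) := by simp [Nat.even_pow]; omega
        simp only [h1, h2, if_false]; simp
    · have h1 : Odd (p ^ (k + 1)) := hodd.pow
      have h2 : Odd (p ^ k) := hodd.pow
      simp only [h1, h2, if_true]
      have hpk : (1 : ℚ) ≤ (p : ℚ) ^ k := one_le_pow₀ hp1.le
      have e : (1 / ((p ^ (k + 1) : ℕ) : ℚ) - 1 / ((p ^ k : ℕ) : ℚ)) =
          -((p - 1) / (p : ℚ) ^ (k + 1)) := by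
        push_cast; field_simp; ring
      rw [e, abs_neg, abs_of_nonneg (div_nonneg (by linarith) (by positivity))]
      push_cast
      rw [hc, div_mul_cancel₀ _ (by positivity)]
      nlinarith
  | coprime a b ha hb hab iha ihb =>
    rw [isMultiplicative_oddInvMoebius.map_mul_of_coprime hab, Nat.totient_mul hab, abs_mul]
    have h1 := iha (by omega)
    have h2 := ihb (by omega)
    have h3 := mul_le_mul h1 h2 (by positivity) (by split_ifs <;> positivity)
    push_cast
    calc |oddInvMoebius a| * |oddInvMoebius b| * (a * b)
        = |oddInvMoebius a| * a * (|oddInvMoebius b| * b) := by ring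
      _ ≤ _ := h3
      _ = ((if Odd a then 1 else 2) * (if Odd b then 1 else 2) : ℚ) *
          (a.totient * b.totient) := by ring
      _ = _ := by
        congr 1
        simp only [Nat.odd_mul]
        by_cases ho1 : Odd a <;> by_cases ho2 : Odd b <;> simp [ho1, ho2]
        rw [Nat.not_odd_iff_even] at ho1 ho2
        have := Nat.dvd_gcd ho1.two_dvd ho2.two_dvd
        rw [hab.gcd_eq_one] at this
        omega

theorem four_mul_coprimeDev {m : ℕ} (hm : 0 < m) :
    4 * coprimeDev m = m.totient + oddInvMoebius m := by
  have h1 : ∀ n : ℕ, n > 0 → ∑ d ∈ n.divisors, (4 * coprimeDev d - d.totient) = oddInv n := by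
    intro n hn
    rw [Finset.sum_sub_distrib, ← Finset.mul_sum, sum_divisors_coprimeDev hn, ← Nat.cast_sum,
      Nat.sum_totient, oddInv_apply]
    have : (n : ℚ) ≠ 0 := by exact_mod_cast hn.ne'
    split_ifs <;> field_simp <;> ring
  rw [ArithmeticFunction.sum_eq_iff_sum_mul_moebius_eq] at h1
  have h2 := h1 m hm
  rw [oddInvMoebius, ArithmeticFunction.mul_apply]
  simp only [ArithmeticFunction.intCoe_apply]
  linarith

theorem coprimeDev_le {m : ℕ} (hm : 2 ≤ m) : coprimeDev m ≤ 1 / 3 * m.totient := by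
  by_cases h24 : m = 2 ∨ m = 4
  · rcases h24 with rfl | rfl <;> decide +kernel
  have h1 := four_mul_coprimeDev (m := m) (by omega)
  have h2 := abs_oddInvMoebius_le (m := m) (by omega)
  have h3 := le_abs_self (oddInvMoebius m)
  have ht : (0 : ℚ) ≤ m.totient := by positivity
  by_cases ho : Odd m
  · simp only [ho, if_true] at h2
    have hm3 : (3 : ℚ) ≤ m := by
      have : 3 ≤ m := by rcases ho with ⟨j, hj⟩; omega
      exact_mod_cast this
    nlinarith [abs_nonneg (oddInvMoebius m)]
  · simp only [ho, if_false] at h2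
    have hm6 : (6 : ℚ) ≤ m := by
      have : 6 ≤ m := by
        rw [Nat.not_odd_iff_even] at ho
        rcases ho with ⟨j, hj⟩; omega
      exact_mod_cast this
    nlinarith [abs_nonneg (oddInvMoebius m)]

theorem coprimeDev_le_of_odd {m : ℕ} (hm : 2 ≤ m) (ho : Odd m) :
    coprimeDev m ≤ 4 / 15 * m.totient := by
  rcases lt_or_ge m 15 with hlt | hge
  · interval_cases m <;> first | (exact absurd ho (by decide)) | decide +kernel
  have h1 := four_mul_coprimeDev (m := m) (by omega)
  have h2 := abs_oddInvMoebius_le (m := m) (by omega)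
  have h3 := le_abs_self (oddInvMoebius m)
  have ht : (0 : ℚ) ≤ m.totient := by positivity
  simp only [ho, if_true] at h2
  have hm6 : (15 : ℚ) ≤ m := by exact_mod_cast hge
  nlinarith [abs_nonneg (oddInvMoebius m)]

theorem card_mul_sum_comp_monoidHom {G H : Type*} [Group G] [Group H] [Fintype G] [Fintype H]
    (π : G →* H) (hπ : Function.Surjective π) (ψ : H → ℝ) :
    Fintype.card H * ∑ g, ψ (π g) = Fintype.card G * ∑ h, ψ h := by
  have h1 : ∑ g, ∑ h, ψ (π g * h) = Fintype.card G * ∑ h, ψ h := by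
    have : ∀ g ∈ (Finset.univ : Finset G), ∑ h, ψ (π g * h) = ∑ h, ψ h := fun g _ =>
      Fintype.sum_equiv (Equiv.mulLeft (π g)) _ _ fun h => rfl
    rw [Finset.sum_congr rfl this]; simp
  have h2 : ∑ g, ∑ h, ψ (π g * h) = Fintype.card H * ∑ g, ψ (π g) := by
    rw [Finset.sum_comm]
    have : ∀ h ∈ (Finset.univ : Finset H), ∑ g, ψ (π g * h) = ∑ g, ψ (π g) := by
      intro h _
      obtain ⟨g₀, rfl⟩ := hπ h
      exact Fintype.sum_equiv (Equiv.mulRight g₀) _ _ fun g => by simp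
    rw [Finset.sum_congr rfl this]; simp
  rw [← h1, h2]

theorem sum_units_zmod_eq {A : Type*} [AddCommMonoid A] {m : ℕ} [NeZero m] (g : ℕ → A) :
    ∑ v : (ZMod m)ˣ, g (v : ZMod m).val = ∑ k ∈ Finset.range m with k.Coprime m, g k := by
  refine Finset.sum_bij (fun v _ => (v : ZMod m).val) ?_ ?_ ?_ ?_
  · intro v _
    simp only [Finset.mem_filter, Finset.mem_range]
    exact ⟨ZMod.val_lt _, ZMod.val_coe_unit_coprime v⟩
  · intro v _ w _ h
    exact Units.ext (ZMod.val_injective m h)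
  · intro k hk
    simp only [Finset.mem_filter, Finset.mem_range] at hk
    refine ⟨ZMod.unitOfCoprime k hk.2, Finset.mem_univ _, ?_⟩
    simp [ZMod.val_cast_of_lt hk.1]
  · intro v _; rfl

theorem sum_units_abs_fract_sub_le {M R x : ℕ} [NeZero M] (hRM : R ∣ M) (hx : ¬ R ∣ x) {β : ℚ}
    (hβ : ∀ o, 2 ≤ o → o ∣ R → coprimeDev o ≤ β * o.totient) :
    ∑ k : (ZMod M)ˣ, |Int.fract (((k : ZMod M).val * x : ℝ) / R) - 1 / 2| ≤ β * M.totient := by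
  have hM : 0 < M := Nat.pos_of_ne_zero (NeZero.ne M)
  have hR : 0 < R := Nat.pos_of_dvd_of_pos hRM hM
  have hg : 0 < Nat.gcd x R := Nat.gcd_pos_of_pos_right _ hR
  obtain ⟨u, o, hcop, hu, ho⟩ := Nat.exists_coprime x R
  set g := Nat.gcd x R
  have ho2 : 2 ≤ o := by
    by_contra hlt
    have : o = 0 ∨ o = 1 := by omega
    rcases this with h0 | h0
    · rw [h0, zero_mul] at ho; omega
    · rw [h0, one_mul] at ho; exact hx (ho ▸ Dvd.intro_left _ hu.symm)
  have hoR : o ∣ R := Dvd.intro _ ho.symm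
  have : NeZero o := ⟨by omega⟩
  have hoM := hoR.trans hRM
  set ψ : (ZMod o)ˣ → ℝ := fun v =>
    |(((v : ZMod o).val : ℝ) / o - 1 / 2)| with hψ
  set ub : (ZMod o)ˣ := ZMod.unitOfCoprime u hcop with hub
  have hterm : ∀ k : (ZMod M)ˣ, |Int.fract (((k : ZMod M).val * x : ℝ) / R) - 1 / 2| =
      ψ (ZMod.unitsMap hoM k * ub) := by
    intro k
    have hval : ((ZMod.unitsMap hoM k * ub : (ZMod o)ˣ) : ZMod o).val =
        (k : ZMod M).val * u % o := by
      rw [Units.val_mul, hub, ZMod.coe_unitOfCoprime, ZMod.unitsMap_val, ZMod.cast_eq_val,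
        ← Nat.cast_mul, ZMod.val_natCast]
    simp only [hψ, hval]
    congr 2
    have hg0 : (g : ℝ) ≠ 0 := by exact_mod_cast hg.ne'
    have : (((k : ZMod M).val * x : ℝ) / R) = (((k : ZMod M).val * u : ℕ) : ℝ) / o := by
      rw [hu, ho]
      have ho0 : (o : ℝ) ≠ 0 := by exact_mod_cast (by omega : o ≠ 0)
      push_cast; field_simp
    rw [this, Int.fract_div_natCast_eq_div_natCast_mod]
  have h1 := card_mul_sum_comp_monoidHom (ZMod.unitsMap hoM) (ZMod.unitsMap_surjective hoM)
    (fun v => ψ (v * ub))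
  have h2 : ∑ v, ψ (v * ub) = ∑ v, ψ v := Fintype.sum_equiv (Equiv.mulRight ub) _ _ fun v => rfl
  have h3 : ∑ v, ψ v = (coprimeDev o : ℝ) := by
    simp only [hψ]
    rw [sum_units_zmod_eq (fun k => |((k : ℝ) / o - 1 / 2)|), coprimeDev]
    push_cast; rfl
  rw [ZMod.card_units_eq_totient, ZMod.card_units_eq_totient, h2, h3] at h1
  rw [Finset.sum_congr rfl fun k _ => hterm k]
  have hφ : (0 : ℝ) < o.totient := by exact_mod_cast Nat.totient_pos.mpr (by omega : 0 < o)
  have h4 : (coprimeDev o : ℝ) ≤ β * o.totient := by exact_mod_cast hβ o ho2 hoR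
  refine le_of_mul_le_mul_left ?_ hφ
  rw [h1]
  calc (M.totient : ℝ) * coprimeDev o ≤ M.totient * (β * o.totient) := by gcongr
    _ = _ := by ring

open Polynomial in
theorem one_le_prod_norm_aeval_primitiveRoots {M : ℕ} [NeZero M] (F : ℤ[X]) {ζ : ℂ}
    (hζ : IsPrimitiveRoot ζ M) (hF : aeval ζ F ≠ 0) :
    1 ≤ ∏ μ ∈ primitiveRoots M ℂ, ‖aeval μ F‖ := by
  have hM : 0 < M := Nat.pos_of_ne_zero (NeZero.ne M)
  have : NeZero (M : ℚ) := ⟨by exact_mod_cast hM.ne'⟩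
  have : IsCyclotomicExtension {M} ℚ (CyclotomicField M ℚ) :=
    CyclotomicField.isCyclotomicExtension M ℚ
  set z : CyclotomicField M ℚ := IsCyclotomicExtension.zeta M ℚ (CyclotomicField M ℚ) with hz
  have hzp : IsPrimitiveRoot z M := IsCyclotomicExtension.zeta_spec M ℚ (CyclotomicField M ℚ)
  have hirr : Irreducible (cyclotomic M ℚ) := cyclotomic.irreducible_rat hM
  set a : CyclotomicField M ℚ := aeval z F with ha
  have hzi : IsIntegral ℤ z := hzp.isIntegral hM
  have hai : IsIntegral ℤ a := by
    rw [ha, aeval_def, eval₂_eq_sum_range]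
    exact IsIntegral.sum _ fun i _ => (isIntegral_algebraMap).mul (hzi.pow i)
  obtain ⟨m, hm⟩ : ∃ m : ℤ, algebraMap ℤ ℚ m = Algebra.norm ℚ a :=
    IsIntegrallyClosed.isIntegral_iff.mp (Algebra.isIntegral_norm ℚ hai)
  have hprod : (algebraMap ℚ ℂ (Algebra.norm ℚ a)) = ∏ μ ∈ primitiveRoots M ℂ, aeval μ F := by
    rw [Algebra.norm_eq_prod_embeddings ℚ ℂ a,
      ← Finset.prod_coe_sort (primitiveRoots M ℂ) (fun μ => aeval μ F)]
    refine Fintype.prod_equiv (hzp.embeddingsEquivPrimitiveRoots ℂ hirr) _ _ fun σ => ?_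
    rw [IsPrimitiveRoot.embeddingsEquivPrimitiveRoots_apply_coe, ha]
    have := Polynomial.aeval_algHom_apply (σ.restrictScalars ℤ) z F
    exact this.symm
  have ha0 : a ≠ 0 := by
    intro h0
    have hmem : ζ ∈ primitiveRoots M ℂ := (mem_primitiveRoots hM).mpr hζ
    have := (hzp.embeddingsEquivPrimitiveRoots ℂ hirr).apply_symm_apply ⟨ζ, hmem⟩
    have h1 := congrArg Subtype.val this
    rw [IsPrimitiveRoot.embeddingsEquivPrimitiveRoots_apply_coe] at h1
    apply hF
    have h2 := Polynomial.aeval_algHom_apply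
      (((hzp.embeddingsEquivPrimitiveRoots ℂ hirr).symm ⟨ζ, hmem⟩).restrictScalars ℤ) z F
    change aeval (((hzp.embeddingsEquivPrimitiveRoots ℂ hirr).symm ⟨ζ, hmem⟩) z) F = _ at h2
    rw [h1] at h2
    rw [h2, ← ha, h0, map_zero]
  have hm0 : m ≠ 0 := by
    rintro rfl
    rw [map_zero] at hm
    exact ha0 (Algebra.norm_eq_zero_iff.mp hm.symm)
  rw [← norm_prod, ← hprod, ← hm]
  have : (algebraMap ℚ ℂ) ((algebraMap ℤ ℚ) m) = (m : ℂ) := by simp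
  rw [this, Complex.norm_intCast]
  exact_mod_cast Int.one_le_abs hm0

open Polynomial in
theorem totient_le_sum_norm_aeval {M : ℕ} [NeZero M] (F : ℤ[X]) {ζ : ℂ}
    (hζ : IsPrimitiveRoot ζ M) (hF : aeval ζ F ≠ 0) :
    (M.totient : ℝ) ≤ ∑ k : (ZMod M)ˣ, ‖aeval (ζ ^ (k : ZMod M).val) F‖ := by
  have hM : 0 < M := Nat.pos_of_ne_zero (NeZero.ne M)
  have h1 := one_le_prod_norm_aeval_primitiveRoots F hζ hF
  have h2 : ∑ k : (ZMod M)ˣ, ‖aeval (ζ ^ (k : ZMod M).val) F‖ =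
      ∑ μ ∈ primitiveRoots M ℂ, ‖aeval μ F‖ := by
    rw [sum_units_zmod_eq (fun k => ‖aeval (ζ ^ k) F‖)]
    refine Finset.sum_bij (fun k _ => ζ ^ k) ?_ ?_ ?_ ?_
    · intro k hk
      simp only [Finset.mem_filter, Finset.mem_range] at hk
      exact (mem_primitiveRoots hM).mpr (hζ.pow_of_coprime k hk.2)
    · intro k hk k' hk' h
      simp only [Finset.mem_filter, Finset.mem_range] at hk hk'
      exact hζ.pow_inj hk.1 hk'.1 h
    · intro μ hμ
      obtain ⟨i, hi, hc, he⟩ :=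
        (hζ.isPrimitiveRoot_iff).mp ((mem_primitiveRoots hM).mp hμ)
      exact ⟨i, Finset.mem_filter.mpr ⟨Finset.mem_range.mpr hi, hc⟩, he⟩
    · intro k _; rfl
  rw [h2]
  have hpos : ∀ μ ∈ primitiveRoots M ℂ, 0 < ‖aeval μ F‖ := by
    intro μ hμ
    by_contra h0
    have h0' : ‖aeval μ F‖ = 0 := le_antisymm (not_lt.mp h0) (norm_nonneg _)
    rw [Finset.prod_eq_zero hμ h0'] at h1
    linarith
  have h3 : 0 ≤ ∑ μ ∈ primitiveRoots M ℂ, Real.log ‖aeval μ F‖ := by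
    rw [← Real.log_prod fun μ hμ => (hpos μ hμ).ne']
    exact Real.log_nonneg h1
  have h4 : ∀ μ ∈ primitiveRoots M ℂ, Real.log ‖aeval μ F‖ + 1 ≤ ‖aeval μ F‖ := by
    intro μ hμ
    have := Real.log_le_sub_one_of_pos (hpos μ hμ)
    linarith
  have h5 := Finset.sum_le_sum h4
  rw [Finset.sum_add_distrib] at h5
  simp only [Finset.sum_const, Complex.card_primitiveRoots, nsmul_eq_mul, mul_one] at h5
  linarith

open MvPolynomial in
theorem aeval_esymm_eq_of_aeval_psum_eq {n : ℕ} {α α' : Fin n → ℂ} {m : ℕ}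
    (h : ∀ j, 0 < j → j < m → aeval α (psum (Fin n) ℤ j) = aeval α' (psum (Fin n) ℤ j))
    {j : ℕ} (hj : j < m) :
    aeval α (esymm (Fin n) ℤ j) = aeval α' (esymm (Fin n) ℤ j) := by
  induction j using Nat.strong_induction_on with
  | _ j ih =>
    rcases Nat.eq_zero_or_pos j with rfl | hj0
    · simp
    have h1 := congrArg (aeval α) (mul_esymm_eq_sum (Fin n) ℤ j)
    have h2 := congrArg (aeval α') (mul_esymm_eq_sum (Fin n) ℤ j)
    simp only [map_mul, map_sum, map_natCast, map_pow, map_neg, map_one] at h1 h2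
    have hj' : (j : ℂ) ≠ 0 := by exact_mod_cast hj0.ne'
    apply mul_left_cancel₀ hj'
    rw [h1, h2]
    congr 1
    refine Finset.sum_congr rfl fun a ha => ?_
    simp only [Finset.mem_filter, Finset.HasAntidiagonal.mem_antidiagonal] at ha
    rw [ih a.1 ha.2 (by omega), h a.2 (by omega) (by omega)]

open MvPolynomial in
theorem aeval_psum_sub_aeval_psum {n : ℕ} {α α' : Fin n → ℂ} {m : ℕ} (hm : 0 < m)
    (h : ∀ j, 0 < j → j < m → aeval α (psum (Fin n) ℤ j) = aeval α' (psum (Fin n) ℤ j)) :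
    aeval α (psum (Fin n) ℤ m) - aeval α' (psum (Fin n) ℤ m) =
      (-1) ^ (m + 1) * (m * (aeval α (esymm (Fin n) ℤ m) - aeval α' (esymm (Fin n) ℤ m))) := by
  have h1 := congrArg (aeval α) (mul_esymm_eq_sum (Fin n) ℤ m)
  have h2 := congrArg (aeval α') (mul_esymm_eq_sum (Fin n) ℤ m)
  simp only [map_mul, map_sum, map_natCast, map_pow, map_neg, map_one] at h1 h2
  have hsq : ((-1 : ℂ) ^ (m + 1)) * (-1) ^ (m + 1) = 1 := by
    rw [← mul_pow]; simp
  rw [mul_sub, h1, h2, ← mul_sub, ← mul_assoc, hsq, one_mul, ← Finset.sum_sub_distrib]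
  rw [Finset.sum_eq_single (0, m)]
  · simp
  · intro a ha hne
    simp only [Finset.mem_filter, Finset.HasAntidiagonal.mem_antidiagonal] at ha
    have ha1 : a.1 ≠ 0 := by
      intro h0
      apply hne
      ext
      · exact h0
      · simp only; omega
    rw [aeval_esymm_eq_of_aeval_psum_eq h ha.2, h a.2 (by omega) (by omega), sub_self]
  · intro hn
    exact absurd (Finset.mem_filter.mpr ⟨Finset.HasAntidiagonal.mem_antidiagonal.mpr (by simp), hm⟩) hn

open MvPolynomial in
theorem exists_eq_of_aeval_psum_eq {n : ℕ} {α α' : Fin n → ℂ}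
    (h : ∀ j, 0 < j → j ≤ n → aeval α (psum (Fin n) ℤ j) = aeval α' (psum (Fin n) ℤ j))
    (i : Fin n) : ∃ j, α i = α' j := by
  have he : ∀ j ≤ n, (Finset.univ.val.map α).esymm j = (Finset.univ.val.map α').esymm j := by
    intro j hj
    rw [← aeval_esymm_eq_multiset_esymm (Fin n) ℤ, ← aeval_esymm_eq_multiset_esymm (Fin n) ℤ]
    exact aeval_esymm_eq_of_aeval_psum_eq (m := n + 1) (fun j h0 h1 => h j h0 (by omega))
      (by omega)
  have hp : ((Finset.univ.val.map α).map fun t => Polynomial.X - Polynomial.C t).prod =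
      ((Finset.univ.val.map α').map fun t => Polynomial.X - Polynomial.C t).prod := by
    rw [Multiset.prod_X_sub_X_eq_sum_esymm, Multiset.prod_X_sub_X_eq_sum_esymm]
    have hc : ∀ β : Fin n → ℂ, Multiset.card (Finset.univ.val.map β) = n := by intro β; simp
    rw [hc, hc]
    refine Finset.sum_congr rfl fun j hj => ?_
    rw [he j (by have := Finset.mem_range.mp hj; omega)]
  have h1 : Polynomial.eval (α i) ((Finset.univ.val.map α).map fun t =>
      Polynomial.X - Polynomial.C t).prod = 0 := by
    rw [Polynomial.eval_multiset_prod]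
    apply Multiset.prod_eq_zero
    simp only [Multiset.map_map, Multiset.mem_map, Finset.mem_val, Finset.mem_univ, true_and]
    exact ⟨i, by simp⟩
  rw [hp, Polynomial.eval_multiset_prod, Multiset.prod_eq_zero_iff] at h1
  simp only [Multiset.map_map, Multiset.mem_map, Finset.mem_val, Finset.mem_univ, true_and] at h1
  obtain ⟨j, hj⟩ := h1
  refine ⟨j, sub_eq_zero.mp ?_⟩
  simpa using hj

open Polynomial in
theorem aeval_pow_eq_zero_of_coprime {M k : ℕ} (hM : 0 < M) {ζ : ℂ} (hζ : IsPrimitiveRoot ζ M)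
    (hk : k.Coprime M) {F : ℤ[X]} (hF : aeval ζ F = 0) : aeval (ζ ^ k) F = 0 := by
  have h1 : minpoly ℤ ζ ∣ F := minpoly.isIntegrallyClosed_dvd (hζ.isIntegral hM) hF
  rw [hζ.minpoly_eq_pow_coprime hk] at h1
  obtain ⟨G, rfl⟩ := h1
  rw [map_mul, minpoly.aeval, zero_mul]

/-- The numerical inequality under which the `h`-th power sums are forced to agree: the main terms
of a set `S` of digit positions outweigh the error terms, `β` bounding the mean deviation of the
fractional parts from `1 / 2`. -/
def PowerSumGap (p f n : ℕ) (β : ℝ) (h : ℕ) : Prop :=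
  ∃ S ⊆ Finset.range f, (∀ t ∈ S, h * p ^ t < p ^ f - 1) ∧
    ∑ t ∈ S, (Real.pi * (h * p ^ t : ℕ) / (p ^ f - 1 : ℕ)) /
        Real.sin (Real.pi * (h * p ^ t : ℕ) / (p ^ f - 1 : ℕ)) * (2 * (n * β)) +
      ∑ t ∈ Finset.range f \ S, n / |Real.sin (Real.pi * (h * p ^ t : ℕ) / (p ^ f - 1 : ℕ))| <
    h * ∑ t ∈ S, 1 / (2 * Real.sin (Real.pi * (h * p ^ t : ℕ) / (p ^ f - 1 : ℕ)))

theorem isPrimitiveRoot_expTwoPiI {M : ℕ} (hM : 0 < M) : IsPrimitiveRoot (expTwoPiI (1 / M)) M := by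
  convert Complex.isPrimitiveRoot_exp M hM.ne' using 1
  rw [expTwoPiI]; congr 1; push_cast; ring

theorem sum_units_fractDev_le {p f n R M x : ℕ} [NeZero M] (hRM : R ∣ M) (hpR : p.Coprime R) (hx : ¬ R ∣ x) {β : ℚ}
    (hβ : ∀ o, 2 ≤ o → o ∣ R → coprimeDev o ≤ β * o.totient) (t : ℕ) :
    ∑ k : (ZMod M)ˣ, fractDev p f n R t ((k : ZMod M).val * x) ≤ n * β * M.totient := by
  simp only [fractDev]
  rw [Finset.sum_comm]
  have h1 : ∀ i ∈ Finset.range n, ∑ k : (ZMod M)ˣ,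
      |Int.fract ((p ^ ((i + 1) * f - t) * ((k : ZMod M).val * x : ℕ) : ℝ) / (R : ℝ)) - 1 / 2| ≤
        β * M.totient := by
    intro i _
    have h2 : ¬ R ∣ p ^ ((i + 1) * f - t) * x := by
      rwa [Nat.Coprime.dvd_mul_left (hpR.symm.pow_right _)]
    have h3 := sum_units_abs_fract_sub_le hRM h2 hβ
    refine le_trans (le_of_eq ?_) h3
    refine Finset.sum_congr rfl fun k _ => ?_
    congr 4
    push_cast; ring
  refine (Finset.sum_le_sum h1).trans_eq ?_
  simp; ring

open MvPolynomial in
theorem exists_modEq_of_powerSumGap {p f n R x x' : ℕ} (hp : p.Prime) (hf : 0 < f) (hn : 1 ≤ n)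
    (hR : R * (p ^ f - 1) = (p ^ f) ^ n - 1) (hnN : n < p ^ f - 1)
    (hs : ∀ κ : ℕ, κ.Coprime ((p ^ f) ^ n - 1) → ∀ b : ℕ,
      (p.digits ((κ * x + b * R) % ((p ^ f) ^ n - 1))).sum =
        (p.digits ((κ * x' + b * R) % ((p ^ f) ^ n - 1))).sum)
    (hx : ¬ R ∣ x) (hx' : ¬ R ∣ x') {β : ℚ}
    (hβ : ∀ o, 2 ≤ o → o ∣ R → coprimeDev o ≤ β * o.totient)
    (hgap : ∀ h, 1 ≤ h → h ≤ n → ¬ p ∣ h → PowerSumGap p f n β h) :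
    ∃ j : ℕ, x ≡ (p ^ f) ^ j * x' [MOD (p ^ f) ^ n - 1] := by
  set q := p ^ f with hq
  set N := q - 1 with hN
  set M := q ^ n - 1 with hM
  have hq1 : 1 < q := Nat.one_lt_pow hf.ne' hp.one_lt
  have hqn : 1 < q ^ n := Nat.one_lt_pow (by omega) hq1
  have hMpos : 0 < M := by omega
  have hNpos : 0 < N := by omega
  have hNeZero : NeZero M := ⟨hMpos.ne'⟩
  have hpq : ∀ m, 1 ≤ m → p.Coprime (q ^ m - 1) := by
    intro m hm
    have h1 : p ∣ q ^ m := dvd_pow (dvd_pow_self p hf.ne') (by omega)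
    have h2 : 1 ≤ q ^ m := Nat.one_le_pow _ _ (by omega)
    rw [hp.coprime_iff_not_dvd]
    intro h3
    have := (Nat.dvd_sub h1 h3)
    rw [Nat.sub_sub_self h2] at this
    exact hp.one_lt.ne' (Nat.dvd_one.mp this)
  have hpM : p.Coprime M := hpq n hn
  have hpN : p.Coprime N := by have := hpq 1 le_rfl; rwa [pow_one] at this
  have hRM : R ∣ M := Dvd.intro _ hR
  have hpR : p.Coprime R := Nat.Coprime.coprime_dvd_right hRM hpM
  set ζ := expTwoPiI (1 / M) with hζdef
  have hζ : IsPrimitiveRoot ζ M := isPrimitiveRoot_expTwoPiI hMpos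
  set a : ℕ → Fin n → Polynomial ℤ := fun x i => Polynomial.X ^ (q ^ (i.val + 1) * x) with ha
  set v : ℂ → ℕ → Fin n → ℂ := fun z x i => z ^ (q ^ (i.val + 1) * x) with hv
  have hav : ∀ (z : ℂ) (x : ℕ) (Q : MvPolynomial (Fin n) ℤ),
      Polynomial.aeval z (aeval (a x) Q) = aeval (v z x) Q := by
    intro z x Q
    rw [MvPolynomial.comp_aeval_apply]
    congr 2
    funext i
    simp [ha, hv]
  set D : ℕ → Polynomial ℤ := fun h => aeval (a x) (psum (Fin n) ℤ h) -
    aeval (a x') (psum (Fin n) ℤ h) with hD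
  set Ds : ℕ → Polynomial ℤ := fun h => aeval (a x) (esymm (Fin n) ℤ h) -
    aeval (a x') (esymm (Fin n) ℤ h) with hDs
  have hpow : ∀ (k X h : ℕ), aeval (v (ζ ^ k) X) (psum (Fin n) ℤ h) = expPowerSum q n h (k * X) := by
    intro k X h
    rw [psum, map_sum, expPowerSum, ← Fin.sum_univ_eq_sum_range (fun i =>
      expTwoPiI (h * (q ^ (i + 1) * (k * X : ℕ)) / ((q ^ n - 1 : ℕ) : ℝ))) n]
    refine Finset.sum_congr rfl fun i _ => ?_
    rw [map_pow, aeval_X]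
    simp only [hv]
    rw [← pow_mul, ← pow_mul, hζdef, ← expTwoPiI_natCast_mul]
    congr 1
    rw [← hM]
    push_cast; ring
  have main : ∀ h, 1 ≤ h → h ≤ n → Polynomial.aeval ζ (D h) = 0 := by
    intro h
    induction h using Nat.strong_induction_on with
    | _ h ih =>
      intro h1 hhn
      by_cases hph : p ∣ h
      · obtain ⟨m, rfl⟩ := hph
        have hm1 : 1 ≤ m := Nat.pos_of_mul_pos_left h1
        have hlt : m < p * m := by nlinarith [hp.two_le]
        have h2 := aeval_pow_eq_zero_of_coprime hMpos hζ hpM (ih m hlt hm1 (by omega))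
        have h3 : ∀ X, aeval (v (ζ ^ p) X) (psum (Fin n) ℤ m) =
            aeval (v ζ X) (psum (Fin n) ℤ (p * m)) := by
          intro X
          simp only [psum, map_sum, map_pow, aeval_X, hv]
          refine Finset.sum_congr rfl fun i _ => ?_
          rw [← pow_mul ζ, ← pow_mul ζ, ← pow_mul ζ]; congr 1; ring
        simp only [hD, map_sub, hav] at h2 ⊢
        rwa [h3, h3] at h2
      · obtain ⟨S, hS, hSc, hlt⟩ := hgap h h1 hhn hph
        have hnewton : ∀ k : (ZMod M)ˣ, ‖Polynomial.aeval (ζ ^ (k : ZMod M).val) (D h)‖ =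
            h * ‖Polynomial.aeval (ζ ^ (k : ZMod M).val) (Ds h)‖ := by
          intro k
          have h2 := aeval_psum_sub_aeval_psum (α := v (ζ ^ (k : ZMod M).val) x)
            (α' := v (ζ ^ (k : ZMod M).val) x') (m := h) h1 (by
              intro j hj0 hjh
              have := aeval_pow_eq_zero_of_coprime hMpos hζ (ZMod.val_coe_unit_coprime k)
                (ih j hjh hj0 (by omega))
              simp only [hD, map_sub, hav] at this
              exact sub_eq_zero.mp this)
          simp only [hD, hDs, map_sub, hav]
          rw [h2, norm_mul, norm_mul]
          simp
        have hDs0 : Polynomial.aeval ζ (Ds h) = 0 := by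
          by_contra hne
          have h2 := totient_le_sum_norm_aeval (Ds h) hζ hne
          set K := ∑ t ∈ S, 1 / (2 * Real.sin (Real.pi * (h * p ^ t : ℕ) / N)) with hK
          set I := ∑ t ∈ Finset.range f \ S,
            n / |Real.sin (Real.pi * (h * p ^ t : ℕ) / N)| with hI
          have h3 : ∀ k : (ZMod M)ˣ, K * (h * ‖Polynomial.aeval (ζ ^ (k : ZMod M).val) (Ds h)‖) ≤
              ∑ t ∈ S, (Real.pi * (h * p ^ t : ℕ) / N) / Real.sin (Real.pi * (h * p ^ t : ℕ) / N) *
                (fractDev p f n R t ((k : ZMod M).val * x) +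
                  fractDev p f n R t ((k : ZMod M).val * x')) + I := by
            intro k
            rw [← hnewton]
            have h4 := norm_expPowerSum_sub_le (X := (k : ZMod M).val * x)
              (X' := (k : ZMod M).val * x') (h := h) hp.one_lt hf hn hR
              (hs _ (ZMod.val_coe_unit_coprime k)) (by
                intro t hdvd
                rw [Nat.Coprime.dvd_mul_right (hpN.symm.pow_right t)] at hdvd
                have := Nat.le_of_dvd h1 hdvd
                omega) hS hSc
            simp only [hD, map_sub, hav]
            rw [hpow, hpow]
            exact h4
          have h5 := Finset.sum_le_sum fun k (_ : k ∈ Finset.univ) => h3 k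
          rw [← Finset.mul_sum, ← Finset.mul_sum, Finset.sum_add_distrib, Finset.sum_comm] at h5
          simp only [Finset.sum_const, Finset.card_univ, ZMod.card_units_eq_totient,
            nsmul_eq_mul] at h5
          have hθpos : ∀ t ∈ S, 0 ≤ Real.sin (Real.pi * (h * p ^ t : ℕ) / N) := by
            intro t ht
            have hlt : ((h * p ^ t : ℕ) : ℝ) < N := by exact_mod_cast hSc t ht
            have hNp : (0 : ℝ) < N := by exact_mod_cast hNpos
            apply Real.sin_nonneg_of_nonneg_of_le_pi
            · positivity
            · rw [div_le_iff₀ hNp]; exact mul_le_mul_of_nonneg_left hlt.le Real.pi_pos.le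
          have h6 : ∀ t ∈ S, ∑ k : (ZMod M)ˣ,
              (Real.pi * (h * p ^ t : ℕ) / N) / Real.sin (Real.pi * (h * p ^ t : ℕ) / N) *
                (fractDev p f n R t ((k : ZMod M).val * x) +
                  fractDev p f n R t ((k : ZMod M).val * x')) ≤
              M.totient * ((Real.pi * (h * p ^ t : ℕ) / N) /
                Real.sin (Real.pi * (h * p ^ t : ℕ) / N) * (2 * (n * β))) := by
            intro t ht
            rw [← Finset.mul_sum, Finset.sum_add_distrib]
            have e1 := sum_units_fractDev_le (f := f) (n := n) hRM hpR hx hβ t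
            have e2 := sum_units_fractDev_le (f := f) (n := n) hRM hpR hx' hβ t
            have e3 := hθpos t ht
            calc _ ≤ (Real.pi * (h * p ^ t : ℕ) / N) / Real.sin (Real.pi * (h * p ^ t : ℕ) / N) *
                (n * β * M.totient + n * β * M.totient) := by gcongr
              _ = _ := by ring
          have h7 := Finset.sum_le_sum h6
          rw [← Finset.mul_sum] at h7
          have hK0 : 0 ≤ K := Finset.sum_nonneg fun t ht => by
            have := hθpos t ht
            positivity
          have hφ : (0 : ℝ) < M.totient := by exact_mod_cast Nat.totient_pos.mpr hMpos
          have h8 : (M.totient : ℝ) * (h * K) ≤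
              K * (h * ∑ k : (ZMod M)ˣ, ‖Polynomial.aeval (ζ ^ (k : ZMod M).val) (Ds h)‖) := by
            calc (M.totient : ℝ) * (h * K) = K * (h * M.totient) := by ring
              _ ≤ _ := by gcongr
          have h9 := mul_lt_mul_of_pos_left hlt hφ
          rw [mul_add] at h9
          linarith
        have h11 : ‖Polynomial.aeval ζ (D h)‖ = h * ‖Polynomial.aeval ζ (Ds h)‖ := by
          have h2 := aeval_psum_sub_aeval_psum (α := v ζ x) (α' := v ζ x') (m := h) h1 (by
              intro j hj0 hjh
              have := ih j hjh hj0 (by omega)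
              simp only [hD, map_sub, hav] at this
              exact sub_eq_zero.mp this)
          simp only [hD, hDs, map_sub, hav]
          rw [h2, norm_mul, norm_mul]
          simp
        rw [hDs0, norm_zero, mul_zero] at h11
        exact norm_eq_zero.mp h11
  obtain ⟨j, hj⟩ := exists_eq_of_aeval_psum_eq (α := v ζ x) (α' := v ζ x') (fun h h0 h1 => by
    have := main h h0 h1
    simp only [hD, map_sub, hav] at this
    exact sub_eq_zero.mp this) ⟨n - 1, by omega⟩
  refine ⟨j.val + 1, ?_⟩
  simp only [hv] at hj
  have hmod : ∀ m, ζ ^ m = ζ ^ (m % M) := fun m => by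
    conv_rhs => rw [hζ.eq_orderOf, pow_mod_orderOf]
  have h1 := hζ.pow_inj (Nat.mod_lt _ hMpos) (Nat.mod_lt _ hMpos) ((hmod _).symm.trans (hj.trans (hmod _)))
  change q ^ (n - 1 + 1) * x ≡ q ^ (j.val + 1) * x' [MOD M] at h1
  rw [Nat.sub_add_cancel hn] at h1
  refine Nat.ModEq.trans ?_ h1
  have h2 : q ^ n ≡ 1 [MOD M] := ((Nat.modEq_iff_dvd' (by omega)).mpr dvd_rfl).symm
  have := (h2.mul_right x).symm
  rwa [one_mul] at this

lemma nonneg_of_hasDerivAt_nonneg {g g' : ℝ → ℝ} (hg : ∀ y, HasDerivAt g (g' y) y) (h0 : g 0 = 0)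
    (hg' : ∀ y, 0 ≤ y → 0 ≤ g' y) {x : ℝ} (hx : 0 ≤ x) : 0 ≤ g x := by
  have := monotoneOn_of_deriv_nonneg (convex_Ici 0) (f := g)
    (fun y _ => (hg y).continuousAt.continuousWithinAt)
    (fun y _ => (hg y).differentiableAt.differentiableWithinAt)
    (fun y hy => by rw [(hg y).deriv]; rw [interior_Ici] at hy; exact hg' y (le_of_lt hy))
  rw [← h0]
  exact this (Set.mem_Ici.mpr le_rfl) (Set.mem_Ici.mpr hx) hx

lemma sin_ge_taylor_three {x : ℝ} (hx : 0 ≤ x) : x - x ^ 3 / 6 ≤ Real.sin x := by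
  have := nonneg_of_hasDerivAt_nonneg (g := fun y => Real.sin y - (y - y ^ 3 / 6))
    (g' := fun y => Real.cos y - (1 - (3 : ℕ) * y ^ 2 / 6))
    (fun y => (Real.hasDerivAt_sin y).sub ((hasDerivAt_id y).sub ((hasDerivAt_pow 3 y).div_const 6)))
    (by simp) (fun y _ => by
      have := Real.one_sub_sq_div_two_le_cos (x := y)
      push_cast; linarith) hx
  linarith

lemma cos_le_taylor_four {x : ℝ} (hx : 0 ≤ x) : Real.cos x ≤ 1 - x ^ 2 / 2 + x ^ 4 / 24 := by
  have := nonneg_of_hasDerivAt_nonneg (g := fun y => (1 - y ^ 2 / 2 + y ^ 4 / 24) - Real.cos y)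
    (g' := fun y => (0 - (2 : ℕ) * y ^ 1 / 2 + (4 : ℕ) * y ^ 3 / 24) - -Real.sin y)
    (fun y => ((((hasDerivAt_const y 1).sub ((hasDerivAt_pow 2 y).div_const 2)).add
      ((hasDerivAt_pow 4 y).div_const 24))).sub (Real.hasDerivAt_cos y))
    (by simp) (fun y hy => by
      have := sin_ge_taylor_three hy
      push_cast; linarith) hx
  linarith

lemma sin_le_taylor_five {x : ℝ} (hx : 0 ≤ x) :
    Real.sin x ≤ x - x ^ 3 / 6 + x ^ 5 / 120 := by
  have := nonneg_of_hasDerivAt_nonneg (g := fun y => (y - y ^ 3 / 6 + y ^ 5 / 120) - Real.sin y)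
    (g' := fun y => (1 - (3 : ℕ) * y ^ 2 / 6 + (5 : ℕ) * y ^ 4 / 120) - Real.cos y)
    (fun y => ((((hasDerivAt_id y).sub ((hasDerivAt_pow 3 y).div_const 6)).add
      ((hasDerivAt_pow 5 y).div_const 120))).sub (Real.hasDerivAt_sin y))
    (by simp) (fun y hy => by
      have := cos_le_taylor_four hy
      push_cast; linarith) hx
  linarith

lemma cos_ge_taylor_six {x : ℝ} (hx : 0 ≤ x) :
    1 - x ^ 2 / 2 + x ^ 4 / 24 - x ^ 6 / 720 ≤ Real.cos x := by
  have := nonneg_of_hasDerivAt_nonneg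
    (g := fun y => Real.cos y - (1 - y ^ 2 / 2 + y ^ 4 / 24 - y ^ 6 / 720))
    (g' := fun y => -Real.sin y -
      (0 - (2 : ℕ) * y ^ 1 / 2 + (4 : ℕ) * y ^ 3 / 24 - (6 : ℕ) * y ^ 5 / 720))
    (fun y => (Real.hasDerivAt_cos y).sub (((((hasDerivAt_const y 1).sub
      ((hasDerivAt_pow 2 y).div_const 2)).add ((hasDerivAt_pow 4 y).div_const 24))).sub
      ((hasDerivAt_pow 6 y).div_const 720)))
    (by simp) (fun y hy => by
      have := sin_le_taylor_five hy
      push_cast; linarith) hx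
  linarith

lemma sin_ge_taylor_seven {x : ℝ} (hx : 0 ≤ x) :
    x - x ^ 3 / 6 + x ^ 5 / 120 - x ^ 7 / 5040 ≤ Real.sin x := by
  have := nonneg_of_hasDerivAt_nonneg
    (g := fun y => Real.sin y - (y - y ^ 3 / 6 + y ^ 5 / 120 - y ^ 7 / 5040))
    (g' := fun y => Real.cos y -
      (1 - (3 : ℕ) * y ^ 2 / 6 + (5 : ℕ) * y ^ 4 / 120 - (7 : ℕ) * y ^ 6 / 5040))
    (fun y => (Real.hasDerivAt_sin y).sub (((((hasDerivAt_id y).sub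
      ((hasDerivAt_pow 3 y).div_const 6)).add ((hasDerivAt_pow 5 y).div_const 120))).sub
      ((hasDerivAt_pow 7 y).div_const 5040)))
    (by simp) (fun y hy => by
      have := cos_ge_taylor_six hy
      push_cast; linarith) hx
  linarith

lemma div_sin_le_one_add {x : ℝ} (h0 : 0 < x) (h1 : x ≤ Real.pi / 2) :
    x / Real.sin x ≤ 1 + x ^ 2 / 6 + 264 / 10000 * x ^ 4 := by
  have hpi := Real.pi_lt_d6
  have hs : 0 < Real.sin x := Real.sin_pos_of_pos_of_lt_pi h0 (by linarith)
  rw [div_le_iff₀ hs]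
  have h2 := sin_ge_taylor_seven h0.le
  have hu : x ^ 2 ≤ 24675 / 10000 := by nlinarith
  have hu0 : 0 < x ^ 2 := by positivity
  refine le_trans ?_ (mul_le_mul_of_nonneg_left h2 (by positivity))
  obtain ⟨u, hu'⟩ : ∃ u, u = x ^ 2 := ⟨_, rfl⟩
  rw [← hu'] at hu hu0
  have key : 0 ≤ (1 / 120 - 1 / 36 + 264 / 10000 : ℝ) + (-1 / 5040 + 1 / 720 - 264 / 60000) * u +
      (-1 / 30240 + 264 / 1200000) * u ^ 2 - 264 / 50400000 * u ^ 3 := by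
    nlinarith [mul_nonneg hu0.le (sub_nonneg.2 hu), mul_nonneg hu0.le (mul_nonneg hu0.le (sub_nonneg.2 hu)), sq_nonneg (u - 24675 / 10000)]
  have : 0 ≤ x * u ^ 2 * ((1 / 120 - 1 / 36 + 264 / 10000 : ℝ) + (-1 / 5040 + 1 / 720 - 264 / 60000) * u +
      (-1 / 30240 + 264 / 1200000) * u ^ 2 - 264 / 50400000 * u ^ 3) := by positivity
  rw [hu'] at this
  nlinarith [this]

lemma one_div_sin_ge {x : ℝ} (h0 : 0 < x) (h1 : x ≤ Real.pi / 2) :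
    1 / x + x / 6 ≤ 1 / Real.sin x := by
  have hpi := Real.pi_lt_d6
  have hs : 0 < Real.sin x := Real.sin_pos_of_pos_of_lt_pi h0 (by linarith)
  rw [le_div_iff₀ hs]
  have h2 := sin_le_taylor_five h0.le
  calc (1 / x + x / 6) * Real.sin x ≤ (1 / x + x / 6) * (x - x ^ 3 / 6 + x ^ 5 / 120) := by gcongr
    _ = 1 - x ^ 4 * (7 / 360 - x ^ 2 / 720) := by field_simp; ring
    _ ≤ 1 := by
      have : x ^ 2 ≤ 24675 / 10000 := by nlinarith
      have : 0 ≤ x ^ 4 * (7 / 360 - x ^ 2 / 720) := mul_nonneg (by positivity) (by linarith)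
      linarith

/-- `1 / sin y ≤ 1 / y + 1 / 2`, multiplied by `y`. -/
lemma div_sin_le_one_add_half {x : ℝ} (h0 : 0 < x) (h1 : x ≤ 1645 / 1000) :
    x / Real.sin x ≤ 1 + x / 2 := by
  have hs : 0 < Real.sin x := Real.sin_pos_of_pos_of_lt_pi h0 (by linarith [Real.pi_gt_three])
  rw [div_le_iff₀ hs]
  refine le_trans ?_ (mul_le_mul_of_nonneg_left (sin_ge_taylor_three h0.le) (by positivity))
  have : 0 ≤ x ^ 2 * (6 - 2 * x - x ^ 2) := mul_nonneg (by positivity) (by nlinarith)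
  nlinarith

/-- The distance from `c` to the nearest multiple of `N`. -/
def distMultiple (N c : ℕ) : ℕ := min (c % N) (N - c % N)

/-- An upper bound for `10 ^ 6 * y / sin y` where `y = π c / N ≤ π / 2`. -/
def divSinBound (N c : ℕ) : ℕ :=
  10 ^ 6 + 1645000 * c ^ 2 / N ^ 2 + 2580000 * c ^ 4 / N ^ 4 + 2

/-- An upper bound for `10 ^ 6 * (π / N) * (n / |sin (π c / N)|)`. -/
def incoherentCost (N n c : ℕ) : ℕ :=
  n * divSinBound N (distMultiple N c) / distMultiple N c + 1

/-- A lower bound for `10 ^ 6 * (π / N) * (h / (2 * sin (π h p ^ t / N)))`. -/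
def coherentGain (p N h t : ℕ) : ℕ :=
  10 ^ 6 / (2 * p ^ t) + 822000 * (h * (h * p ^ t)) / N ^ 2

/-- An upper bound for `10 ^ 6 * (π / N) * (y / sin y) * (2 * n * b / 15)` where `y = π c / N`. -/
def coherentCost (N n b c : ℕ) : ℕ :=
  2 * n * b * 31416 * divSinBound N c / (150000 * N) + 1

/-- The indices `t` that are put into the set `S` of `PowerSumGap`. -/
def isCoherent (p N n b h t : ℕ) : Bool :=
  Nat.ble (2 * (h * p ^ t)) N && Nat.ble (coherentCost N n b (h * p ^ t))
    (coherentGain p N h t + incoherentCost N n (h * p ^ t))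

/-- A sufficient criterion for `PowerSumGap` with `β = b / 15`. -/
def powerSumGapCheck (p f n b h : ℕ) : Bool :=
  Nat.blt
    ((List.range f).map fun t => bif isCoherent p (p ^ f - 1) n b h t then
      coherentCost (p ^ f - 1) n b (h * p ^ t) else incoherentCost (p ^ f - 1) n (h * p ^ t)).sum
    ((List.range f).map fun t => bif isCoherent p (p ^ f - 1) n b h t then
      coherentGain p (p ^ f - 1) h t else 0).sum

lemma div_le_natCast_div_add_one (a b : ℕ) : (a : ℝ) / b ≤ (a / b : ℕ) + 1 := by
  rcases Nat.eq_zero_or_pos b with rfl | hb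
  · simp
  · have hb' : (0 : ℝ) < b := by exact_mod_cast hb
    rw [div_le_iff₀ hb']
    have h1 := Nat.lt_div_mul_add hb (a := a)
    have : (a : ℝ) < (a / b : ℕ) * b + b := by exact_mod_cast h1
    linarith

lemma pi_mul_div_sin_le {c N : ℕ} (hc : 0 < c) (hcN : 2 * c ≤ N) :
    10 ^ 6 * ((Real.pi * c / N) / Real.sin (Real.pi * c / N)) ≤ divSinBound N c := by
  have hN : (0 : ℝ) < N := by exact_mod_cast (by omega : 0 < N)
  have hc' : (0 : ℝ) < c := by exact_mod_cast hc
  have h2 : (2 : ℝ) * c ≤ N := by exact_mod_cast hcN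
  have h1 : Real.pi * c / N ≤ Real.pi / 2 := by
    rw [div_le_div_iff₀ hN two_pos]; nlinarith [Real.pi_pos]
  have hx : 0 < Real.pi * c / N := by positivity
  have h3 := div_sin_le_one_add hx h1
  have hpi := Real.pi_lt_d6
  have hp2 : Real.pi ^ 2 ≤ 98697 / 10000 := by nlinarith [Real.pi_pos]
  have hp4 : Real.pi ^ 4 ≤ (98697 / 10000) ^ 2 := by
    rw [show Real.pi ^ 4 = (Real.pi ^ 2) ^ 2 by ring]; gcongr
  have d2 := div_le_natCast_div_add_one (1645000 * c ^ 2) (N ^ 2)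
  have d4 := div_le_natCast_div_add_one (2580000 * c ^ 4) (N ^ 4)
  unfold divSinBound
  push_cast at d2 d4 ⊢
  rw [mul_div_assoc, ← div_pow] at d2 d4
  have e : Real.pi * c / N = Real.pi * (c / N) := by ring
  rw [e, mul_pow, mul_pow] at h3
  rw [e]
  have a2 : (0 : ℝ) ≤ (c / N : ℝ) ^ 2 := by positivity
  have a4 : (0 : ℝ) ≤ (c / N : ℝ) ^ 4 := by positivity
  nlinarith

lemma abs_sin_pi_mul_div_eq {c N : ℕ} (hN : 0 < N) :
    |Real.sin (Real.pi * c / N)| = |Real.sin (Real.pi * distMultiple N c / N)| := by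
  have hN' : (N : ℝ) ≠ 0 := by positivity
  have hmod : |Real.sin (Real.pi * c / N)| = |Real.sin (Real.pi * (c % N : ℕ) / N)| := by
    have : Real.pi * c / N = Real.pi * (c % N : ℕ) / N + (c / N : ℕ) * Real.pi := by
      have : (c : ℝ) = (c % N : ℕ) + N * (c / N : ℕ) := by exact_mod_cast (Nat.mod_add_div c N).symm
      rw [this]; field_simp
    rw [this, Real.sin_add_nat_mul_pi, abs_mul, abs_pow, abs_neg, abs_one, one_pow, one_mul]
  rw [hmod, distMultiple]
  rcases min_choice (c % N) (N - c % N) with h | h <;> rw [h]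
  rw [Nat.cast_sub (Nat.mod_lt _ hN).le, mul_sub, sub_div, mul_div_cancel_right₀ _ hN',
    Real.sin_pi_sub]

lemma div_abs_sin_le {n c N : ℕ} (hN : 0 < N) (hc : ¬ N ∣ c) :
    10 ^ 6 * (Real.pi / N) * (n / |Real.sin (Real.pi * c / N)|) ≤ incoherentCost N n c := by
  have hr := Nat.pos_of_ne_zero fun h => hc (Nat.dvd_of_mod_eq_zero h)
  have hr' := Nat.mod_lt c hN
  have hd : 0 < distMultiple N c := by unfold distMultiple; omega
  have hd2 : 2 * distMultiple N c ≤ N := by unfold distMultiple; omega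
  rw [abs_sin_pi_mul_div_eq hN]
  unfold incoherentCost
  have h1 := pi_mul_div_sin_le hd hd2
  set d := distMultiple N c
  have hN' : (0 : ℝ) < N := by exact_mod_cast hN
  have hd' : (0 : ℝ) < d := by exact_mod_cast hd
  have h2 : (2 : ℝ) * d ≤ N := by exact_mod_cast hd2
  have hs : 0 < Real.sin (Real.pi * d / N) := by
    apply Real.sin_pos_of_pos_of_lt_pi (by positivity)
    rw [div_lt_iff₀ hN']; nlinarith [Real.pi_pos]
  rw [abs_of_pos hs]
  push_cast
  refine le_trans ?_ (div_le_natCast_div_add_one _ _)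
  push_cast
  calc 10 ^ 6 * (Real.pi / N) * (n / Real.sin (Real.pi * d / N)) =
      n * (10 ^ 6 * ((Real.pi * d / N) / Real.sin (Real.pi * d / N))) / d := by field_simp
    _ ≤ _ := by gcongr

lemma coherentGain_le {p N h t : ℕ} (hp : 0 < p) (hh : 0 < h) (hcN : 2 * (h * p ^ t) ≤ N) :
    (coherentGain p N h t : ℝ) ≤ 10 ^ 6 * (Real.pi / N) *
      (h * (1 / (2 * Real.sin (Real.pi * (h * p ^ t : ℕ) / N)))) := by
  have hc : 0 < h * p ^ t := by positivity
  have hN : (0 : ℝ) < N := by exact_mod_cast (by omega : 0 < N)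
  have hc' : (0 : ℝ) < (h * p ^ t : ℕ) := by exact_mod_cast hc
  have h2 : (2 : ℝ) * (h * p ^ t : ℕ) ≤ N := by exact_mod_cast hcN
  have h3 : Real.pi * (h * p ^ t : ℕ) / N ≤ Real.pi / 2 := by
    rw [div_le_div_iff₀ hN two_pos]; nlinarith [Real.pi_pos]
  have hx : 0 < Real.pi * (h * p ^ t : ℕ) / N := by positivity
  have h4 := one_div_sin_ge hx h3
  have hh' : (0 : ℝ) < h := by exact_mod_cast hh
  have hp' : (0 : ℝ) < p := by exact_mod_cast hp
  have e : 10 ^ 6 * (Real.pi / N) * (h * (1 / (2 * Real.sin (Real.pi * (h * p ^ t : ℕ) / N)))) =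
    10 ^ 6 * (Real.pi / N) * h / 2 * (1 / Real.sin (Real.pi * (h * p ^ t : ℕ) / N)) := by ring
  rw [e]
  refine le_trans ?_ (mul_le_mul_of_nonneg_left h4 (by positivity))
  have e2 : 10 ^ 6 * (Real.pi / N) * h / 2 * (1 / (Real.pi * (h * p ^ t : ℕ) / N) +
    Real.pi * (h * p ^ t : ℕ) / N / 6) = 10 ^ 6 / (2 * p ^ t) +
      Real.pi ^ 2 / 12 * 10 ^ 6 * (h * (h * p ^ t)) / N ^ 2 := by
    push_cast; field_simp; ring
  rw [e2]
  have : (822000 : ℝ) ≤ Real.pi ^ 2 / 12 * 10 ^ 6 := by nlinarith [Real.pi_gt_d6]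
  unfold coherentGain
  push_cast
  refine add_le_add (Nat.cast_div_le.trans (by push_cast; norm_num))
    (Nat.cast_div_le.trans ?_)
  push_cast
  gcongr

lemma le_coherentCost {N n b c : ℕ} (hc : 0 < c) (hcN : 2 * c ≤ N) :
    10 ^ 6 * (Real.pi / N) * ((Real.pi * c / N) / Real.sin (Real.pi * c / N) *
      (2 * (n * (b / 15 : ℝ)))) ≤ coherentCost N n b c := by
  have h1 := pi_mul_div_sin_le hc hcN
  have hN : (0 : ℝ) < N := by exact_mod_cast (by omega : 0 < N)
  have := Real.pi_lt_d6
  unfold coherentCost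
  push_cast
  refine le_trans ?_ (div_le_natCast_div_add_one _ _)
  push_cast
  calc _ = Real.pi * (10 ^ 6 * ((Real.pi * c / N) / Real.sin (Real.pi * c / N))) *
        (2 * (n * (b / 15 : ℝ))) / N := by ring
    _ ≤ 31416 / 10000 * divSinBound N c * (2 * (n * (b / 15 : ℝ))) / N := by
        have h2 : Real.pi * (10 ^ 6 * ((Real.pi * c / N) / Real.sin (Real.pi * c / N))) ≤
            31416 / 10000 * divSinBound N c :=
          (mul_le_mul_of_nonneg_left h1 Real.pi_pos.le).trans (by gcongr; linarith)
        gcongr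
    _ = _ := by field_simp; ring

lemma powerSumGap_of_check {p f n b h : ℕ} (hp : p.Prime) (hf : 0 < f)
    (hh : 0 < h) (hhN : h < p ^ f - 1) (hchk : powerSumGapCheck p f n b h = true) :
    PowerSumGap p f n (b / 15) h := by
  have hq : p ^ f ≠ 0 := by have := hp.pos; positivity
  have hpN : Nat.Coprime (p ^ f - 1) p := by
    have h1 : Nat.Coprime (p ^ f - 1) (p ^ f) := by
      have := Nat.coprime_self_sub_left (m := 1) (n := p ^ f) (by omega)
      exact this.mpr (Nat.coprime_one_left _)
    exact h1.coprime_dvd_right (dvd_pow_self p hf.ne')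
  set N := p ^ f - 1 with hN
  have hndvd : ∀ t, ¬ N ∣ h * p ^ t := fun t hd => by
    rw [(hpN.pow_right t).dvd_mul_right] at hd
    have := Nat.le_of_dvd hh hd
    omega
  have hpos : ∀ t, 0 < h * p ^ t := fun t => by have := hp.pos; positivity
  have hcoh : ∀ t, isCoherent p N n b h t = true → 2 * (h * p ^ t) ≤ N := fun t ht => by
    simp only [isCoherent, Bool.and_eq_true, Nat.ble_eq] at ht
    exact ht.1
  refine ⟨(Finset.range f).filter fun t => isCoherent p N n b h t = true,
    Finset.filter_subset _ _, ?_, ?_⟩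
  · intro t ht
    have h1 := hcoh t (Finset.mem_filter.mp ht).2
    have := hpos t
    show h * p ^ t < N
    omega
  · rw [← hN]
    simp only [powerSumGapCheck, Nat.blt_eq, ← hN, cond_eq_ite] at hchk
    have e : ∀ (g : ℕ → ℕ), ((List.range f).map g).sum = ∑ t ∈ Finset.range f, g t := by
      intro g; rw [← List.sum_toFinset _ List.nodup_range, List.toFinset_range]
    rw [e, e, Finset.sum_ite, Finset.sum_ite, Finset.sum_const_zero, add_zero] at hchk
    have hchk' := (Nat.cast_lt (α := ℝ)).mpr hchk
    have hfilter : ∀ (P : ℕ → Prop) [DecidablePred P], Finset.range f \ (Finset.range f).filter P =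
        (Finset.range f).filter fun t => ¬ P t := fun P _ => by
      rw [← Finset.filter_not]
    rw [hfilter, Finset.mul_sum]
    push_cast at hchk'
    have a0 := Finset.sum_le_sum fun t (ht : t ∈ (Finset.range f).filter fun t =>
      isCoherent p N n b h t = true) => coherentGain_le hp.pos hh (hcoh t (Finset.mem_filter.mp ht).2)
    have a1 := Finset.sum_le_sum fun t (ht : t ∈ (Finset.range f).filter fun t =>
      isCoherent p N n b h t = true) =>
        le_coherentCost (n := n) (b := b) (hpos t) (hcoh t (Finset.mem_filter.mp ht).2)
    have a2 := Finset.sum_le_sum fun t (_ : t ∈ (Finset.range f).filter fun t =>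
      ¬ isCoherent p N n b h t = true) =>
        div_abs_sin_le (n := n) (by omega : 0 < N) (hndvd t)
    rw [← Finset.mul_sum] at a0 a1 a2
    have hN0 : (0 : ℝ) < N := by exact_mod_cast (by omega : 0 < N)
    have := Real.pi_pos
    refine lt_of_mul_lt_mul_left ?_ (by positivity : (0 : ℝ) ≤ 10 ^ 6 * (Real.pi / N))
    rw [mul_add]
    linarith

lemma PowerSumGap.mono {p f n n' h : ℕ} {β : ℝ} (hβ : 0 ≤ β) (hn : n ≤ n')
    (hgap : PowerSumGap p f n' β h) : PowerSumGap p f n β h := by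
  obtain ⟨S, h1, h2, h3⟩ := hgap
  refine ⟨S, h1, h2, lt_of_le_of_lt ?_ h3⟩
  have hn' : (n : ℝ) ≤ n' := by exact_mod_cast hn
  gcongr with t ht t ht
  have hlt : ((h * p ^ t : ℕ) : ℝ) < (p ^ f - 1 : ℕ) := by exact_mod_cast h2 t ht
  have hNp : (0 : ℝ) < (p ^ f - 1 : ℕ) := lt_of_le_of_lt (by positivity) hlt
  refine div_nonneg (by positivity) (Real.sin_nonneg_of_nonneg_of_le_pi (by positivity) ?_)
  rw [div_le_iff₀ hNp]; exact mul_le_mul_of_nonneg_left hlt.le Real.pi_pos.le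

/-- The triples `(p, f, n)` for which the estimates do not suffice. -/
def smallExceptions : List (ℕ × ℕ × ℕ) :=
  [(2, 3, 2), (2, 4, 2), (3, 2, 2), (5, 2, 3), (3, 3, 3), (2, 5, 3)]

lemma mem_primes_of_lt {p : ℕ} (hp : p.Prime) (h : p < 64) :
    p ∈ [2, 3, 5, 7, 11, 13, 17, 19, 23, 29, 31, 37, 41, 43, 47, 53, 59, 61] := by
  interval_cases p <;> first | decide | (exfalso; revert hp; norm_num)

/-- `15` times the value of the constant `β` used for the parameters `(p, f, n)`. -/
def coprimeDevConst (p f n : ℕ) : ℕ :=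
  bif p == 2 || (p == 3 && f == 4 && n == 5) then 4 else 5

/-- Whether the estimates have to treat the parameters `(p, f, n)`. -/
def isAdmissible (p f n : ℕ) : Bool :=
  Nat.blt (4 * (n - 1) ^ 2 * p ^ f) ((p ^ f - 1) ^ 2) &&
    !smallExceptions.any (fun a => a.1 == p && a.2.1 == f && a.2.2 == n)

/-- `powerSumGapCheck` for all relevant `h` and sufficiently many `n`. -/
def powerSumGapCheckAll (p f : ℕ) : Bool :=
  (List.range 33).all fun n =>
    Nat.ble n 1 || !isAdmissible p f n || (isAdmissible p f (n + 1) && !(p == 3 && f == 4)) ||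
      (List.range (n + 1)).all fun h =>
        h == 0 || h % p == 0 || powerSumGapCheck p f n (coprimeDevConst p f n) h

lemma powerSumGapCheckAll_eq_true : ([2, 3, 5, 7, 11, 13, 17, 19, 23, 29, 31, 37, 41, 43, 47, 53,
    59, 61].all fun p => (List.range 12).all fun f => Nat.ble f 1 || Nat.ble 4096 (p ^ f) ||
      powerSumGapCheckAll p f) = true := by
  decide +kernel

lemma coprimeDev_le_coprimeDevConst {p f n R o : ℕ} (ho : 2 ≤ o) (hoR : o ∣ R)
    (hodd : (p = 2 ∨ p = 3 ∧ f = 4 ∧ n = 5) → Odd R) :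
    coprimeDev o ≤ (coprimeDevConst p f n / 15 : ℚ) * o.totient := by
  unfold coprimeDevConst
  by_cases hc : p = 2 ∨ p = 3 ∧ f = 4 ∧ n = 5
  · have : (p == 2 || (p == 3 && f == 4 && n == 5)) = true := by simpa [and_assoc] using hc
    rw [this]
    simpa using coprimeDev_le_of_odd ho (Odd.of_dvd_nat (hodd hc) hoR)
  · have : (p == 2 || (p == 3 && f == 4 && n == 5)) = false := by
      rw [Bool.eq_false_iff]; simpa [and_assoc] using hc
    rw [this]
    refine (coprimeDev_le ho).trans (le_of_eq ?_)
    norm_num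

lemma powerSumGap_of_lt {p f : ℕ} (hp : p.Prime) (hf : 2 ≤ f) (hq : p ^ f < 4096) :
    ∀ k n : ℕ, n + k = 33 → 2 ≤ n → isAdmissible p f n = true →
      ∀ h, 1 ≤ h → h ≤ n → ¬ p ∣ h → PowerSumGap p f n (coprimeDevConst p f n / 15) h := by
  have hp64 : p < 64 := by
    by_contra hc
    have : 64 ^ 2 ≤ p ^ f := (Nat.pow_le_pow_left (not_lt.mp hc) 2).trans
      (Nat.pow_le_pow_right hp.pos hf)
    omega
  have hf12 : f < 12 := by
    by_contra hc
    have : 2 ^ 12 ≤ p ^ f := (Nat.pow_le_pow_left hp.two_le 12).trans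
      (Nat.pow_le_pow_right hp.pos (not_lt.mp hc))
    omega
  have hchk := powerSumGapCheckAll_eq_true
  rw [List.all_eq_true] at hchk
  have hchk := hchk p (mem_primes_of_lt hp hp64)
  rw [List.all_eq_true] at hchk
  have hchk := hchk f (List.mem_range.mpr hf12)
  simp only [Bool.or_eq_true, Nat.ble_eq, not_le.mpr hq,
    false_or, show ¬ f ≤ 1 by omega] at hchk
  have hadm : ∀ n, isAdmissible p f n = true → 4 * (n - 1) ^ 2 * p ^ f < (p ^ f - 1) ^ 2 := by
    intro n hn
    simp only [isAdmissible, Bool.and_eq_true, Nat.blt_eq] at hn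
    exact hn.1
  intro k
  induction k with
  | zero =>
    intro n hn _ ha
    have h1 := hadm n ha
    exfalso
    obtain rfl : n = 33 := by omega
    have : (p ^ f - 1) ^ 2 ≤ 4096 * p ^ f := by
      rw [sq]; exact Nat.mul_le_mul (by omega) (by omega)
    norm_num at h1
    omega
  | succ k ih =>
    intro n hn hn2 ha h h1 h2 hph
    by_cases hnext : isAdmissible p f (n + 1) = true ∧ ¬ (p = 3 ∧ f = 4)
    · have h3 := ih (n + 1) (by omega) (by omega) hnext.1 h h1 (by omega) hph
      have e : coprimeDevConst p f (n + 1) = coprimeDevConst p f n := by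
        have hn34 : (p == 3 && f == 4) = false := by
          rw [Bool.eq_false_iff]; simpa using hnext.2
        simp only [coprimeDevConst, hn34, Bool.false_and]
      rw [e] at h3
      exact h3.mono (by positivity) (by omega)
    · rw [powerSumGapCheckAll, List.all_eq_true] at hchk
      have h3 := hchk n (List.mem_range.mpr (by omega))
      have hnext' : (isAdmissible p f (n + 1) && !(p == 3 && f == 4)) = false := by
        rw [Bool.eq_false_iff]; simpa using hnext
      have hn1 : Nat.ble n 1 = false := by rw [Bool.eq_false_iff, ne_eq, Nat.ble_eq]; omega
      rw [ha, hnext', hn1] at h3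
      simp only [Bool.not_true, Bool.or_false, Bool.false_or] at h3
      rw [List.all_eq_true] at h3
      have h4 := h3 h (List.mem_range.mpr (by omega))
      have e1 : (h == 0) = false := by rw [Bool.eq_false_iff]; simp; omega
      have e2 : (h % p == 0) = false := by
        rw [Bool.eq_false_iff]; simpa using fun hc => hph (Nat.dvd_of_mod_eq_zero hc)
      rw [e1, e2] at h4
      simp only [Bool.false_or] at h4
      refine powerSumGap_of_check hp (by omega) h1 ?_ h4
      have h5 := hadm n ha
      have hq4 : 4 ≤ p ^ f := (Nat.pow_le_pow_left hp.two_le 2).trans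
        (Nat.pow_le_pow_right hp.pos hf)
      by_contra hc
      have h6 : (p ^ f - 1) - 1 ≤ n - 1 := by omega
      obtain ⟨a, ha⟩ : ∃ a, p ^ f = a + 4 := ⟨p ^ f - 4, by omega⟩
      have h7 := Nat.mul_le_mul_right (p ^ f) (Nat.mul_le_mul_left 4 (Nat.pow_le_pow_left h6 2))
      rw [ha] at h5 h7
      have h8 := h7.trans_lt h5
      simp only [show a + 4 - 1 = a + 3 by omega,
        show a + 3 - 1 = a + 2 by omega] at h8
      nlinarith

/-- The sum of the lowest `k` digits of `y` in base `p`. -/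
def digitSumTo (p k : ℕ) : ℕ → ℕ :=
  Nat.rec (fun _ => 0) (fun _ ih y => Nat.add (Nat.mod y p) (ih (Nat.div y p))) k

lemma digitSumTo_succ (p k y : ℕ) : digitSumTo p (k + 1) y = y % p + digitSumTo p k (y / p) := rfl

lemma digitSumTo_eq {p : ℕ} (hp : 1 < p) : ∀ {k y : ℕ}, y < p ^ k →
    digitSumTo p k y = (p.digits y).sum
  | 0, y, h => by
    obtain rfl : y = 0 := by simpa using h
    simp [digitSumTo]
  | k + 1, y, h => by
    rw [digitSumTo_succ, sum_digits_eq_mod_add hp, digitSumTo_eq hp]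
    rw [Nat.div_lt_iff_lt_mul (by omega), ← pow_succ]
    exact h

/-- The sum of the base `p` digits of the canonical representative of `z` modulo `p ^ L - 1`. -/
def cyclicDigitSum (p L : ℕ) (z : ZMod (p ^ L - 1)) : ℕ := (p.digits z.val).sum

lemma cyclicDigitSum_natCast (p L m : ℕ) :
    cyclicDigitSum p L (m : ZMod (p ^ L - 1)) = (p.digits (m % (p ^ L - 1))).sum := by
  rw [cyclicDigitSum, ZMod.val_natCast]

lemma natCast_pow_eq_one (p L : ℕ) (hp : 0 < p) : (p : ZMod (p ^ L - 1)) ^ L = 1 := by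
  have h1 : ((p ^ L - 1 : ℕ) : ZMod (p ^ L - 1)) = 0 := ZMod.natCast_self _
  have h2 : 1 ≤ p ^ L := Nat.one_le_pow _ _ hp
  rw [Nat.cast_sub h2, Nat.cast_one, Nat.cast_pow, sub_eq_zero] at h1
  exact h1

lemma cyclicDigitSum_mul {p L : ℕ} (hp : 1 < p) (hL : 0 < L) (z : ZMod (p ^ L - 1)) :
    cyclicDigitSum p L (p * z) = cyclicDigitSum p L z := by
  have hM : 0 < p ^ L - 1 := by have := Nat.one_lt_pow hL.ne' hp; omega
  have : NeZero (p ^ L - 1) := ⟨hM.ne'⟩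
  have hsum : ∀ z : ZMod (p ^ L - 1), (p - 1) * ∑ r ∈ Finset.range L, ((p : ZMod (p ^ L - 1)) ^ r * z).val =
      (p ^ L - 1) * cyclicDigitSum p L z := fun z => by
    rw [cyclicDigitSum, ← sub_one_mul_sum_pow_mul_mod hp (ZMod.val_lt z)]
    congr 1
    refine Finset.sum_congr rfl fun r _ => ?_
    rw [← ZMod.val_natCast]
    push_cast
    rw [ZMod.natCast_zmod_val]
  have h1 := hsum (p * z)
  have h2 : ∑ r ∈ Finset.range L, ((p : ZMod (p ^ L - 1)) ^ r * (p * z)).val =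
      ∑ r ∈ Finset.range L, ((p : ZMod (p ^ L - 1)) ^ r * z).val := by
    have h3 := Finset.sum_range_succ (fun r => ((p : ZMod (p ^ L - 1)) ^ r * z).val) L
    rw [Finset.sum_range_succ', natCast_pow_eq_one p L (by omega), pow_zero] at h3
    simp only [pow_succ, mul_assoc] at h3
    exact Nat.add_right_cancel h3
  rw [h2, hsum z] at h1
  exact (Nat.eq_of_mul_eq_mul_left hM h1).symm

lemma cyclicDigitSum_pow_mul {p L : ℕ} (hp : 1 < p) (hL : 0 < L) (z : ZMod (p ^ L - 1)) (a : ℕ) :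
    cyclicDigitSum p L (p ^ a * z) = cyclicDigitSum p L z := by
  induction a with
  | zero => simp
  | succ a ih => rw [pow_succ', mul_assoc, cyclicDigitSum_mul hp hL, ih]

lemma mod_mul_eq_of_mul_eq {M N R : ℕ} (hRN : R * N = M) (m : ℕ) : ((m % N : ℕ) : ZMod M) * R = m * R := by
  conv_rhs => rw [← Nat.mod_add_div m N]
  have : (R : ZMod M) * N = 0 := by rw [← Nat.cast_mul, hRN, ZMod.natCast_self]
  push_cast
  linear_combination (-((m / N : ℕ) : ZMod M)) * this

lemma exists_eq_add_mul_of_modEq {M N R : ℕ} (hRN : R * N = M) (hN : 0 < N) {x y : ℕ} (h : x ≡ y [MOD R]) :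
    ∃ c < N, (x : ZMod M) = y + (c : ℕ) * R := by
  obtain ⟨k, hk⟩ := (Nat.modEq_iff_dvd.mp h.symm)
  refine ⟨(k % N).toNat, ?_, ?_⟩
  · have h1 := Int.emod_nonneg k (b := N) (by omega)
    have h2 := Int.emod_lt_of_pos k (b := N) (by omega)
    omega
  · have h1 := Int.emod_nonneg k (b := N) (by omega)
    have h2 : (((k % N).toNat : ℤ) : ZMod M) = (k % N : ℤ) := by rw [Int.toNat_of_nonneg h1]
    have h3 : ((x - y : ℤ) : ZMod M) = (R * k : ℤ) := by rw [hk]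
    have h4 : (R : ZMod M) * N = 0 := by rw [← Nat.cast_mul, hRN, ZMod.natCast_self]
    have h5 : (k : ZMod M) = (k % N : ℤ) + N * (k / N : ℤ) := by
      exact_mod_cast congrArg (Int.cast (R := ZMod M)) (Int.emod_add_mul_ediv k N).symm
    rw [Int.cast_natCast] at h2
    rw [h2]
    push_cast at h3
    rw [h5] at h3
    linear_combination h3 + ((k / N : ℤ) : ZMod M) * h4

/-- The sum of the cubes of the digit sums over a coset of the multiples of `R`. -/
def cosetInvariant (p L N R : ℕ) (z : ZMod (p ^ L - 1)) : ℕ :=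
  ∑ b ∈ Finset.range N, cyclicDigitSum p L (z + (b : ℕ) * R) ^ 3

lemma cosetInvariant_eq_sum_zmod {p L N R : ℕ} [NeZero N] (z : ZMod (p ^ L - 1)) :
    cosetInvariant p L N R z =
      ∑ b : ZMod N, cyclicDigitSum p L (z + ((b.val : ℕ) : ZMod (p ^ L - 1)) * R) ^ 3 := by
  unfold cosetInvariant
  refine Finset.sum_nbij' (fun b => (b : ZMod N)) (fun b => b.val) (by simp)
    (fun b _ => Finset.mem_range.mpr (ZMod.val_lt b))
    (fun b hb => ZMod.val_cast_of_lt (Finset.mem_range.mp hb)) (by simp) (fun b hb => ?_)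
  rw [ZMod.val_cast_of_lt (Finset.mem_range.mp hb)]

lemma cosetInvariant_add_mul {p L N R : ℕ} (hRN : R * N = p ^ L - 1) [NeZero N] (z : ZMod (p ^ L - 1)) (c : ℕ) :
    cosetInvariant p L N R (z + (c : ℕ) * R) = cosetInvariant p L N R z := by
  rw [cosetInvariant_eq_sum_zmod, cosetInvariant_eq_sum_zmod,
    ← Equiv.sum_comp (Equiv.addLeft (c : ZMod N)) fun b => cyclicDigitSum p L (z + (b.val : ℕ) * R) ^ 3]
  refine Finset.sum_congr rfl fun b _ => ?_
  have : ((Equiv.addLeft (c : ZMod N) b).val : ZMod (p ^ L - 1)) * R = (c + b.val : ℕ) * R := by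
    have e : Equiv.addLeft (c : ZMod N) b = ((c + b.val : ℕ) : ZMod N) := by simp
    rw [e, ZMod.val_natCast, mod_mul_eq_of_mul_eq hRN]
  rw [this]
  push_cast
  ring_nf

lemma cosetInvariant_mul {p L N R : ℕ} (hRN : R * N = p ^ L - 1) [NeZero N] (hp : 1 < p) (hL : 0 < L) (hpN : p.Coprime N)
    (z : ZMod (p ^ L - 1)) :
    cosetInvariant p L N R (p * z) = cosetInvariant p L N R z := by
  rw [cosetInvariant_eq_sum_zmod, cosetInvariant_eq_sum_zmod,
    ← Equiv.sum_comp (Units.mulLeft (ZMod.unitOfCoprime p hpN)) fun b =>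
      cyclicDigitSum p L (p * z + (b.val : ℕ) * R) ^ 3]
  refine Finset.sum_congr rfl fun b _ => ?_
  have : ((Units.mulLeft (ZMod.unitOfCoprime p hpN) b).val : ZMod (p ^ L - 1)) * R =
      (p * b.val : ℕ) * R := by
    have e : Units.mulLeft (ZMod.unitOfCoprime p hpN) b = ((p * b.val : ℕ) : ZMod N) := by simp
    rw [e, ZMod.val_natCast, mod_mul_eq_of_mul_eq hRN]
  rw [this, ← cyclicDigitSum_mul hp hL (z + _)]
  push_cast
  ring_nf

lemma cosetInvariant_pow_mul {p L N R : ℕ} (hRN : R * N = p ^ L - 1) [NeZero N] (hp : 1 < p) (hL : 0 < L) (hpN : p.Coprime N)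
    (z : ZMod (p ^ L - 1)) (a : ℕ) :
    cosetInvariant p L N R (p ^ a * z) = cosetInvariant p L N R z := by
  induction a with
  | zero => simp
  | succ a ih => rw [pow_succ', mul_assoc, cosetInvariant_mul hRN hp hL hpN, ih]

/-- Every residue modulo `R` is a power of `p` times an entry of the table `T`. -/
def coverCheck (p L R : ℕ) (T : List (ℕ × ℕ)) : Bool :=
  (List.range R).all fun w =>
    (List.range L).any (fun a => Nat.blt (p ^ a * w % R) w) || T.any fun e => e.1 == w

/-- The second entries of the table `T` are the invariants of the first ones. -/
def invariantCheck (p L N R : ℕ) (T : List (ℕ × ℕ)) : Bool :=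
  T.all fun e => ((List.range N).map fun b => digitSumTo p L (e.1 + b * R) ^ 3).sum == e.2

/-- The digit sums over the coset of `w` determine `w` up to the action of `p ^ f`. -/
def separationCheck (p f n R : ℕ) (T : List (ℕ × ℕ)) : Bool :=
  T.all fun e => T.all fun e' => !(e.2 == e'.2) ||
    (List.range f).all fun r => (List.range (p ^ f - 1)).all fun c =>
      (List.range (p ^ f - 1)).any (fun b => !(digitSumTo p (f * n) (e.1 + b * R) ==
        digitSumTo p (f * n) ((p ^ r * e'.1 + (c + b) * R) % (R * (p ^ f - 1))))) ||
      (List.range n).any fun j =>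
        (p ^ r * e'.1 + c * R) % (R * (p ^ f - 1)) == p ^ (f * j) * e.1 % (R * (p ^ f - 1))

lemma exists_modEq_of_coverCheck {p L R : ℕ} {T : List (ℕ × ℕ)} (hL : 0 < L)
    (hpR : p ^ L ≡ 1 [MOD R]) (hT : coverCheck p L R T = true) :
    ∀ w < R, ∃ e ∈ T, ∃ a, w ≡ p ^ a * e.1 [MOD R] := by
  intro w
  induction w using Nat.strong_induction_on with
  | _ w ih =>
    intro hw
    rw [coverCheck, List.all_eq_true] at hT
    have h1 := hT w (List.mem_range.mpr hw)
    rw [Bool.or_eq_true, List.any_eq_true, List.any_eq_true] at h1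
    rcases h1 with ⟨a, -, ha⟩ | ⟨e, he, hew⟩
    · rw [Nat.blt_eq] at ha
      obtain ⟨e, he, a', h2⟩ := ih _ ha (ha.trans hw)
      refine ⟨e, he, (L - 1) * a + a', ?_⟩
      have h3 := ((Nat.mod_modEq (p ^ a * w) R).symm.trans h2).mul_left (p ^ ((L - 1) * a))
      rw [← mul_assoc, ← mul_assoc, ← pow_add, ← pow_add] at h3
      refine Nat.ModEq.trans ?_ h3
      have h4 : (L - 1) * a + a = L * a := by
        obtain ⟨k, rfl⟩ : ∃ k, L = k + 1 := ⟨L - 1, by omega⟩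
        simp; ring
      rw [h4, pow_mul]
      simpa using ((hpR.pow a).mul_right w).symm
    · rw [beq_iff_eq] at hew
      exact ⟨e, he, 0, by rw [hew]; simp [Nat.ModEq.refl]⟩

lemma exists_eq_of_separationCheck {p f n R : ℕ} {T : List (ℕ × ℕ)} (hp : 1 < p)
    (hR : R * (p ^ f - 1) = p ^ (f * n) - 1) (hTR : ∀ e ∈ T, e.1 < R)
    (hI : invariantCheck p (f * n) (p ^ f - 1) R T = true) (hS : separationCheck p f n R T = true)
    (hf : 0 < f) (hn : 1 ≤ n) {e e' : ℕ × ℕ} (he : e ∈ T) (he' : e' ∈ T) {r c : ℕ} (hr : r < f)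
    (hc : c < p ^ f - 1)
    (h : ∀ b : ℕ, cyclicDigitSum p (f * n) (e.1 + (b : ℕ) * R) =
      cyclicDigitSum p (f * n) (p ^ r * e'.1 + (c : ℕ) * R + (b : ℕ) * R)) :
    ∃ j : ℕ, (p ^ r * e'.1 + (c : ℕ) * R : ZMod (p ^ (f * n) - 1)) = (p ^ f) ^ j * e.1 := by
  have hL : 0 < f * n := by positivity
  have hN : 0 < p ^ f - 1 := by have := Nat.one_lt_pow hf.ne' hp; omega
  have hM : 0 < p ^ (f * n) - 1 := by have := Nat.one_lt_pow hL.ne' hp; omega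
  have : NeZero (p ^ f - 1) := ⟨hN.ne'⟩
  have hpN : p.Coprime (p ^ f - 1) := by
    have h1 : Nat.Coprime (p ^ f - 1) (p ^ f) :=
      (Nat.coprime_self_sub_left (m := 1) (n := p ^ f) (by omega)).mpr (Nat.coprime_one_left _)
    exact (h1.coprime_dvd_right (dvd_pow_self p hf.ne')).symm
  have hlt : ∀ e ∈ T, ∀ b < p ^ f - 1, e.1 + b * R < p ^ (f * n) - 1 := fun e he b hb => by
    have h1 := hTR e he
    have h2 : (b + 1) * R ≤ (p ^ f - 1) * R := Nat.mul_le_mul_right _ hb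
    rw [mul_comm (p ^ f - 1) R, hR] at h2
    linarith
  have hsum : ∀ e ∈ T, ∀ b < p ^ f - 1, cyclicDigitSum p (f * n) (e.1 + (b : ℕ) * R) =
      digitSumTo p (f * n) (e.1 + b * R) := fun e he b hb => by
    have h1 := hlt e he b hb
    rw [digitSumTo_eq hp (by omega), ← Nat.mod_eq_of_lt h1, ← cyclicDigitSum_natCast]
    push_cast [Nat.mod_eq_of_lt h1]
    rfl
  have hinv : ∀ e ∈ T, cosetInvariant p (f * n) (p ^ f - 1) R e.1 = e.2 := fun e he => by
    rw [invariantCheck, List.all_eq_true] at hI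
    have h1 := hI e he
    rw [beq_iff_eq] at h1
    rw [← h1, cosetInvariant, ← List.sum_toFinset _ List.nodup_range, List.toFinset_range]
    exact Finset.sum_congr rfl fun b hb => by rw [hsum e he b (Finset.mem_range.mp hb)]
  have hee : e.2 = e'.2 := by
    rw [← hinv e he, ← hinv e' he', ← cosetInvariant_pow_mul hR hp hL hpN (e'.1 : ZMod _) r,
      ← cosetInvariant_add_mul hR ((p : ZMod (p ^ (f * n) - 1)) ^ r * e'.1) c]
    exact Finset.sum_congr rfl fun b _ => by rw [h b]
  rw [separationCheck, List.all_eq_true] at hS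
  have h1 := hS e he
  rw [List.all_eq_true] at h1
  have h2 := h1 e' he'
  rw [hee, beq_self_eq_true, Bool.not_true, Bool.false_or, List.all_eq_true] at h2
  have h3 := h2 r (List.mem_range.mpr hr)
  rw [List.all_eq_true] at h3
  have h4 := h3 c (List.mem_range.mpr hc)
  rw [Bool.or_eq_true, List.any_eq_true, List.any_eq_true] at h4
  rcases h4 with ⟨b, hb, hne⟩ | ⟨j, -, hj⟩
  · exfalso
    have hb' := List.mem_range.mp hb
    rw [Bool.not_eq_true', beq_eq_false_iff_ne] at hne
    apply hne
    rw [← hsum e he b hb', h b, hR, digitSumTo_eq hp, ← cyclicDigitSum_natCast]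
    · push_cast; ring_nf
    · exact (Nat.mod_lt _ hM).trans (by omega)
  · rw [beq_iff_eq, hR] at hj
    have h5 := (ZMod.natCast_eq_natCast_iff _ _ _).mpr hj
    push_cast at h5
    exact ⟨j, h5.trans (congrArg (· * _) (pow_mul _ f j))⟩

theorem exists_modEq_of_check {p f n R x x' : ℕ} {T : List (ℕ × ℕ)} (hp : 1 < p) (hf : 0 < f)
    (hn : 1 ≤ n) (hR : R * (p ^ f - 1) = (p ^ f) ^ n - 1) (hTR : ∀ e ∈ T, e.1 < R)
    (hC : coverCheck p (f * n) R T = true)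
    (hI : invariantCheck p (f * n) (p ^ f - 1) R T = true) (hS : separationCheck p f n R T = true)
    (hs : ∀ b : ℕ, (p.digits ((x + b * R) % ((p ^ f) ^ n - 1))).sum =
      (p.digits ((x' + b * R) % ((p ^ f) ^ n - 1))).sum) :
    ∃ j : ℕ, x ≡ (p ^ f) ^ j * x' [MOD (p ^ f) ^ n - 1] := by
  rw [← pow_mul] at *
  have hL : 0 < f * n := by positivity
  have hN : 0 < p ^ f - 1 := by have := Nat.one_lt_pow hf.ne' hp; omega
  have hM : 0 < p ^ (f * n) - 1 := by have := Nat.one_lt_pow hL.ne' hp; omega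
  have hRpos : 0 < R := Nat.pos_of_ne_zero fun h => by rw [h, zero_mul] at hR; omega
  have hpR : p ^ (f * n) ≡ 1 [MOD R] :=
    ((Nat.modEq_iff_dvd' (by omega)).mpr ⟨_, hR.symm⟩).symm
  set L := f * n with hLdef
  set M := p ^ L - 1 with hMdef
  have hs' : ∀ b : ℕ, cyclicDigitSum p L (x + (b : ℕ) * R) =
      cyclicDigitSum p L (x' + (b : ℕ) * R) := fun b => by
    have := hs b
    rw [← cyclicDigitSum_natCast, ← cyclicDigitSum_natCast] at this
    exact_mod_cast this
  have hP : (p : ZMod M) ^ L = 1 := natCast_pow_eq_one p L (by omega)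
  have hqn : ((p : ZMod M) ^ f) ^ n = 1 := by rw [← pow_mul, hP]
  have hqR : ((p : ZMod M) ^ f) * R = R := by
    have h1 : ((R * (p ^ f - 1) : ℕ) : ZMod M) = 0 := by rw [hR, ZMod.natCast_self]
    have h2 : 1 ≤ p ^ f := by omega
    rw [Nat.cast_mul, Nat.cast_sub h2] at h1
    push_cast at h1
    linear_combination h1
  have hNR : ((p ^ f - 1 : ℕ) : ZMod M) * R = 0 := by
    rw [← Nat.cast_mul, mul_comm, hR, ZMod.natCast_self]
  have hqkR : ∀ k : ℕ, ((p : ZMod M) ^ f) ^ k * R = R := fun k => by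
    induction k with
    | zero => simp
    | succ k ih => rw [pow_succ, mul_assoc, hqR, ih]
  have hcover : ∀ y : ℕ, ∃ e ∈ T, ∃ a, y ≡ p ^ a * e.1 [MOD R] := fun y => by
    obtain ⟨e, he, a, ha⟩ := exists_modEq_of_coverCheck hL hpR hC (y % R) (Nat.mod_lt _ hRpos)
    exact ⟨e, he, a, (Nat.mod_modEq y R).symm.trans ha⟩
  obtain ⟨e, he, a, ha⟩ := hcover x
  obtain ⟨c₀, -, hc₀⟩ := exists_eq_add_mul_of_modEq hR hN ha
  have hinv : (p : ZMod M) ^ ((L - 1) * a) * p ^ a = 1 := by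
    rw [← pow_add, show (L - 1) * a + a = L * a by
      obtain ⟨k, hk⟩ : ∃ k, L = k + 1 := ⟨L - 1, by omega⟩
      rw [hk]; simp; ring, pow_mul, hP, one_pow]
  set i := (L - 1) * a with hi
  obtain ⟨e', he', a', ha'⟩ := hcover (p ^ i * x')
  obtain ⟨c₁, -, hc₁⟩ := exists_eq_add_mul_of_modEq hR hN ha'
  set r := a' % f with hr
  set s := a' / f with hs0
  have hpa' : (p : ZMod M) ^ a' = p ^ r * (p ^ f) ^ s := by
    rw [← pow_mul, ← pow_add, hr, hs0, Nat.mod_add_div]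
  have hqs : ((p : ZMod M) ^ f) ^ ((n - 1) * s) * (p ^ f) ^ s = 1 := by
    rw [← pow_add, show (n - 1) * s + s = n * s by
      obtain ⟨k, hk⟩ : ∃ k, n = k + 1 := ⟨n - 1, by omega⟩
      rw [hk]; simp; ring, pow_mul, hqn, one_pow]
  set k := (n - 1) * s with hk
  push_cast at hc₀ hc₁
  have hX : (p : ZMod M) ^ i * x = e.1 + p ^ i * c₀ * R := by
    rw [hc₀]; linear_combination (e.1 : ZMod M) * hinv
  have hY : ((p : ZMod M) ^ f) ^ k * (p ^ i * x') = p ^ r * e'.1 + c₁ * R := by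
    rw [hc₁, hpa']
    linear_combination ((p : ZMod M) ^ r * e'.1) * hqs + (c₁ : ZMod M) * hqkR k
  have hXY : ∀ b : ℕ, cyclicDigitSum p L (p ^ i * x + (b : ℕ) * R) =
      cyclicDigitSum p L ((p ^ f) ^ k * (p ^ i * x') + (b : ℕ) * R) := fun b => by
    have e1 : (p : ZMod M) ^ i * x + b * R = p ^ i * (x + (p ^ a * b : ℕ) * R) := by
      push_cast; linear_combination (-(b : ZMod M) * R) * hinv
    have e2 : ((p : ZMod M) ^ f) ^ k * (p ^ i * x') + (b : ℕ) * R =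
        p ^ (f * k + i) * (x' + (p ^ a * b : ℕ) * R) := by
      rw [pow_add, pow_mul]
      push_cast
      linear_combination (-(b : ZMod M) * R * ((p : ZMod M) ^ f) ^ k) * hinv - (b : ZMod M) * hqkR k
    rw [e1, e2, cyclicDigitSum_pow_mul hp hL, cyclicDigitSum_pow_mul hp hL, hs']
  set N := p ^ f - 1 with hNdef
  set c₂ := p ^ i * c₀ with hc₂
  have hc₂' : (c₂ : ZMod M) = p ^ i * c₀ := by rw [hc₂]; push_cast; rfl
  have hcancel : ((c₂ + (N - 1) * c₂ : ℕ) : ZMod M) * R = 0 := by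
    have : c₂ + (N - 1) * c₂ = c₂ * N := by
      obtain ⟨m, hm⟩ : ∃ m, N = m + 1 := ⟨N - 1, by omega⟩
      rw [hm]; simp; ring
    rw [this]; push_cast; linear_combination (c₂ : ZMod M) * hNR
  obtain ⟨j, hj⟩ := exists_eq_of_separationCheck hp hR hTR hI hS hf hn he he'
    (r := r) (c := (c₁ + (N - 1) * c₂) % N) (Nat.mod_lt _ hf) (Nat.mod_lt _ hN) (fun b => by
      have h1 := hXY (b + (N - 1) * c₂)
      rw [hX, hY] at h1
      rw [mod_mul_eq_of_mul_eq hR]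
      push_cast at h1 hcancel ⊢
      convert h1 using 2
      · linear_combination -hcancel + (R : ZMod M) * hc₂'
      · ring)
  rw [mod_mul_eq_of_mul_eq hR] at hj
  have hfinal : ((p : ZMod M) ^ f) ^ k * (p ^ i * x') = (p ^ f) ^ j * (p ^ i * x) := by
    rw [hX, hY]
    push_cast at hj hcancel
    linear_combination hj - hcancel - ((p : ZMod M) ^ i * c₀) * hqkR j + (R : ZMod M) * hc₂'
  have hfinal2 : ((p : ZMod M) ^ f) ^ k * x' = (p ^ f) ^ j * x := by
    linear_combination (p : ZMod M) ^ a * hfinal - (((p : ZMod M) ^ f) ^ k * x' - (p ^ f) ^ j * x) * hinv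
  have hqj : ((p : ZMod M) ^ f) ^ ((n - 1) * j) * (p ^ f) ^ j = 1 := by
    rw [← pow_add, show (n - 1) * j + j = n * j by
      obtain ⟨m, hm⟩ : ∃ m, n = m + 1 := ⟨n - 1, by omega⟩
      rw [hm]; simp; ring, pow_mul, hqn, one_pow]
  refine ⟨(n - 1) * j + k, ?_⟩
  rw [← ZMod.natCast_eq_natCast_iff]
  push_cast
  rw [pow_add]
  linear_combination (-(x : ZMod M)) * hqj - ((p : ZMod M) ^ f) ^ ((n - 1) * j) * hfinal2

/-- The finite check that settles the case of `p`, `f`, `n` with the table `T`. -/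
def tableCheck (p f n R : ℕ) (T : List (ℕ × ℕ)) : Bool :=
  (T.all fun e => Nat.blt e.1 R) && Nat.beq (R * (p ^ f - 1)) ((p ^ f) ^ n - 1) &&
    coverCheck p (f * n) R T && invariantCheck p (f * n) (p ^ f - 1) R T &&
    separationCheck p f n R T

lemma exists_modEq_of_tableCheck {p f n R x x' : ℕ} {T : List (ℕ × ℕ)} {R₀ : ℕ} (hp : 1 < p)
    (hf : 0 < f) (hn : 1 ≤ n) (hR : R * (p ^ f - 1) = (p ^ f) ^ n - 1)
    (hT : tableCheck p f n R₀ T = true)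
    (hs : ∀ b : ℕ, (p.digits ((x + b * R) % ((p ^ f) ^ n - 1))).sum =
      (p.digits ((x' + b * R) % ((p ^ f) ^ n - 1))).sum) :
    ∃ j : ℕ, x ≡ (p ^ f) ^ j * x' [MOD (p ^ f) ^ n - 1] := by
  simp only [tableCheck, Bool.and_eq_true] at hT
  obtain ⟨⟨⟨⟨h1, h2⟩, h3⟩, h4⟩, h5⟩ := hT
  have hN : 0 < p ^ f - 1 := by have := Nat.one_lt_pow hf.ne' hp; omega
  obtain rfl : R = R₀ := Nat.eq_of_mul_eq_mul_right hN (hR.trans (Nat.eq_of_beq_eq_true h2).symm)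
  rw [List.all_eq_true] at h1
  exact exists_modEq_of_check hp hf hn hR (fun e he => by simpa using h1 e he) h3 h4 h5 hs

/-- Representatives of the orbits of multiplication by `7` on the residues modulo `8`. -/
def orbitTable7Pow2 : List (ℕ × ℕ) :=
  [(0, 1800), (1, 2556), (2, 2016), (3, 1692), (4, 1584)]

lemma tableCheck_7_1_2 : tableCheck 7 1 2 8 orbitTable7Pow2 = true := by decide +kernel

/-- Representatives of the orbits of multiplication by `2` on the residues modulo `9`. -/
def orbitTable8Pow2 : List (ℕ × ℕ) :=
  [(0, 216), (1, 279), (3, 243)]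

lemma tableCheck_2_3_2 : tableCheck 2 3 2 9 orbitTable8Pow2 = true := by decide +kernel

/-- Representatives of the orbits of multiplication by `2` on the residues modulo `17`. -/
def orbitTable16Pow2 : List (ℕ × ℕ) :=
  [(0, 1280), (1, 1368), (3, 1224)]

lemma tableCheck_2_4_2 : tableCheck 2 4 2 17 orbitTable16Pow2 = true := by decide +kernel

/-- Representatives of the orbits of multiplication by `3` on the residues modulo `10`. -/
def orbitTable9Pow2 : List (ℕ × ℕ) :=
  [(0, 640), (1, 800), (2, 704), (5, 608)]

lemma tableCheck_3_2_2 : tableCheck 3 2 2 10 orbitTable9Pow2 = true := by decide +kernel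

/-- Representatives of the orbits of multiplication by `5` on the residues modulo `651`. -/
def orbitTable25Pow3 : List (ℕ × ℕ) :=
  [(0, 61776), (1, 62264), (2, 57008), (3, 55448), (4, 57296), (6, 55952), (7, 50996),
   (8, 49712), (9, 51812), (11, 53432), (12, 48752), (13, 47720), (14, 50048), (16, 54416),
   (17, 49988), (18, 49184), (19, 51716), (21, 58616), (22, 54416), (23, 53816), (24, 56528),
   (26, 67048), (28, 52880), (29, 52784), (31, 56592), (32, 50672), (33, 47348), (34, 47552),
   (36, 52140), (37, 48560), (38, 45536), (39, 46016), (41, 51360), (42, 49904), (43, 47156),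
   (44, 47888), (46, 53964), (48, 51920), (51, 60112), (52, 61936), (56, 52140), (57, 52404),
   (58, 48464), (59, 46916), (61, 48036), (62, 48528), (63, 46808), (64, 45584), (66, 47580),
   (67, 48276), (69, 47636), (71, 50484), (72, 51360), (76, 57064), (77, 56848), (78, 60040),
   (82, 49680), (83, 51456), (84, 49616), (86, 47580), (87, 46176), (88, 48204), (91, 47424),
   (92, 46272), (93, 48528), (96, 50604), (101, 57616), (102, 55504), (103, 56944), (104, 61648),
   (109, 54036), (111, 50484), (112, 47328), (113, 47748), (114, 51456), (116, 50604),
   (117, 47748), (118, 48444), (119, 52404), (126, 61480), (127, 57616), (128, 57448),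
   (129, 60688), (163, 44084), (166, 49680), (168, 43856), (176, 55132), (177, 56188),
   (181, 54448), (182, 55852), (191, 46176), (192, 46272), (201, 52480), (202, 51472),
   (203, 53920), (206, 52048), (207, 51436), (208, 54256), (217, 44496), (226, 53404),
   (227, 50476), (228, 51148), (231, 53200), (232, 50716), (233, 51808), (252, 52912),
   (253, 51952), (258, 52912), (326, 51640), (327, 49888), (331, 49168), (332, 47788),
   (336, 50248), (337, 49216), (357, 47440)]

lemma tableCheck_5_2_3 : tableCheck 5 2 3 651 orbitTable25Pow3 = true := by decide +kernel

/-- Representatives of the orbits of multiplication by `3` on the residues modulo `757`. -/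
def orbitTable27Pow3 : List (ℕ × ℕ) :=
  [(0, 26973), (1, 26607), (2, 25221), (4, 23709), (5, 23121), (7, 23751), (8, 23877),
   (10, 24261), (11, 22587), (13, 22161), (14, 21285), (16, 22917), (17, 22755), (19, 24807),
   (20, 22869), (22, 23421), (23, 22281), (26, 24381), (28, 28635), (31, 23789), (32, 21933),
   (34, 22967), (35, 22365), (37, 24325), (38, 22485), (40, 21503), (41, 20835), (43, 21491),
   (44, 21981), (46, 23665), (49, 22109), (52, 22823), (55, 25893), (56, 27213), (59, 23153),
   (61, 21809), (62, 22853), (64, 22969), (65, 23635), (67, 21323), (68, 21437), (70, 21119),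
   (71, 21947), (73, 23107), (74, 23533), (76, 22631), (77, 22553), (82, 26115), (83, 26013),
   (95, 20571), (97, 21243), (101, 21413), (109, 25533), (110, 23347), (112, 25701),
   (118, 22495), (119, 21107), (121, 22075), (124, 20765), (127, 21595), (130, 21925),
   (136, 23673), (137, 24279), (139, 23589), (140, 24993), (146, 21949), (148, 21301),
   (149, 22087), (154, 21823), (155, 21607), (163, 24693), (164, 23901), (166, 24381),
   (167, 24447), (190, 25443), (191, 22549), (193, 24021), (194, 22417), (218, 24333),
   (220, 22767), (221, 23541), (248, 23793), (379, 22941), (382, 22143), (388, 22311)]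

lemma tableCheck_3_3_3 : tableCheck 3 3 3 757 orbitTable27Pow3 = true := by decide +kernel

/-- Representatives of the orbits of multiplication by `2` on the residues modulo `1057`. -/
def orbitTable32Pow3 : List (ℕ × ℕ) :=
  [(0, 18225), (1, 17654), (3, 16382), (5, 15890), (7, 15962), (9, 15968), (11, 15200),
   (13, 15560), (15, 16064), (17, 16640), (19, 15254), (21, 15356), (23, 15302), (25, 16274),
   (27, 15380), (33, 18841), (35, 16023), (37, 15898), (39, 15177), (41, 16097), (43, 14721),
   (45, 15136), (47, 15201), (49, 16602), (51, 15069), (53, 14926), (55, 14745), (57, 15659),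
   (59, 15093), (61, 15484), (65, 17515), (71, 14936), (73, 15100), (75, 14744), (77, 14451),
   (81, 15611), (85, 14529), (89, 14974), (97, 16921), (99, 17503), (103, 15436), (105, 15077),
   (107, 15329), (109, 14638), (113, 15552), (115, 15828), (119, 14938), (121, 15131),
   (123, 15365), (129, 16981), (131, 17017), (151, 14540), (161, 16933), (163, 15804),
   (165, 17005), (171, 14242), (173, 15089), (177, 15270), (179, 14423), (181, 15294),
   (185, 14837), (193, 16165), (195, 15576), (197, 16201), (225, 16435), (227, 16153),
   (229, 15889), (243, 15036), (245, 15024), (259, 16189), (353, 16165), (361, 15631),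
   (453, 15385)]

lemma tableCheck_2_5_3 : tableCheck 2 5 3 1057 orbitTable32Pow3 = true := by decide +kernel

lemma eq_zero_of_sum_digits_eq_zero {p : ℕ} (hp : 1 < p) (a : ℕ) (h : (p.digits a).sum = 0) : a = 0 := by
  induction a using Nat.strong_induction_on with
  | _ a ih =>
    by_contra h0
    rw [sum_digits_eq_mod_add hp] at h
    have h1 := ih (a / p) (Nat.div_lt_self (Nat.pos_of_ne_zero h0) hp) (by omega)
    have h2 := Nat.mod_add_div a p
    rw [h1, mul_zero] at h2
    omega

lemma modEq_of_dvd_of_sum_digits_eq {p f n R x x' : ℕ} (hp : 1 < p) (hf : 0 < f)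
    (hR : R * (p ^ f - 1) = (p ^ f) ^ n - 1) (hx : R ∣ x)
    (hs : ∀ b : ℕ, (p.digits ((x + b * R) % ((p ^ f) ^ n - 1))).sum =
      (p.digits ((x' + b * R) % ((p ^ f) ^ n - 1))).sum) :
    x ≡ x' [MOD (p ^ f) ^ n - 1] := by
  obtain ⟨y, rfl⟩ := hx
  obtain ⟨N, hN⟩ : ∃ N, p ^ f - 1 = N + 1 :=
    ⟨p ^ f - 2, by have := Nat.one_lt_pow hf.ne' hp; omega⟩
  have h1 : (R * y + N * y * R) % ((p ^ f) ^ n - 1) = 0 := by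
    rw [← hR, hN]
    exact Nat.mod_eq_zero_of_dvd ⟨y, by ring⟩
  have h2 := hs (N * y)
  rw [h1, Nat.digits_zero, List.sum_nil] at h2
  exact Nat.ModEq.add_right_cancel' (N * y * R)
    (h1.trans (eq_zero_of_sum_digits_eq_zero hp _ h2.symm).symm)

lemma four_mul_sq_mul_lt {q n : ℕ} (hq : 0 < q) (hn : 1 ≤ n)
    (h : (n : ℝ) < ((q : ℝ) - 1) / (2 * Real.sqrt q) + 1) : 4 * (n - 1) ^ 2 * q < (q - 1) ^ 2 := by
  obtain ⟨k, rfl⟩ : ∃ k, n = k + 1 := ⟨n - 1, by omega⟩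
  obtain ⟨r, rfl⟩ : ∃ r, q = r + 1 := ⟨q - 1, by omega⟩
  have hs : 0 < Real.sqrt ((r + 1 : ℕ) : ℝ) := Real.sqrt_pos.mpr (by positivity)
  have hsq := Real.sq_sqrt (show (0 : ℝ) ≤ ((r + 1 : ℕ) : ℝ) by positivity)
  set s := Real.sqrt ((r + 1 : ℕ) : ℝ)
  push_cast at h hsq
  have h1 : (k : ℝ) < r / (2 * s) := by simpa using h
  rw [lt_div_iff₀ (by positivity)] at h1
  have h2 : ((k : ℝ) * (2 * s)) ^ 2 < r ^ 2 := pow_lt_pow_left₀ h1 (by positivity) (by norm_num)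
  rw [mul_pow, mul_pow, hsq] at h2
  simp only [Nat.add_sub_cancel]
  have h3 : (4 * (k : ℝ) ^ 2 * (r + 1)) < r ^ 2 := by linarith
  exact_mod_cast h3

lemma powerSumGap_one {p n h : ℕ} (hn : 21 * n < 5 * (p - 1)) (hh : 1 ≤ h) (hhn : h ≤ n) :
    PowerSumGap p 1 n (1 / 3) h := by
  refine ⟨Finset.range 1, subset_rfl, by simp; omega, ?_⟩
  have hN : (0 : ℝ) < (p - 1 : ℕ) := by exact_mod_cast (by omega : 0 < p - 1)
  have hn' : (21 * n : ℝ) < 5 * (p - 1 : ℕ) := by exact_mod_cast hn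
  have hlt : (h : ℝ) < (p - 1 : ℕ) := by exact_mod_cast (by omega : h < p - 1)
  have hh' : (0 : ℝ) < h := by exact_mod_cast hh
  simp only [Finset.sdiff_self, Finset.sum_empty, add_zero, Finset.sum_range_one, pow_zero, mul_one, pow_one]
  have hsin : 0 < Real.sin (Real.pi * h / (p - 1 : ℕ)) := by
    refine Real.sin_pos_of_pos_of_lt_pi (by positivity) ?_
    rw [div_lt_iff₀ hN]
    exact mul_lt_mul_of_pos_left hlt Real.pi_pos
  have h1 : Real.pi * h / (p - 1 : ℕ) * (2 * (n * (1 / 3))) < h * (1 / 2) := by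
    rw [div_mul_eq_mul_div, div_lt_iff₀ hN]
    have := Real.pi_lt_d2
    have h2 : Real.pi * n * 4 < 3 * (p - 1 : ℕ) := by nlinarith [Real.pi_pos]
    nlinarith
  rw [div_mul_eq_mul_div, div_lt_iff₀ hsin]
  have h3 : (h : ℝ) * (1 / (2 * Real.sin (Real.pi * h / (p - 1 : ℕ)))) * Real.sin (Real.pi * h / (p - 1 : ℕ)) =
      h * (1 / 2) := by
    generalize Real.sin (Real.pi * h / (p - 1 : ℕ)) = s at hsin ⊢
    field_simp
  rw [h3]
  exact h1

lemma mul_lt_of_four_mul_sq_mul_lt {q n : ℕ} (hq : 11 ≤ q) (hq' : q ≠ 12) (hn : 1 ≤ n)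
    (h : 4 * (n - 1) ^ 2 * q < (q - 1) ^ 2) : 21 * n < 5 * (q - 1) := by
  obtain ⟨k, rfl⟩ : ∃ k, n = k + 1 := ⟨n - 1, by omega⟩
  obtain rfl | hq1 : q = 11 ∨ 13 ≤ q := by omega
  · norm_num at h ⊢
    have : k < 2 := by nlinarith
    omega
  · obtain ⟨r, rfl⟩ : ∃ r, q = r + 13 := ⟨q - 13, by omega⟩
    simp only [Nat.add_sub_cancel] at h
    rw [show r + 13 - 1 = r + 12 by omega] at h ⊢
    by_contra! hc
    have h1 : 5 * r + 39 ≤ 21 * k := by omega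
    nlinarith [Nat.mul_le_mul h1 h1, Nat.mul_le_mul (Nat.mul_le_mul h1 h1) (Nat.le_refl r)]

lemma seven_mul_add_le {m : ℕ} {s : ℝ} (hs : 64 ≤ s) (hm : (2 : ℝ) ^ m ≤ s) :
    Real.pi * (7 * m / 6 + 529 / 300) ≤ 4305 / 10000 * s := by
  have hpi := Real.pi_lt_d4
  have h1 : (7 * m / 6 + 529 / 300 : ℝ) ≤ 137 / 1000 * s := by
    rcases le_total m 6 with h | h
    · have : (m : ℝ) ≤ 6 := by exact_mod_cast h
      linarith
    · obtain ⟨k, rfl⟩ := Nat.exists_eq_add_of_le h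
      have h2 : ((k + 1 : ℕ) : ℝ) ≤ (2 ^ k : ℕ) := by exact_mod_cast Nat.lt_two_pow_self
      rw [pow_add] at hm
      push_cast at h2 ⊢
      linarith
  have h3 : (0 : ℝ) ≤ 7 * m / 6 + 529 / 300 := by positivity
  nlinarith

lemma gap_inequality {s σ n B a' K N : ℝ} (hs : 64 ≤ s) (hσ : 2 ≤ σ ^ 2) (hσ0 : 0 < σ)
    (hN : N = s ^ 2 - 1) (hn : n ≤ s / 2 + 1) (hB0 : 0 ≤ B) (hB : B ≤ σ * s)
    (ha : a' ≤ σ / s) (hK0 : 0 ≤ K) (hK : K ≤ 4305 / 10000 * s) :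
    (σ ^ 2 - 1) * (n * K) + n * B * (N / (N - n)) < N / 2 * (σ ^ 2 - a') := by
  have hn1 : n ≤ 33 / 64 * s := by linarith
  have hss : 64 * s ≤ s ^ 2 := by nlinarith
  have hNs : 4095 / 4096 * s ^ 2 ≤ N := by nlinarith
  have hNn : 0 < N - n := by nlinarith
  have h1 : N / (N - n) ≤ 10082 / 10000 := by
    rw [div_le_iff₀ hNn]; nlinarith
  have h2 : n * K ≤ 22199 / 100000 * s ^ 2 := by
    have := mul_le_mul hn1 hK hK0 (by positivity)
    nlinarith
  have h3 : n * B ≤ 33 / 64 * (σ * s ^ 2) := by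
    have := mul_le_mul hn1 hB hB0 (by positivity)
    nlinarith
  have h4 : n * B * (N / (N - n)) ≤ 33 / 64 * (σ * s ^ 2) * (10082 / 10000) :=
    mul_le_mul h3 h1 (by have : 0 < N := by linarith
                         positivity) (by positivity)
  have h5 : (σ ^ 2 - 1) * (n * K) ≤ (σ ^ 2 - 1) * (22199 / 100000 * s ^ 2) :=
    mul_le_mul_of_nonneg_left h2 (by linarith)
  have h6 : N / 2 * a' ≤ σ / 128 * s ^ 2 := by
    have e1 : N / 2 * a' ≤ N / 2 * (σ / s) :=
      mul_le_mul_of_nonneg_left ha (by nlinarith)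
    have e2 : N / 2 * (σ / s) ≤ s ^ 2 / 2 * (σ / s) :=
      mul_le_mul_of_nonneg_right (by linarith) (by positivity)
    have e3 : s ^ 2 / 2 * (σ / s) = σ / 2 * s := by field_simp
    nlinarith
  have h7 : 4095 / 8192 * σ ^ 2 * s ^ 2 ≤ N / 2 * σ ^ 2 := by nlinarith [sq_nonneg σ]
  have hσ1 : 1414 / 1000 ≤ σ := by nlinarith
  have h8 : 0 < (4095 / 8192 * σ ^ 2 - σ / 128 - (σ ^ 2 - 1) * (22199 / 100000) -
      33 / 64 * σ * (10082 / 10000)) * s ^ 2 := mul_pos (by nlinarith) (by positivity)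
  nlinarith

lemma sub_le_pow_mul_distMultiple {p f h t : ℕ} (hp : 1 < p) (hh : 0 < h) (hhN : h < p ^ f - 1) (ht : t < f)
    (hph : ¬ p ∣ h) :
    p ^ f - 1 - h ≤ p ^ (f - t) * distMultiple (p ^ f - 1) (h * p ^ t) := by
  have hpf : p ^ (f - t) * p ^ t = p ^ f := by rw [← pow_add, Nat.sub_add_cancel ht.le]
  obtain ⟨N, hN⟩ : ∃ N, p ^ f = N + 1 := ⟨p ^ f - 1, by omega⟩
  have hdvd : p ∣ p ^ (f - t) := dvd_pow_self p (by omega)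
  rw [hN, Nat.add_sub_cancel] at hhN ⊢
  rw [hN] at hpf
  set r := h * p ^ t % N with hr
  set u := h * p ^ t / N with hu
  set P := p ^ (f - t) with hP
  have hru : r + N * u = h * p ^ t := Nat.mod_add_div _ _
  have hrN : r < N := Nat.mod_lt _ (by omega)
  have key : P * r + N * (u * P) = N * h + h := by
    calc P * r + N * (u * P) = (r + N * u) * P := by ring
      _ = h * (P * p ^ t) := by rw [hru]; ring
      _ = N * h + h := by rw [hpf]; ring
  have hne : u * P ≠ h := fun e => hph (e ▸ hdvd.mul_left u)
  have hdist : distMultiple N (h * p ^ t) = min r (N - r) := rfl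
  rw [hdist, ← Nat.mul_min_mul_left]
  refine le_min ?_ ?_
  · rcases Nat.lt_or_gt_of_ne hne with h1 | h1
    · have := Nat.mul_le_mul_left N (show u * P + 1 ≤ h from h1)
      rw [mul_add, mul_one] at this
      omega
    · have := Nat.mul_le_mul_left N (show h + 1 ≤ u * P from h1)
      rw [mul_add, mul_one] at this
      omega
  · obtain ⟨w, hw⟩ := Nat.exists_eq_add_of_lt hrN
    rw [show N - r = w + 1 by omega]
    have e : P * r + P * (w + 1) = N * P := by rw [hw]; ring
    by_contra! hc
    have h1 : h < P + u * P := by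
      by_contra! h2
      have := Nat.mul_le_mul_left N h2
      rw [mul_add] at this
      have e' : N * P = P * N := mul_comm _ _
      have : 0 < P * (w + 1) := Nat.mul_pos (pow_pos (by omega) _) (by omega)
      omega
    have := Nat.mul_le_mul_left N (show h + 1 ≤ P + u * P from h1)
    rw [mul_add, mul_add, mul_one] at this
    omega

lemma sub_one_mul_sum_Ico_pow {p f m : ℕ} (u : ℕ) (hmu : m + 1 ≤ u) (huf : u ≤ f) :
    ((p : ℝ) - 1) * ∑ t ∈ Finset.Ico (m + 1) u, (p : ℝ) ^ (f - t) + (p : ℝ) ^ (f + 1 - u) = (p : ℝ) ^ (f - m) := by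
  induction u, hmu using Nat.le_induction with
  | base => simp [Nat.add_sub_add_right]
  | succ u hu ih =>
    rw [Finset.sum_Ico_succ_top hu, ← ih (by omega), show f + 1 - (u + 1) = f - u by omega,
      show f + 1 - u = f - u + 1 by omega, pow_succ]
    ring

lemma one_div_abs_sin_le {p f h t : ℕ} (hp : 1 < p) (hh : 0 < h) (hhN : h < p ^ f - 1)
    (ht : t < f) (hph : ¬ p ∣ h) :
    1 / |Real.sin (Real.pi * (h * p ^ t : ℕ) / (p ^ f - 1 : ℕ))| ≤
      (p : ℝ) ^ (f - t) * ((p ^ f - 1 : ℕ) / (Real.pi * ((p ^ f - 1 : ℕ) - h))) + 1 / 2 := by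
  have hd := sub_le_pow_mul_distMultiple hp hh hhN ht hph
  set N := p ^ f - 1
  have hN : 0 < N := by omega
  have hd2 : 2 * distMultiple N (h * p ^ t) ≤ N := by unfold distMultiple; omega
  rw [abs_sin_pi_mul_div_eq hN]
  set d := distMultiple N (h * p ^ t)
  have hd0 : 0 < d := Nat.pos_of_ne_zero fun e => by rw [e] at hd; omega
  have hNR : (0 : ℝ) < N := by exact_mod_cast hN
  have hdR : (0 : ℝ) < d := by exact_mod_cast hd0
  have hd2R : (2 : ℝ) * d ≤ N := by exact_mod_cast hd2
  have hhR : (h : ℝ) < N := by exact_mod_cast hhN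
  have hdist : (N : ℝ) - h ≤ (p : ℝ) ^ (f - t) * d := by
    rw [← Nat.cast_sub hhN.le]
    exact_mod_cast hd
  have hpi := Real.pi_pos
  have hy : 0 < Real.pi * d / N := by positivity
  have hy2 : Real.pi * d / N ≤ Real.pi / 2 := by rw [div_le_iff₀ hNR]; nlinarith
  have hsin : 0 < Real.sin (Real.pi * d / N) := Real.sin_pos_of_pos_of_lt_pi hy (by linarith)
  have h1 := div_sin_le_one_add_half hy (by linarith [Real.pi_lt_d4])
  rw [abs_of_pos hsin]
  have h2 : 1 / Real.sin (Real.pi * d / N) ≤ 1 / (Real.pi * d / N) + 1 / 2 := by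
    have : 1 / Real.sin (Real.pi * d / N) =
        Real.pi * d / N / Real.sin (Real.pi * d / N) / (Real.pi * d / N) := by
      generalize Real.pi * d / N = y at hy
      field_simp
    rw [this, div_le_iff₀ hy]
    generalize Real.pi * d / N = y at hy h1
    have : (1 / y + 1 / 2) * y = 1 + y / 2 := by field_simp
    linarith
  refine h2.trans (add_le_add_left ?_ _)
  rw [one_div_div, ← mul_div_assoc, div_le_div_iff₀ (by positivity) (mul_pos hpi (by linarith))]
  nlinarith [mul_le_mul_of_nonneg_left hdist (by positivity : 0 ≤ N * Real.pi)]

lemma sum_range_pow_le {p : ℕ} (hp : 2 ≤ p) (m : ℕ) :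
    ∑ t ∈ Finset.range (m + 1), (p : ℝ) ^ t ≤ 2 * (p : ℝ) ^ m := by
  have hp' : (2 : ℝ) ≤ p := by exact_mod_cast hp
  induction m with
  | zero => simp
  | succ m ih =>
    rw [Finset.sum_range_succ]
    have : (0 : ℝ) < (p : ℝ) ^ m := by positivity
    rw [pow_succ (p : ℝ) m]
    nlinarith

lemma sub_one_mul_sum_range_inv_pow {p : ℕ} (hp : 0 < p) (m : ℕ) :
    ((p : ℝ) - 1) * ∑ t ∈ Finset.range (m + 1), 1 / (p : ℝ) ^ t = p - 1 / (p : ℝ) ^ m := by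
  have hp' : (0 : ℝ) < p := by exact_mod_cast hp
  induction m with
  | zero => simp
  | succ m ih =>
    rw [Finset.sum_range_succ, mul_add, ih]
    field_simp
    ring

lemma lt_of_scaled_lt {p n m l I G Q N B : ℝ} (hp : 1 < p) (hn : 0 ≤ n) (hlm : l ≤ m) (hQ : 0 ≤ Q)
    (hI : (p - 1) * I ≤ B)
    (hgap : (p - 1) * (n * (Real.pi * (7 * m / 6 + 529 / 300))) + n * B * Q < N / 2 * ((p - 1) * G)) :
    2 * n / 3 * (m + 1 + 1645 / 1000) + n * (I * (Q / Real.pi) + l / 2) < N / (2 * Real.pi) * G := by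
  have hpi := Real.pi_pos
  have hp1 : 0 < p - 1 := by linarith
  refine lt_of_mul_lt_mul_left (a := Real.pi * (p - 1)) ?_ (by positivity)
  have e2 : Real.pi * (p - 1) * (N / (2 * Real.pi) * G) = N / 2 * ((p - 1) * G) := by field_simp
  have e3 : Real.pi * (p - 1) * (2 * n / 3 * (m + 1 + 1645 / 1000) + n * (I * (Q / Real.pi) + l / 2)) =
      (p - 1) * (n * (Real.pi * (2 / 3 * (m + 1 + 1645 / 1000) + l / 2))) + n * ((p - 1) * I) * Q := by
    field_simp
    ring
  rw [e2, e3]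
  refine lt_of_le_of_lt ?_ hgap
  have h1 : Real.pi * (2 / 3 * (m + 1 + 1645 / 1000) + l / 2) ≤ Real.pi * (7 * m / 6 + 529 / 300) :=
    mul_le_mul_of_nonneg_left (by linarith) hpi.le
  gcongr

set_option maxHeartbeats 800000 in
lemma powerSumGap_of_le {p f n h : ℕ} (hp : p.Prime) (hq : 4096 ≤ p ^ f)
    (hn : 4 * (n - 1) ^ 2 * p ^ f < (p ^ f - 1) ^ 2) (hh : 1 ≤ h) (hhn : h ≤ n) (hph : ¬ p ∣ h) :
    PowerSumGap p f n (1 / 3) h := by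
  have hf : 0 < f := Nat.pos_of_ne_zero fun e => by simp [e] at hq
  obtain ⟨m, l, hl, hfm, hlm⟩ : ∃ m l, f = m + 1 + l ∧ f ≤ 2 * m + 1 ∧ 2 * m ≤ f :=
    ⟨f / 2, f - 1 - f / 2, by omega, by omega, by omega⟩
  have hpR : (2 : ℝ) ≤ p := by exact_mod_cast hp.two_le
  have hpi := Real.pi_pos
  have hpi4 := Real.pi_lt_d4
  have hqR : (4096 : ℝ) ≤ (p : ℝ) ^ f := by exact_mod_cast hq
  set s := Real.sqrt ((p : ℝ) ^ f) with hs
  have hs2 : s ^ 2 = (p : ℝ) ^ f := Real.sq_sqrt (by positivity)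
  have hs0 : 0 ≤ s := Real.sqrt_nonneg _
  have hs64 : 64 ≤ s := by nlinarith
  set σ := Real.sqrt (p : ℝ) with hσ
  have hσ2 : σ ^ 2 = p := Real.sq_sqrt (by positivity)
  have hσ0 : 0 < σ := Real.sqrt_pos.mpr (by positivity)
  have hN : ((p ^ f - 1 : ℕ) : ℝ) = s ^ 2 - 1 := by
    rw [hs2, Nat.cast_sub (by omega)]; push_cast; ring
  have hnR : (n : ℝ) ≤ s / 2 + 1 := by
    have h1 : 4 * (n - 1) ^ 2 < p ^ f := by
      by_contra! hc
      have h2 := Nat.mul_le_mul_right (p ^ f) hc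
      have h3 : (p ^ f - 1) ^ 2 ≤ p ^ f * p ^ f := by
        rw [sq]; exact Nat.mul_le_mul (Nat.sub_le _ _) (Nat.sub_le _ _)
      omega
    have h2 : ((2 * (n - 1 : ℕ) : ℝ)) ^ 2 < s ^ 2 := by
      rw [hs2]
      have : ((4 * (n - 1) ^ 2 : ℕ) : ℝ) < ((p ^ f : ℕ) : ℝ) := by exact_mod_cast h1
      push_cast at this
      linarith
    have h3 := lt_of_pow_lt_pow_left₀ 2 hs0 h2
    have h4 : (n : ℝ) = (n - 1 : ℕ) + 1 := by
      rw [← Nat.cast_add_one, Nat.sub_add_cancel (by omega)]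
    linarith
  have hn0 : (0 : ℝ) < n := by exact_mod_cast (by omega : 0 < n)
  have hh0 : (0 : ℝ) < h := by exact_mod_cast hh
  have hhnR : (h : ℝ) ≤ n := by exact_mod_cast hhn
  have hnN : (n : ℝ) < (p ^ f - 1 : ℕ) := by rw [hN]; nlinarith
  have hhN : h < p ^ f - 1 := by exact_mod_cast hhnR.trans_lt hnN
  have hpm : (p : ℝ) ^ m ≤ s := by
    refine le_of_pow_le_pow_left₀ two_ne_zero hs0 ?_
    rw [hs2, ← pow_mul]
    exact pow_le_pow_right₀ (by linarith) (by omega)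
  set N : ℝ := ((p ^ f - 1 : ℕ) : ℝ) with hNdef
  have hN0 : 0 < N := hn0.trans hnN
  set S := Finset.range (m + 1) with hS
  set y : ℕ → ℝ := fun t => Real.pi * (h * p ^ t : ℕ) / N with hy
  have hy0 : ∀ t, 0 < y t := fun t => by
    have : (0 : ℝ) < (h * p ^ t : ℕ) := by exact_mod_cast Nat.mul_pos hh (pow_pos hp.pos _)
    simp only [hy]; positivity
  have hpt : ∀ t ∈ S, (p : ℝ) ^ t ≤ (p : ℝ) ^ m := fun t ht =>
    pow_le_pow_right₀ (by linarith) (by have := Finset.mem_range.mp ht; omega)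
  have hhm : h * (p : ℝ) ^ m ≤ (s / 2 + 1) * s :=
    mul_le_mul (hhnR.trans hnR) hpm (by positivity) (by positivity)
  have hym : Real.pi * (h * (p : ℝ) ^ m) / N ≤ 1645 / 1000 := by
    rw [div_le_iff₀ hN0, hN]
    have : Real.pi * (h * (p : ℝ) ^ m) ≤ 31416 / 10000 * ((s / 2 + 1) * s) :=
      mul_le_mul (by linarith) hhm (by positivity) (by norm_num)
    nlinarith
  have hyt : ∀ t ∈ S, y t ≤ 1645 / 1000 := fun t ht => by
    refine le_trans ?_ hym
    simp only [hy]
    push_cast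
    have := hpt t ht
    gcongr
  have hysum : ∑ t ∈ S, y t ≤ 2 * (1645 / 1000) := by
    calc ∑ t ∈ S, y t = Real.pi * h / N * ∑ t ∈ S, (p : ℝ) ^ t := by
          rw [Finset.mul_sum]
          refine Finset.sum_congr rfl fun t _ => ?_
          simp only [hy]; push_cast; ring
      _ ≤ Real.pi * h / N * (2 * (p : ℝ) ^ m) :=
          mul_le_mul_of_nonneg_left (sum_range_pow_le hp.two_le m) (by positivity)
      _ = 2 * (Real.pi * (h * (p : ℝ) ^ m) / N) := by ring
      _ ≤ _ := by linarith
  have hfirst : ∑ t ∈ S, y t / Real.sin (y t) * (2 * (n * (1 / 3))) ≤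
      2 * n / 3 * (m + 1 + 1645 / 1000) := by
    rw [← Finset.sum_mul]
    have h1 : ∑ t ∈ S, y t / Real.sin (y t) ≤ ∑ t ∈ S, (1 + y t / 2) :=
      Finset.sum_le_sum fun t ht => div_sin_le_one_add_half (hy0 t) (hyt t ht)
    rw [Finset.sum_add_distrib, ← Finset.sum_div, Finset.sum_const, hS, Finset.card_range,
      nsmul_one] at h1
    push_cast at h1
    have h2 : ∑ t ∈ S, y t / Real.sin (y t) ≤ m + 1 + 1645 / 1000 := by linarith
    nlinarith
  have hsecond : ∑ t ∈ Finset.range f \ S, n / |Real.sin (y t)| ≤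
      n * ((∑ t ∈ Finset.Ico (m + 1) f, (p : ℝ) ^ (f - t)) * (N / (Real.pi * (N - n))) + l / 2) := by
    have h1 : Finset.range f \ S = Finset.Ico (m + 1) f := by
      ext t; simp [hS]; omega
    rw [h1, Finset.sum_mul]
    have h2 : ((l : ℝ) / 2) = ∑ t ∈ Finset.Ico (m + 1) f, (1 / 2 : ℝ) := by
      rw [Finset.sum_const, Nat.card_Ico, nsmul_eq_mul, show f - (m + 1) = l by omega]; ring
    rw [h2, ← Finset.sum_add_distrib, Finset.mul_sum]
    refine Finset.sum_le_sum fun t ht => ?_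
    have h3 := one_div_abs_sin_le hp.one_lt hh hhN (Finset.mem_Ico.mp ht).2 hph
    rw [div_eq_mul_one_div]
    refine mul_le_mul_of_nonneg_left (h3.trans ?_) hn0.le
    have : 0 < N - n := by linarith
    gcongr
  have hthird : N / (2 * Real.pi) * ∑ t ∈ S, 1 / (p : ℝ) ^ t ≤
      h * ∑ t ∈ S, 1 / (2 * Real.sin (y t)) := by
    rw [Finset.mul_sum, Finset.mul_sum]
    refine Finset.sum_le_sum fun t ht => ?_
    have h1 : 0 < Real.sin (y t) :=
      Real.sin_pos_of_pos_of_lt_pi (hy0 t) (by linarith [hyt t ht, Real.pi_gt_three])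
    have h2 := Real.sin_le (hy0 t).le
    have h3 : N / (2 * Real.pi) * (1 / (p : ℝ) ^ t) = h * (1 / (2 * y t)) := by
      simp only [hy]; push_cast; field_simp
    rw [h3]
    gcongr
  refine ⟨S, Finset.range_subset_range.mpr (by omega), fun t ht => ?_, ?_⟩
  · have h1 := hyt t ht
    have : ((h * p ^ t : ℕ) : ℝ) < N := by
      simp only [hy] at h1
      rw [div_le_iff₀ hN0] at h1
      nlinarith [Real.pi_gt_three]
    exact Nat.cast_lt.mp this
  · have hB : (p : ℝ) ^ (f - m) ≤ σ * s := by
      refine le_of_pow_le_pow_left₀ two_ne_zero (by positivity) ?_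
      rw [mul_pow, hσ2, hs2, ← pow_mul, ← pow_succ']
      exact pow_le_pow_right₀ (by linarith) (by omega)
    have ha : 1 / (p : ℝ) ^ m ≤ σ / s := by
      rw [div_le_div_iff₀ (by positivity) (by linarith), one_mul]
      refine le_of_pow_le_pow_left₀ two_ne_zero (by positivity) ?_
      rw [mul_pow, hσ2, hs2, ← pow_mul, ← pow_succ']
      exact pow_le_pow_right₀ (by linarith) (by omega)
    have h2m : (2 : ℝ) ^ m ≤ s := (pow_le_pow_left₀ (by norm_num) hpR m).trans hpm
    have hgap := gap_inequality hs64 (by rw [hσ2]; exact hpR) hσ0 hN hnR (by positivity) hB ha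
      (by positivity) (seven_mul_add_le hs64 h2m)
    rw [hσ2] at hgap
    refine lt_of_le_of_lt (add_le_add hfirst hsecond) (lt_of_lt_of_le ?_ hthird)
    have hI := sub_one_mul_sum_Ico_pow (p := p) (m := m) f (by omega) le_rfl
    have hG := sub_one_mul_sum_range_inv_pow hp.pos m
    set I := ∑ t ∈ Finset.Ico (m + 1) f, (p : ℝ) ^ (f - t)
    set G := ∑ t ∈ S, 1 / (p : ℝ) ^ t
    have hlmR : (l : ℝ) ≤ m := by exact_mod_cast (by omega : l ≤ m)
    have hNn : 0 < N - n := by linarith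
    have hp1 : (0 : ℝ) < p - 1 := by linarith
    have hI' : ((p : ℝ) - 1) * I ≤ (p : ℝ) ^ (f - m) := by
      have : (0 : ℝ) < (p : ℝ) ^ (f + 1 - f) := by positivity
      linarith
    rw [← hG] at hgap
    have hQ : 0 < N / (N - n) := by positivity
    have e1 : N / (Real.pi * (N - n)) = N / (N - n) / Real.pi := by field_simp
    rw [e1]
    set Q := N / (N - n)
    exact lt_of_scaled_lt (by linarith) hn0.le hlmR hQ.le hI' hgap

lemma odd_of_mul_sub_one_eq {p f n R : ℕ} (hf : 0 < f) (hn : 1 ≤ n)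
    (hR : R * (p ^ f - 1) = (p ^ f) ^ n - 1) (h : p = 2 ∨ p = 3 ∧ f = 4 ∧ n = 5) : Odd R := by
  rcases h with rfl | ⟨rfl, rfl, rfl⟩
  · have h1 : Odd ((2 ^ f) ^ n - 1) := by
      rw [← pow_mul]
      exact Nat.Even.sub_odd Nat.one_le_two_pow
        ((Nat.even_pow' (by positivity)).mpr even_two) odd_one
    rw [← hR] at h1
    exact (Nat.odd_mul.mp h1).1
  · norm_num at hR
    rw [Nat.odd_iff]
    omega

lemma lt_pow_sub_one {q n : ℕ} (hn : 2 ≤ n) (h : 4 * (n - 1) ^ 2 * q < (q - 1) ^ 2) :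
    n < q - 1 ∧ 4 * (n - 1) ^ 2 < q := by
  have h1 : 4 * (n - 1) ^ 2 < q := by
    by_contra! hc
    have h2 := Nat.mul_le_mul_right q hc
    have h3 : (q - 1) ^ 2 ≤ q * q := by
      rw [sq]; exact Nat.mul_le_mul (Nat.sub_le _ _) (Nat.sub_le _ _)
    omega
  refine ⟨?_, h1⟩
  obtain ⟨k, rfl⟩ : ∃ k, n = k + 2 := ⟨n - 2, by omega⟩
  rw [show k + 2 - 1 = k + 1 by omega] at h1
  have : k + 1 ≤ (k + 1) ^ 2 := Nat.le_self_pow two_ne_zero _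
  omega

theorem exists_modEq_of_sum_digits_eq {p f n R x x' : ℕ} (hp : p.Prime) (hf : 0 < f) (hn : 1 ≤ n)
    (hR : R * (p ^ f - 1) = (p ^ f) ^ n - 1) (hbound : 4 * (n - 1) ^ 2 * p ^ f < (p ^ f - 1) ^ 2)
    (hs : ∀ κ : ℕ, κ.Coprime ((p ^ f) ^ n - 1) → ∀ b : ℕ,
      (p.digits ((κ * x + b * R) % ((p ^ f) ^ n - 1))).sum =
        (p.digits ((κ * x' + b * R) % ((p ^ f) ^ n - 1))).sum) :
    ∃ j : ℕ, x ≡ (p ^ f) ^ j * x' [MOD (p ^ f) ^ n - 1] := by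
  have hs1 := hs 1 (Nat.coprime_one_left _)
  simp only [one_mul] at hs1
  by_cases hx : R ∣ x
  · exact ⟨0, by simpa using modEq_of_dvd_of_sum_digits_eq hp.one_lt hf hR hx hs1⟩
  by_cases hx' : R ∣ x'
  · exact ⟨0, by simpa using
      (modEq_of_dvd_of_sum_digits_eq hp.one_lt hf hR hx' fun b => (hs1 b).symm).symm⟩
  have hn2 : 2 ≤ n := by
    by_contra! hc
    obtain rfl : n = 1 := by omega
    have hN : 0 < p ^ f - 1 := by have := Nat.one_lt_pow hf.ne' hp.one_lt; omega
    rw [pow_one] at hR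
    obtain rfl : R = 1 := Nat.eq_of_mul_eq_mul_right hN (hR.trans (one_mul _).symm)
    exact hx (one_dvd x)
  obtain ⟨hnN, hnq⟩ := lt_pow_sub_one hn2 hbound
  obtain rfl | hf2 : f = 1 ∨ 2 ≤ f := by omega
  · by_cases hp11 : 11 ≤ p
    · have hp12 : p ≠ 12 := by rintro rfl; norm_num at hp
      refine exists_modEq_of_powerSumGap (β := 1 / 3) hp hf hn hR hnN hs hx hx'
        (fun o ho _ => coprimeDev_le ho) fun h hh hhn _ => ?_
      push_cast
      exact powerSumGap_one (mul_lt_of_four_mul_sq_mul_lt hp11 hp12 hn (by simpa using hbound)) hh hhn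
    · obtain rfl : p = 7 := by
        rw [pow_one] at hbound
        obtain ⟨k, rfl⟩ : ∃ k, n = k + 2 := ⟨n - 2, by omega⟩
        rw [show k + 2 - 1 = k + 1 by omega] at hbound
        have hk : 1 ≤ (k + 1) ^ 2 := Nat.one_le_pow _ _ (by omega)
        interval_cases p <;> first
          | rfl
          | (exfalso; revert hp; norm_num; done)
          | (norm_num at hbound <;> omega)
      obtain rfl : n = 2 := by
        obtain ⟨k, rfl⟩ : ∃ k, n = k + 2 := ⟨n - 2, by omega⟩
        rw [show k + 2 - 1 = k + 1 by omega] at hnq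
        have : (k + 1) * (k + 1) < 2 := by nlinarith
        have : k = 0 := by nlinarith
        omega
      exact exists_modEq_of_tableCheck hp.one_lt hf hn hR tableCheck_7_1_2 hs1
  · by_cases hq : 4096 ≤ p ^ f
    · refine exists_modEq_of_powerSumGap (β := 1 / 3) hp hf hn hR hnN hs hx hx'
        (fun o ho _ => coprimeDev_le ho) fun h hh hhn hph => ?_
      push_cast
      exact powerSumGap_of_le hp hq hbound hh hhn hph
    by_cases hadm : isAdmissible p f n = true
    · refine exists_modEq_of_powerSumGap (β := (coprimeDevConst p f n / 15 : ℚ)) hp hf hn hR hnN hs hx hx'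
        (fun o ho hoR => coprimeDev_le_coprimeDevConst ho hoR (odd_of_mul_sub_one_eq hf hn hR))
        fun h hh hhn hph => ?_
      have hn33 : n ≤ 33 := by
        by_contra! hc
        have : 33 ^ 2 ≤ (n - 1) ^ 2 := Nat.pow_le_pow_left (by omega) 2
        omega
      push_cast
      exact powerSumGap_of_lt hp hf2 (by omega) (33 - n) n (by omega) hn2 hadm h hh hhn hph
    · have hex : (p, f, n) ∈ smallExceptions := by
        by_contra hc
        apply hadm
        rw [isAdmissible, Bool.and_eq_true, Nat.blt_eq]
        refine ⟨hbound, ?_⟩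
        rw [Bool.not_eq_true', List.any_eq_false]
        rintro ⟨a, b, c⟩ ha hh
        simp only [Bool.and_eq_true, beq_iff_eq] at hh
        obtain ⟨⟨rfl, rfl⟩, rfl⟩ := hh
        exact hc ha
      simp only [smallExceptions, List.mem_cons, List.not_mem_nil, or_false, Prod.mk.injEq] at hex
      obtain ⟨rfl, rfl, rfl⟩ | ⟨rfl, rfl, rfl⟩ | ⟨rfl, rfl, rfl⟩ | ⟨rfl, rfl, rfl⟩ | ⟨rfl, rfl, rfl⟩ |
        ⟨rfl, rfl, rfl⟩ := hex
      · exact exists_modEq_of_tableCheck hp.one_lt hf hn hR tableCheck_2_3_2 hs1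
      · exact exists_modEq_of_tableCheck hp.one_lt hf hn hR tableCheck_2_4_2 hs1
      · exact exists_modEq_of_tableCheck hp.one_lt hf hn hR tableCheck_3_2_2 hs1
      · exact exists_modEq_of_tableCheck hp.one_lt hf hn hR tableCheck_5_2_3 hs1
      · exact exists_modEq_of_tableCheck hp.one_lt hf hn hR tableCheck_3_3_3 hs1
      · exact exists_modEq_of_tableCheck hp.one_lt hf hn hR tableCheck_2_5_3 hs1

theorem gauss_sum_converse_of_small_n
    (q n : ℕ) (hq : IsPrimePow q) (hn : 1 ≤ n)
    (hbound : (n : ℝ) < ((q : ℝ) - 1) / (2 * Real.sqrt q) + 1)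
    (F E : Type) [Field F] [Field E] [Fintype F] [Fintype E] [Algebra F E]
    (hF : Fintype.card F = q) (hE : Fintype.card E = q ^ n)
    (ψ : AddChar F ℂ) (hψ : ψ ≠ 1)
    (χ₁ χ₂ : Eˣ →* ℂˣ)
    (h : ∀ η : Fˣ →* ℂˣ, twistedGaussSum F χ₁ η ψ = twistedGaussSum F χ₂ η ψ) :
    ∃ j : ℕ, ∀ x : Eˣ, χ₁ x = χ₂ (x ^ q ^ j) := by
  obtain ⟨p, f, hp, hf, rfl⟩ := (isPrimePow_nat_iff q).mp hq
  have : Fact p.Prime := ⟨hp⟩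
  obtain ⟨R, hR⟩ : ∃ R, R * (p ^ f - 1) = (p ^ f) ^ n - 1 := by
    obtain ⟨R, hR⟩ := Nat.sub_dvd_pow_sub_pow (p ^ f) 1 n
    rw [one_pow] at hR
    exact ⟨R, by rw [hR, mul_comm]⟩
  obtain ⟨ω, x, x', rfl, rfl, hs⟩ :=
    exists_exponents_sum_digits_eq hf hn F E hF hE hR ψ hψ χ₁ χ₂ h
  obtain ⟨j, hj⟩ := exists_modEq_of_sum_digits_eq hp hf hn hR
    (four_mul_sq_mul_lt (pow_pos hp.pos f) hn hbound) hs
  refine ⟨j, fun y => ?_⟩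
  have hcard : ω y ^ ((p ^ f) ^ n - 1) = 1 := by
    rw [← map_pow, ← hE, ← Fintype.card_units, pow_card_eq_one, map_one]
  rw [MonoidHom.pow_apply, MonoidHom.pow_apply, map_pow, ← pow_mul]
  exact pow_eq_pow_iff_modEq.mpr (hj.of_dvd (orderOf_dvd_of_pow_eq_one hcard))
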